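/- Let 1 < q < 2, λ, μ > 0 and φ ∈ L¹(ℝ), and let u = u^μ_λ be the classical solution of the rescaled regularized problem. Then for every 0 < t₁ < t₂ < ∞ there exists a constant C(t₁, ‖φ‖_{L¹(ℝ)}, q) > 0, independent of λ, μ and t₂, such that λ^q ∫_{t₁}^{t₂} ∫_ℝ ∫_ℝ J_λ(x−y)·(u(t,x) − u(t,y))² dx dy dt ≤ C(t₁, ‖φ‖_{L¹(ℝ)}, q). -/

import Mathlib

open MeasureTheory Filter ENNReal

/-- `u` is a classical solution of the rescaled regularized problem
`u_t + |u|^{q-1} u_x = λ^q (J_λ ∗ u - u) + μ u_xx` with initial datum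
`φ_λ(x) = λ φ(λ x)`, where `J_λ(x) = λ J(λ x)`. -/
def IsRescaledSol (J : ℝ → ℝ) (q lam μ : ℝ) (φ : ℝ → ℝ) (u : ℝ → ℝ → ℝ) : Prop :=
  (∀ t : ℝ, 0 ≤ t → Integrable (u t)) ∧
  (∀ t₀ : ℝ, 0 ≤ t₀ →
    Tendsto (fun t => ∫ x, |u t x - u t₀ x|) (nhdsWithin t₀ (Set.Ici 0)) (nhds 0)) ∧
  (∀ t : ℝ, 0 < t → ContDiff ℝ 2 (u t)) ∧
  (∀ x : ℝ, ContDiffOn ℝ 1 (fun s => u s x) (Set.Ioi 0)) ∧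
  (∀ t : ℝ, 0 < t → ∀ x : ℝ,
    deriv (fun s => u s x) t + |u t x| ^ (q - 1) * deriv (u t) x
      = lam ^ q * ((∫ y, lam * J (lam * (x - y)) * u t y) - u t x)
        + μ * deriv (deriv (u t)) x) ∧
  (u 0 =ᵐ[volume] fun x => lam * φ (lam * x))

lemma hasDerivAt_maxsq (y : ℝ) : HasDerivAt (fun y : ℝ => (max y 0)^2) (2 * max y 0) y := by
  rcases lt_trichotomy y 0 with h | h | h
  · have : (fun y : ℝ => (max y 0)^2) =ᶠ[nhds y] fun _ => 0 := by
      filter_upwards [Iio_mem_nhds h] with z hz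
      simp [max_eq_right (Set.mem_Iio.1 hz).le]
    rw [max_eq_right h.le]
    simpa using (hasDerivAt_const y (0:ℝ)).congr_of_eventuallyEq this
  · subst h
    simp only [max_self, mul_zero]
    rw [hasDerivAt_iff_isLittleO]
    simp only [sub_zero, max_self, smul_zero, ne_eq, OfNat.ofNat_ne_zero, not_false_eq_true, zero_pow]
    have h2 : (fun y : ℝ => y^2) =o[nhds 0] (fun y : ℝ => y) := by
      have := Asymptotics.isLittleO_pow_id (𝕜 := ℝ) (n := 2) (by norm_num)
      simpa using this
    refine Asymptotics.IsBigO.trans_isLittleO ?_ h2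
    refine Asymptotics.isBigO_of_le _ fun y => ?_
    simp only [norm_pow, Real.norm_eq_abs]
    have : |max y 0| ≤ |y| := by
      rcases le_total y 0 with h | h
      · simp [h]
      · simp [h]
    gcongr
  · have : (fun y : ℝ => (max y 0)^2) =ᶠ[nhds y] fun y => y^2 := by
      filter_upwards [Ioi_mem_nhds h] with z hz
      rw [max_eq_left (le_of_lt hz)]
    rw [max_eq_left h.le]
    have h3 := (hasDerivAt_pow 2 y)
    simp only [Nat.cast_ofNat, Nat.add_one_sub_one, pow_one] at h3
    exact h3.congr_of_eventuallyEq this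

/-- FTC for the positive part of a `C¹` function. -/
lemma posFTC {y y' : ℝ → ℝ} {a b : ℝ} (hab : a ≤ b)
    (hy : ∀ t ∈ Set.Icc a b, HasDerivAt y (y' t) t) (hc : ContinuousOn y' (Set.Icc a b)) :
    ∫ t in a..b, (if 0 < y t then y' t else 0) = max (y b) 0 - max (y a) 0 := by
  have hyc : ContinuousOn y (Set.Icc a b) := fun t ht => (hy t ht).continuousAt.continuousWithinAt
  set e : ℕ → ℝ := fun n => 1 / ((n : ℝ) + 1) with he
  have hepos : ∀ n, 0 < e n := fun n => by positivity
  have he0 : Tendsto e atTop (nhds 0) := tendsto_one_div_add_atTop_nhds_zero_nat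
  have hpos : ∀ n z, 0 < (e n)^2 + (max z 0 : ℝ)^2 := fun n z => by
    have := hepos n; positivity
  have hS : ∀ n, ∀ t ∈ Set.Icc a b, HasDerivAt (fun t => Real.sqrt ((e n)^2 + (max (y t) 0)^2))
      (max (y t) 0 / Real.sqrt ((e n)^2 + (max (y t) 0)^2) * y' t) t := by
    intro n t ht
    have h1 := ((hasDerivAt_maxsq (y t)).const_add ((e n)^2)).sqrt (hpos n _).ne'
    have h2 := h1.comp t (hy t ht)
    refine h2.congr_deriv ?_
    field_simp
  have hFTC : ∀ n, ∫ t in a..b, max (y t) 0 / Real.sqrt ((e n)^2 + (max (y t) 0)^2) * y' t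
      = Real.sqrt ((e n)^2 + (max (y b) 0)^2) - Real.sqrt ((e n)^2 + (max (y a) 0)^2) := by
    intro n
    apply intervalIntegral.integral_eq_sub_of_hasDerivAt
    · rw [Set.uIcc_of_le hab]; exact hS n
    · apply ContinuousOn.intervalIntegrable
      rw [Set.uIcc_of_le hab]
      refine ContinuousOn.mul (ContinuousOn.div ?_ ?_ ?_) hc
      · exact hyc.sup continuousOn_const
      · exact (continuousOn_const.add ((hyc.sup continuousOn_const).pow 2)).sqrt
      · intro t _
        exact (Real.sqrt_pos.2 (hpos n _)).ne'
  have hlim1 : ∀ z : ℝ, Tendsto (fun n => Real.sqrt ((e n)^2 + (max z 0)^2)) atTop (nhds (max z 0)) := by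
    intro z
    have : Tendsto (fun n => Real.sqrt ((e n)^2 + (max z 0)^2)) atTop
        (nhds (Real.sqrt (0^2 + (max z 0)^2))) :=
      ((he0.pow 2).add_const _).sqrt
    simpa [Real.sqrt_sq] using this
  have hlimR := (hlim1 (y b)).sub (hlim1 (y a))
  have hlimL : Tendsto (fun n => ∫ t in a..b, max (y t) 0 / Real.sqrt ((e n)^2 + (max (y t) 0)^2) * y' t)
      atTop (nhds (∫ t in a..b, (if 0 < y t then y' t else 0))) := by
    apply intervalIntegral.tendsto_integral_filter_of_dominated_convergence (fun t => |y' t|)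
    · refine Eventually.of_forall fun n => ?_
      rw [Set.uIoc_of_le hab]
      refine ContinuousOn.aestronglyMeasurable (ContinuousOn.mono ?_ Set.Ioc_subset_Icc_self) measurableSet_Ioc
      refine ContinuousOn.mul (ContinuousOn.div ?_ ?_ ?_) hc
      · exact hyc.sup continuousOn_const
      · exact (continuousOn_const.add ((hyc.sup continuousOn_const).pow 2)).sqrt
      · intro t _
        exact (Real.sqrt_pos.2 (hpos n _)).ne'
    · refine Eventually.of_forall fun n => Eventually.of_forall fun t _ => ?_
      rw [norm_mul, Real.norm_eq_abs, Real.norm_eq_abs]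
      have hs := Real.sqrt_pos.2 (hpos n (y t))
      have : |max (y t) 0 / Real.sqrt ((e n)^2 + (max (y t) 0)^2)| ≤ 1 := by
        rw [abs_of_nonneg (by positivity), div_le_one hs]
        apply Real.le_sqrt_of_sq_le
        nlinarith [sq_nonneg (e n)]
      nlinarith [abs_nonneg (y' t)]
    · apply ContinuousOn.intervalIntegrable
      rw [Set.uIcc_of_le hab]; exact hc.abs
    · refine Eventually.of_forall fun t _ => ?_
      by_cases h : 0 < y t
      · simp only [h, if_true]
        have h1 := (hlim1 (y t))
        rw [max_eq_left h.le] at h1 ⊢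
        have h2 := (tendsto_const_nhds (x := y t)).div h1 h.ne'
        rw [div_self h.ne'] at h2
        simpa using h2.mul_const (y' t)
      · simp only [h, if_false]
        rw [max_eq_right (not_lt.1 h)]
        simp
  have := tendsto_nhds_unique hlimL (by simpa only [hFTC] using hlimR)
  exact this

lemma hasDerivAt_H {ε : ℝ} (hε : 0 < ε) (y : ℝ) :
    HasDerivAt (fun y : ℝ => (max y 0)^2 / (ε^2 + (max y 0)^2))
      (2 * ε^2 * max y 0 / (ε^2 + (max y 0)^2)^2) y := by
  have hp : ε^2 + (max y 0)^2 ≠ 0 := by positivity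
  have h := (hasDerivAt_maxsq y).div ((hasDerivAt_maxsq y).const_add (ε^2)) hp
  refine h.congr_deriv ?_
  field_simp
  ring

/-- One-dimensional Kato-type inequality. -/
lemma kato1 {f F w w1 w2 W W1 W2 : ℝ → ℝ} {μ α β : ℝ} (hμ : 0 < μ) (hαβ : α ≤ β)
    (hf : Continuous f) (hF : ∀ p, HasDerivAt F (f p) p)
    (hw : ∀ x, HasDerivAt w (w1 x) x) (hw1 : ∀ x, HasDerivAt w1 (w2 x) x) (hw2 : Continuous w2)
    (hW : ∀ x, HasDerivAt W (W1 x) x) (hW1 : ∀ x, HasDerivAt W1 (W2 x) x) (hW2 : Continuous W2)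
    (ha : w α ≤ W α) (hb : w β ≤ W β) :
    ∫ x in α..β, (if 0 < w x - W x then
      μ * (w2 x - W2 x) - (f (w x) * w1 x - f (W x) * W1 x) else 0) ≤ 0 := by
  have cw : Continuous w := continuous_iff_continuousAt.2 fun x => (hw x).continuousAt
  have cw1 : Continuous w1 := continuous_iff_continuousAt.2 fun x => (hw1 x).continuousAt
  have cW : Continuous W := continuous_iff_continuousAt.2 fun x => (hW x).continuousAt
  have cW1 : Continuous W1 := continuous_iff_continuousAt.2 fun x => (hW1 x).continuousAt
  have cF : Continuous F := continuous_iff_continuousAt.2 fun x => (hF x).continuousAt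
  set y : ℝ → ℝ := fun x => w x - W x with hy
  set y1 : ℝ → ℝ := fun x => w1 x - W1 x with hy1
  set h : ℝ → ℝ := fun x => F (w x) - F (W x) with hh
  set k : ℝ → ℝ := fun x => μ * (w2 x - W2 x) - (f (w x) * w1 x - f (W x) * W1 x) with hk
  have cy : Continuous y := cw.sub cW
  have cy1 : Continuous y1 := cw1.sub cW1
  have ch : Continuous h := (cF.comp cw).sub (cF.comp cW)
  have ck : Continuous k := (continuous_const.mul (hw2.sub hW2)).sub
    (((hf.comp cw).mul cw1).sub ((hf.comp cW).mul cW1))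
  have dy : ∀ x, HasDerivAt y (y1 x) x := fun x => (hw x).sub (hW x)
  have dG : ∀ x, HasDerivAt (fun x => μ * y1 x - h x) (k x) x := fun x =>
    (((hw1 x).sub (hW1 x)).const_mul μ).sub (((hF _).comp x (hw x)).sub ((hF _).comp x (hW x)))
  -- Lipschitz bound for `F`
  obtain ⟨A, hA⟩ : ∃ A, ∀ x ∈ Set.Icc α β, |w x| ≤ A := by
    obtain ⟨A, hA⟩ := isCompact_Icc.exists_bound_of_continuousOn (cw.continuousOn (s := Set.Icc α β))
    exact ⟨A, hA⟩
  obtain ⟨A', hA'⟩ : ∃ A, ∀ x ∈ Set.Icc α β, |W x| ≤ A := by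
    obtain ⟨A, hA⟩ := isCompact_Icc.exists_bound_of_continuousOn (cW.continuousOn (s := Set.Icc α β))
    exact ⟨A, hA⟩
  obtain ⟨Lc, hLc⟩ := isCompact_Icc.exists_bound_of_continuousOn
    (hf.continuousOn (s := Set.Icc (-(max A A')) (max A A')))
  have hLip : ∀ x ∈ Set.Icc α β, |h x| ≤ Lc * |y x| := by
    intro x hx
    have := (convex_Icc (-(max A A')) (max A A')).norm_image_sub_le_of_norm_hasDerivWithin_le
      (f := F) (f' := f) (C := Lc) (x := W x) (y := w x)
      (fun z _ => (hF z).hasDerivWithinAt) (fun z hz => hLc z hz)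
      (abs_le.1 ((hA' x hx).trans (le_max_right _ _)))
      (abs_le.1 ((hA x hx).trans (le_max_left _ _)))
    simpa [Real.norm_eq_abs] using this
  set e : ℕ → ℝ := fun n => 1 / ((n : ℝ) + 1) with he
  have hepos : ∀ n, 0 < e n := fun n => by positivity
  have he0 : Tendsto e atTop (nhds 0) := tendsto_one_div_add_atTop_nhds_zero_nat
  have hpos : ∀ n z, 0 < (e n)^2 + (max z 0 : ℝ)^2 := fun n z => by
    have := hepos n; positivity
  set H : ℕ → ℝ → ℝ := fun n z => (max z 0)^2 / ((e n)^2 + (max z 0)^2) with hH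
  set H1 : ℕ → ℝ → ℝ := fun n z => 2 * (e n)^2 * max z 0 / ((e n)^2 + (max z 0)^2)^2 with hH1
  have cH : ∀ n, Continuous (H n) := fun n =>
    continuous_iff_continuousAt.2 fun x => (hasDerivAt_H (hepos n) x).continuousAt
  have cH1 : ∀ n, Continuous (H1 n) := fun n => by
    refine Continuous.div (by fun_prop) (by fun_prop) fun z => ?_
    have := hpos n z
    positivity
  have key : ∀ n, ∫ x in α..β, H n (y x) * k x ≤ (2 * e n * Lc^2 / (4*μ)) * (β - α) := by
    intro n
    have hd : ∀ x, HasDerivAt (fun x => H n (y x) * (μ * y1 x - h x))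
        (H1 n (y x) * y1 x * (μ * y1 x - h x) + H n (y x) * k x) x := fun x =>
      ((hasDerivAt_H (hepos n) (y x)).comp x (dy x)).mul (dG x)
    have c1 : Continuous fun x => H1 n (y x) * y1 x * (μ * y1 x - h x) :=
      (((cH1 n).comp cy).mul cy1).mul ((continuous_const.mul cy1).sub ch)
    have c2 : Continuous fun x => H n (y x) * k x := ((cH n).comp cy).mul ck
    have hI := intervalIntegral.integral_eq_sub_of_hasDerivAt (a := α) (b := β)
      (fun x _ => hd x) ((c1.add c2).intervalIntegrable _ _)
    have z1 : H n (y α) = 0 := by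
      simp only [hH]; rw [max_eq_right (by simp only [hy]; linarith)]; simp
    have z2 : H n (y β) = 0 := by
      simp only [hH]; rw [max_eq_right (by simp only [hy]; linarith)]; simp
    rw [z1, z2, intervalIntegral.integral_add (c1.intervalIntegrable _ _)
      (c2.intervalIntegrable _ _)] at hI
    have hI2 : ∫ x in α..β, H n (y x) * k x
        = ∫ x in α..β, -(H1 n (y x) * y1 x * (μ * y1 x - h x)) := by
      rw [intervalIntegral.integral_neg]; linarith
    rw [hI2]
    have : ∫ x in α..β, (2 * e n * Lc^2 / (4*μ) : ℝ) = (2 * e n * Lc^2 / (4*μ)) * (β - α) := by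
      simp; ring
    rw [← this]
    apply intervalIntegral.integral_mono_on hαβ (c1.neg.intervalIntegrable _ _)
      (by simp)
    intro x hx
    have hH1n : 0 ≤ H1 n (y x) := by
      simp only [hH1]; positivity
    have s1 : -(y1 x * (μ * y1 x - h x)) ≤ (h x)^2 / (4*μ) := by
      rw [le_div_iff₀ (by positivity)]
      nlinarith [sq_nonneg (2 * μ * y1 x - h x)]
    have s2 : H1 n (y x) * (h x)^2 ≤ 2 * e n * Lc^2 := by
      have hl := hLip x hx
      have hsq : (h x)^2 ≤ Lc^2 * (y x)^2 := by
        have := pow_le_pow_left₀ (abs_nonneg _) hl 2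
        simpa [mul_pow, sq_abs] using this
      rcases le_or_gt (y x) 0 with hneg | hp
      · simp only [hH1]; rw [max_eq_right hneg]; simp
        have := (hepos n).le
        positivity
      · simp only [hH1]; rw [max_eq_left hp.le]
        have he' := hepos n
        have hden : 0 < ((e n)^2 + (y x)^2)^2 := by positivity
        calc 2 * e n ^ 2 * y x / (e n ^ 2 + y x ^ 2) ^ 2 * h x ^ 2
            ≤ 2 * e n ^ 2 * y x / (e n ^ 2 + y x ^ 2) ^ 2 * (Lc^2 * (y x)^2) := by
              gcongr
          _ = 2 * Lc^2 * ((e n)^2 * (y x)^3 / (e n ^ 2 + y x ^ 2) ^ 2) := by ring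
          _ ≤ 2 * Lc^2 * e n := by
              gcongr
              rw [div_le_iff₀ hden]
              have : e n * (y x)^3 ≤ ((e n)^2 + (y x)^2)^2 := by
                have a1 : e n * y x ≤ (e n)^2 + (y x)^2 := by nlinarith [sq_nonneg (e n - y x), sq_nonneg (e n), sq_nonneg (y x)]
                have a2 : (y x)^2 ≤ (e n)^2 + (y x)^2 := by nlinarith [sq_nonneg (e n)]
                calc e n * (y x)^3 = (e n * y x) * (y x)^2 := by ring
                  _ ≤ ((e n)^2 + (y x)^2) * ((e n)^2 + (y x)^2) := by gcongr
                  _ = _ := by ring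
              calc e n ^ 2 * y x ^ 3 = e n * (e n * y x ^ 3) := by ring
                _ ≤ _ := by gcongr
          _ = 2 * e n * Lc^2 := by ring
    calc -(H1 n (y x) * y1 x * (μ * y1 x - h x)) = H1 n (y x) * -(y1 x * (μ * y1 x - h x)) := by ring
      _ ≤ H1 n (y x) * ((h x)^2 / (4*μ)) := by gcongr
      _ = (H1 n (y x) * (h x)^2) / (4*μ) := by ring
      _ ≤ (2 * e n * Lc^2) / (4*μ) := by gcongr
  have hlimR : Tendsto (fun n => (2 * e n * Lc^2 / (4*μ)) * (β - α)) atTop (nhds 0) := by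
    have : Tendsto (fun n => (2 * e n * Lc^2 / (4*μ)) * (β - α)) atTop
        (nhds ((2 * 0 * Lc^2 / (4*μ)) * (β - α))) :=
      ((((he0.const_mul 2).mul_const _).div_const _).mul_const _)
    simpa using this
  have hlimL : Tendsto (fun n => ∫ x in α..β, H n (y x) * k x) atTop
      (nhds (∫ x in α..β, (if 0 < y x then k x else 0))) := by
    apply intervalIntegral.tendsto_integral_filter_of_dominated_convergence (fun t => |k t|)
    · exact Eventually.of_forall fun n => (((cH n).comp cy).mul ck).aestronglyMeasurable
    · refine Eventually.of_forall fun n => Eventually.of_forall fun t _ => ?_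
      rw [norm_mul, Real.norm_eq_abs, Real.norm_eq_abs]
      have : |H n (y t)| ≤ 1 := by
        simp only [hH]
        rw [abs_of_nonneg (div_nonneg (sq_nonneg _) (hpos n _).le), div_le_one (hpos n _)]
        nlinarith [sq_nonneg (e n)]
      nlinarith [abs_nonneg (k t)]
    · exact ck.abs.intervalIntegrable _ _
    · refine Eventually.of_forall fun t _ => ?_
      by_cases h : 0 < y t
      · simp only [h, if_true, hH]
        rw [max_eq_left h.le]
        have h1 : Tendsto (fun n => (y t)^2 / ((e n)^2 + (y t)^2)) atTop
            (nhds ((y t)^2 / (0^2 + (y t)^2))) := by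
          refine tendsto_const_nhds.div ((he0.pow 2).add_const _) ?_
          positivity
        have h2 : (y t)^2 / (0^2 + (y t)^2) = 1 := by
          rw [zero_pow (by norm_num), zero_add, div_self (by positivity)]
        rw [h2] at h1
        simpa using h1.mul_const (k t)
      · simp only [h, if_false, hH]
        rw [max_eq_right (not_lt.1 h)]
        simp
  exact le_of_tendsto_of_tendsto' hlimL hlimR key

def gapSet (E : Set ℝ) : Set (ℝ × ℝ) :=
  {p | p.1 ∈ E ∧ p.2 ∈ E ∧ p.1 < p.2 ∧ ∀ τ ∈ Set.Ioo p.1 p.2, τ ∉ E}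

lemma gapSet_disj (E : Set ℝ) :
    (gapSet E).PairwiseDisjoint (fun p => Set.Ioo p.1 p.2) := by
  intro p hp p' hp' hne
  rw [Function.onFun, Set.disjoint_left]
  intro τ h h'
  apply hne
  obtain ⟨h1, h2, _, h3⟩ := hp
  obtain ⟨k1, k2, _, k3⟩ := hp'
  obtain ⟨a1, a2⟩ := h
  obtain ⟨b1, b2⟩ := h'
  have e1 : p.1 = p'.1 := by
    rcases lt_trichotomy p.1 p'.1 with c | c | c
    · exact absurd k1 (h3 _ ⟨c, b1.trans a2⟩)
    · exact c
    · exact absurd h1 (k3 _ ⟨c, a1.trans b2⟩)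
  have e2 : p.2 = p'.2 := by
    rcases lt_trichotomy p.2 p'.2 with c | c | c
    · exact absurd h2 (k3 _ ⟨b1.trans a2, c⟩)
    · exact c
    · exact absurd k2 (h3 _ ⟨a1.trans b2, c⟩)
  exact Prod.ext e1 e2

lemma gapSet_countable (E : Set ℝ) : (gapSet E).Countable :=
  (gapSet_disj E).countable_of_isOpen (fun _ _ => isOpen_Ioo)
    (fun p hp => Set.nonempty_Ioo.2 hp.2.2.1)

lemma gapSet_cover {E : Set ℝ} (hE : IsClosed E) {s t : ℝ} (hs : s ∈ E) (ht : t ∈ E)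
    (hsub : E ⊆ Set.Icc s t) : Set.Icc s t = E ∪ ⋃ p : gapSet E, Set.Ioo p.1.1 p.1.2 := by
  apply Set.Subset.antisymm
  · intro τ hτ
    by_cases h : τ ∈ E
    · exact Or.inl h
    · right
      have c1 : IsClosed (E ∩ Set.Iic τ) := hE.inter isClosed_Iic
      have c2 : IsClosed (E ∩ Set.Ici τ) := hE.inter isClosed_Ici
      have m1 := c1.csSup_mem ⟨s, hs, hτ.1⟩ ⟨τ, fun z hz => hz.2⟩
      have m2 := c2.csInf_mem ⟨t, ht, hτ.2⟩ ⟨τ, fun z hz => hz.2⟩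
      set l := sSup (E ∩ Set.Iic τ) with hl
      set r := sInf (E ∩ Set.Ici τ) with hr
      have l1 : l < τ := lt_of_le_of_ne m1.2 fun hh => h (hh ▸ m1.1)
      have r1 : τ < r := lt_of_le_of_ne m2.2 fun hh => h (hh ▸ m2.1)
      refine Set.mem_iUnion.2 ⟨⟨(l, r), m1.1, m2.1, l1.trans r1, ?_⟩, l1, r1⟩
      intro z hz hzE
      rcases le_total z τ with c | c
      · exact absurd (le_csSup ⟨τ, fun z hz => hz.2⟩ (⟨hzE, c⟩ : z ∈ E ∩ Set.Iic τ)) (not_le.2 hz.1)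
      · exact absurd (csInf_le ⟨τ, fun z hz => hz.2⟩ (⟨hzE, c⟩ : z ∈ E ∩ Set.Ici τ)) (not_le.2 hz.2)
  · rintro τ (h | h)
    · exact hsub h
    · obtain ⟨p, hp⟩ := Set.mem_iUnion.1 h
      exact ⟨(hsub p.2.1).1.trans hp.1.le, hp.2.le.trans (hsub p.2.2.1).2⟩

lemma gap_hasSum {E : Set ℝ} (hE : IsClosed E) {s t : ℝ} (hs : s ∈ E) (ht : t ∈ E)
    (hsub : E ⊆ Set.Icc s t) {ψ : ℝ → ℝ} (hψ : IntegrableOn ψ (Set.Icc s t)) :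
    HasSum (fun p : gapSet E => ∫ τ in p.1.1..p.1.2, ψ τ)
      ((∫ τ in Set.Icc s t, ψ τ) - ∫ τ in E, ψ τ) := by
  have hc := gapSet_cover hE hs ht hsub
  have : Countable (gapSet E) := (gapSet_countable E).to_subtype
  have hm : ∀ p : gapSet E, MeasurableSet (Set.Ioo p.1.1 p.1.2) := fun _ => measurableSet_Ioo
  have hd : Pairwise (Function.onFun Disjoint fun p : gapSet E => Set.Ioo p.1.1 p.1.2) := by
    intro p p' hne
    exact gapSet_disj E p.2 p'.2 fun h => hne (Subtype.ext h)
  have hsub2 : (⋃ p : gapSet E, Set.Ioo p.1.1 p.1.2) ⊆ Set.Icc s t := by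
    rw [hc]; exact Set.subset_union_right
  have h1 := hasSum_integral_iUnion hm hd (hψ.mono_set hsub2)
  have hdis : Disjoint E (⋃ p : gapSet E, Set.Ioo p.1.1 p.1.2) := by
    rw [Set.disjoint_left]
    intro τ h h'
    obtain ⟨p, hp⟩ := Set.mem_iUnion.1 h'
    exact p.2.2.2.2 τ hp h
  have h2 := setIntegral_union (μ := volume) hdis (MeasurableSet.iUnion hm) (hψ.mono_set hsub) (hψ.mono_set hsub2)
  rw [← hc] at h2
  have h3 : (fun p : gapSet E => ∫ τ in p.1.1..p.1.2, ψ τ)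
      = fun p : gapSet E => ∫ τ in Set.Ioo p.1.1 p.1.2, ψ τ := by
    funext p
    rw [intervalIntegral.integral_of_le p.2.2.2.1.le, integral_Ioc_eq_integral_Ioo]
  rw [h3, h2, add_sub_cancel_left]
  exact h1

/-- generalized dominated convergence -/
lemma gdct {X ι : Type*} [MeasurableSpace X] {ν : Measure X} {l : Filter ι} [l.IsCountablyGenerated]
    {a : ι → X → ℝ} {b d : X → ℝ} {e : ι → X → ℝ}
    (ham : ∀ᶠ i in l, AEStronglyMeasurable (a i) ν) 
    (hd : Integrable d ν) (he : ∀ᶠ i in l, Integrable (e i) ν)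
    (hae : ∀ᶠ i in l, ∀ᵐ x ∂ν, |a i x| ≤ d x + e i x)
    (hb : ∀ᵐ x ∂ν, |b x| ≤ d x) (hlim : ∀ᵐ x ∂ν, Tendsto (fun i => a i x) l (nhds (b x)))
    (he0 : Tendsto (fun i => ∫ x, |e i x| ∂ν) l (nhds 0)) :
    Tendsto (fun i => ∫ x, a i x ∂ν) l (nhds (∫ x, b x ∂ν)) := by
  have hC : Tendsto (fun i => ∫ x, max (-d x) (min (d x) (a i x)) ∂ν) l (nhds (∫ x, b x ∂ν)) := by
    apply tendsto_integral_filter_of_dominated_convergence d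
    · filter_upwards [ham] with i hi
      exact hd.1.neg.sup (hd.1.inf hi)
    · refine Eventually.of_forall fun i => ?_
      filter_upwards [hb] with x hx
      have := (abs_nonneg _).trans hx
      rw [Real.norm_eq_abs, abs_le]
      exact ⟨le_max_left _ _, max_le (by linarith) (min_le_left _ _)⟩
    · exact hd
    · filter_upwards [hb, hlim] with x hx hl
      have h1 : Tendsto (fun i => max (-d x) (min (d x) (a i x))) l
        (nhds (max (-d x) (min (d x) (b x)))) :=
        tendsto_const_nhds.max (tendsto_const_nhds.min hl)
      rwa [min_eq_right (abs_le.1 hx).2, max_eq_right (abs_le.1 hx).1] at h1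
  have hD : Tendsto (fun i => ∫ x, (a i x - max (-d x) (min (d x) (a i x))) ∂ν) l (nhds 0) := by
    apply squeeze_zero_norm' _ he0
    filter_upwards [he, hae, ham] with i hi hi2 hi3
    refine (norm_integral_le_integral_norm _).trans ?_
    apply integral_mono_of_nonneg (Eventually.of_forall fun x => norm_nonneg _) hi.abs
    filter_upwards [hi2, hb] with x hx hbx
    have := (abs_nonneg _).trans hbx
    have h3 := abs_le.1 hx
    have h4 := le_abs_self (e i x)
    have h5 := abs_nonneg (e i x)
    rw [Real.norm_eq_abs, abs_le]
    constructor
    · rcases max_cases (-d x) (min (d x) (a i x)) with h | h <;>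
      rcases min_cases (d x) (a i x) with h' | h' <;> linarith
    · rcases max_cases (-d x) (min (d x) (a i x)) with h | h <;>
      rcases min_cases (d x) (a i x) with h' | h' <;> linarith
  have := hC.add hD
  rw [add_zero] at this
  refine this.congr' ?_
  filter_upwards [ham, he, hae] with i hi hi2 hi3
  have hia : Integrable (a i) ν := (hd.add hi2).mono' hi hi3
  rw [← integral_add]
  · congr 1; funext x; ring
  · exact hd.neg.sup (hd.inf hia)
  · exact hia.sub (hd.neg.sup (hd.inf hia))

structure Sol (f : ℝ → ℝ) (μ : ℝ) (u g ut ux uxx : ℝ → ℝ → ℝ) : Prop where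
  hμ : 0 < μ
  hf : Continuous f
  hfe : ∀ p, f (-p) = f p
  um : Measurable (Function.uncurry u)
  utm : Measurable (Function.uncurry ut)
  uxm : Measurable (Function.uncurry ux)
  ui : ∀ t, 0 < t → Integrable (u t)
  gi : ∀ t, 0 < t → Integrable (g t)
  uc : ∀ t₀, 0 < t₀ → Tendsto (fun t => ∫ x, |u t x - u t₀ x|) (nhds t₀) (nhds 0)
  gc : ∀ t₀, 0 < t₀ → Tendsto (fun t => ∫ x, |g t x - g t₀ x|) (nhds t₀) (nhds 0)
  hut : ∀ t, 0 < t → ∀ x, HasDerivAt (fun s => u s x) (ut t x) t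
  utc : ∀ x, ContinuousOn (fun s => ut s x) (Set.Ioi 0)
  hux : ∀ t, 0 < t → ∀ x, HasDerivAt (u t) (ux t x) x
  huxx : ∀ t, 0 < t → ∀ x, HasDerivAt (ux t) (uxx t x) x
  uxxc : ∀ t, 0 < t → Continuous (uxx t)
  pde : ∀ t, 0 < t → ∀ x, ut t x = g t x - f (u t x) * ux t x + μ * uxx t x

namespace Sol
variable {f : ℝ → ℝ} {μ : ℝ} {u g ut ux uxx : ℝ → ℝ → ℝ}

lemma neg (h : Sol f μ u g ut ux uxx) :
    Sol f μ (fun t x => - u t x) (fun t x => - g t x) (fun t x => - ut t x)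
      (fun t x => - ux t x) (fun t x => - uxx t x) where
  hμ := h.hμ
  hf := h.hf
  hfe := h.hfe
  um := h.um.neg
  utm := h.utm.neg
  uxm := h.uxm.neg
  ui t ht := (h.ui t ht).neg
  gi t ht := (h.gi t ht).neg
  uc t ht := by
    refine (h.uc t ht).congr fun s => ?_
    congr 1; funext x; rw [← abs_neg]; congr 1; ring
  gc t ht := by
    refine (h.gc t ht).congr fun s => ?_
    congr 1; funext x; rw [← abs_neg]; congr 1; ring
  hut t ht x := (h.hut t ht x).neg
  utc x := (h.utc x).neg
  hux t ht x := (h.hux t ht x).neg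
  huxx t ht x := (h.huxx t ht x).neg
  uxxc t ht := (h.uxxc t ht).neg
  pde t ht x := by rw [h.pde t ht x, h.hfe]; ring

lemma cu (h : Sol f μ u g ut ux uxx) {t : ℝ} (ht : 0 < t) : Continuous (u t) :=
  continuous_iff_continuousAt.2 fun x => (h.hux t ht x).continuousAt

lemma cux (h : Sol f μ u g ut ux uxx) {t : ℝ} (ht : 0 < t) : Continuous (ux t) :=
  continuous_iff_continuousAt.2 fun x => (h.huxx t ht x).continuousAt

lemma gii (h : Sol f μ u g ut ux uxx) {t : ℝ} (ht : 0 < t) (a b : ℝ) :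
    IntervalIntegrable (g t) volume a b := (h.gi t ht).intervalIntegrable

lemma uti (h : Sol f μ u g ut ux uxx) {t : ℝ} (ht : 0 < t) (a b : ℝ) :
    IntervalIntegrable (ut t) volume a b := by
  have : ut t = fun x => g t x + (- (f (u t x) * ux t x) + μ * uxx t x) := by
    funext x; rw [h.pde t ht x]; ring
  rw [this]
  refine (h.gii ht a b).add (Continuous.intervalIntegrable ?_ a b)
  exact (((h.hf.comp (h.cu ht)).mul (h.cux ht)).neg).add (continuous_const.mul (h.uxxc t ht))

end Sol

/-- L¹ difference quotient control on an interval -/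
lemma ii_le_full {k : ℝ → ℝ} (hk : Integrable k) {a b : ℝ} (hab : a ≤ b) :
    ∫ x in a..b, |k x| ≤ ∫ x, |k x| := by
  rw [intervalIntegral.integral_of_le hab]
  exact setIntegral_le_integral hk.abs (Eventually.of_forall fun x => abs_nonneg _)

noncomputable def Theta (α β : ℝ) (f : ℝ → ℝ) (μ : ℝ) (g : ℝ → ℝ → ℝ) (w w1 w2 : ℝ → ℝ) (m τ : ℝ) : ℝ :=
  ∫ x in α..β, max (g τ x - (m + f (w x + m * τ) * w1 x - μ * w2 x)) 0

noncomputable def Pos (α β : ℝ) (u : ℝ → ℝ → ℝ) (w : ℝ → ℝ) (m τ : ℝ) : ℝ :=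
  ∫ x in α..β, max (u τ x - (w x + m * τ)) 0

def Good (α β : ℝ) (f : ℝ → ℝ) (μ : ℝ) (u g : ℝ → ℝ → ℝ) (s t : ℝ) : Prop :=
  ∀ (w w1 w2 : ℝ → ℝ) (m : ℝ), (∀ x, HasDerivAt w (w1 x) x) → (∀ x, HasDerivAt w1 (w2 x) x) →
    Continuous w2 → (∀ τ ∈ Set.Icc s t, u τ α ≤ w α + m * τ) →
    (∀ τ ∈ Set.Icc s t, u τ β ≤ w β + m * τ) →
    Pos α β u w m t ≤ Pos α β u w m s + ∫ τ in s..t, Theta α β f μ g w w1 w2 m τ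

lemma max_sub_le (a b : ℝ) : |max a 0 - max b 0| ≤ |a - b| := by
  have := abs_max_sub_max_le_max a 0 b 0
  simpa using this

/-- continuity in time of an integral of positive part -/
lemma cont_pos {v : ℝ → ℝ → ℝ} {α β : ℝ} (hαβ : α ≤ β)
    (vi : ∀ t, 0 < t → Integrable (v t))
    (vc : ∀ t₀, 0 < t₀ → Tendsto (fun t => ∫ x, |v t x - v t₀ x|) (nhds t₀) (nhds 0))
    {ρ : ℝ → ℝ → ℝ} (hρ : Continuous (Function.uncurry ρ)) :
    ContinuousOn (fun τ => ∫ x in α..β, max (v τ x - ρ τ x) 0) (Set.Ioi 0) := by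
  intro t₀ ht₀
  apply ContinuousAt.continuousWithinAt
  have hρt : ∀ t, Continuous (ρ t) := fun t => hρ.comp (Continuous.prodMk_right t)
  have hii : ∀ t, 0 < t → IntervalIntegrable (fun x => v t x - ρ t x) volume α β := fun t ht =>
    (vi t ht).intervalIntegrable.sub ((hρt t).intervalIntegrable _ _)
  have hii' : ∀ t, 0 < t → IntervalIntegrable (fun x => max (v t x - ρ t x) 0) volume α β := by
    intro t ht
    have h := hii t ht
    rw [intervalIntegrable_iff] at h ⊢
    exact h.sup (integrable_zero _ _ _)
  have hρ0 : Tendsto (fun t => ∫ x in α..β, |ρ t x - ρ t₀ x|) (nhds t₀) (nhds 0) := by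
    have h1 : Continuous fun t => ∫ x in α..β, |ρ t x - ρ t₀ x| := by
      apply intervalIntegral.continuous_parametric_intervalIntegral_of_continuous'
      have : Continuous fun p : ℝ × ℝ => ρ t₀ p.2 := (hρt t₀).comp continuous_snd
      exact (hρ.sub this).abs
    have := h1.tendsto t₀
    simpa using this
  rw [ContinuousAt, tendsto_iff_norm_sub_tendsto_zero]
  have hsum := (vc t₀ ht₀).add hρ0
  rw [add_zero] at hsum
  apply squeeze_zero' (Eventually.of_forall fun t => norm_nonneg _) _ hsum
  filter_upwards [Ioi_mem_nhds ht₀] with t ht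
  have ht : 0 < t := ht
  have ht₀ : 0 < t₀ := ht₀
  rw [← intervalIntegral.integral_sub (hii' t ht) (hii' t₀ ht₀)]
  refine (intervalIntegral.norm_integral_le_integral_norm hαβ).trans ?_
  have i1 : IntervalIntegrable (fun x => |v t x - v t₀ x|) volume α β :=
    ((vi t ht).sub (vi t₀ ht₀)).abs.intervalIntegrable
  have i2 : IntervalIntegrable (fun x => |ρ t x - ρ t₀ x|) volume α β :=
    ((hρt t).sub (hρt t₀)).abs.intervalIntegrable _ _
  calc ∫ x in α..β, ‖max (v t x - ρ t x) 0 - max (v t₀ x - ρ t₀ x) 0‖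
      ≤ ∫ x in α..β, (|v t x - v t₀ x| + |ρ t x - ρ t₀ x|) := by
        apply intervalIntegral.integral_mono_on hαβ _ (i1.add i2)
        · intro x _
          refine (max_sub_le _ _).trans ?_
          have : v t x - ρ t x - (v t₀ x - ρ t₀ x) = (v t x - v t₀ x) - (ρ t x - ρ t₀ x) := by ring
          rw [this]
          exact abs_sub _ _
        · exact ((hii' t ht).sub (hii' t₀ ht₀)).norm
    _ = (∫ x in α..β, |v t x - v t₀ x|) + ∫ x in α..β, |ρ t x - ρ t₀ x| :=
        intervalIntegral.integral_add i1 i2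
    _ ≤ _ := by
        gcongr
        exact ii_le_full ((vi t ht).sub (vi t₀ ht₀)) hαβ

namespace Sol
variable {f : ℝ → ℝ} {μ : ℝ} {u g ut ux uxx : ℝ → ℝ → ℝ} {α β : ℝ}

lemma theta_cont (h : Sol f μ u g ut ux uxx) (hαβ : α ≤ β) {w w1 w2 : ℝ → ℝ} (m : ℝ)
    (hw : Continuous w) (hw1 : Continuous w1) (hw2 : Continuous w2) :
    ContinuousOn (Theta α β f μ g w w1 w2 m) (Set.Ioi 0) := by
  apply cont_pos hαβ h.gi h.gc (ρ := fun τ x => m + f (w x + m * τ) * w1 x - μ * w2 x)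
  have := h.hf
  simp only [Function.uncurry_def]
  fun_prop

lemma pos_cont (h : Sol f μ u g ut ux uxx) (hαβ : α ≤ β) {w : ℝ → ℝ} (m : ℝ)
    (hw : Continuous w) : ContinuousOn (Pos α β u w m) (Set.Ioi 0) := by
  apply cont_pos hαβ h.ui h.uc (ρ := fun τ x => w x + m * τ)
  simp only [Function.uncurry_def]
  fun_prop

lemma theta_ii (h : Sol f μ u g ut ux uxx) (hαβ : α ≤ β) {w w1 w2 : ℝ → ℝ} (m : ℝ)
    (hw : Continuous w) (hw1 : Continuous w1) (hw2 : Continuous w2) {s t : ℝ} (hs : 0 < s) (ht : 0 < t) :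
    IntervalIntegrable (Theta α β f μ g w w1 w2 m) volume s t := by
  apply ContinuousOn.intervalIntegrable
  refine (h.theta_cont hαβ m hw hw1 hw2).mono fun τ hτ => ?_
  exact lt_of_lt_of_le (lt_min hs ht) hτ.1

end Sol

lemma Good.refl {α β : ℝ} {f : ℝ → ℝ} {μ : ℝ} {u g : ℝ → ℝ → ℝ} (s : ℝ) : Good α β f μ u g s s := by
  intro w w1 w2 m _ _ _ _ _
  simp

lemma dcont {w w1 : ℝ → ℝ} (hw : ∀ x, HasDerivAt w (w1 x) x) : Continuous w :=
  continuous_iff_continuousAt.2 fun x => (hw x).continuousAt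

lemma Good.trans {α β : ℝ} {f : ℝ → ℝ} {μ : ℝ} {u g ut ux uxx : ℝ → ℝ → ℝ} 
    (h : Sol f μ u g ut ux uxx) (hαβ : α ≤ β) {s r t : ℝ} (hs : 0 < s) (hsr : s ≤ r) (hrt : r ≤ t)
    (h1 : Good α β f μ u g s r) (h2 : Good α β f μ u g r t) : Good α β f μ u g s t := by
  intro w w1 w2 m hw hw1 hw2 ha hb
  have k1 := h1 w w1 w2 m hw hw1 hw2 (fun τ hτ => ha τ ⟨hτ.1, hτ.2.trans hrt⟩)
    (fun τ hτ => hb τ ⟨hτ.1, hτ.2.trans hrt⟩)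
  have k2 := h2 w w1 w2 m hw hw1 hw2 (fun τ hτ => ha τ ⟨hsr.trans hτ.1, hτ.2⟩)
    (fun τ hτ => hb τ ⟨hsr.trans hτ.1, hτ.2⟩)
  have hr : 0 < r := by linarith
  have := intervalIntegral.integral_add_adjacent_intervals
    (h.theta_ii hαβ m (dcont hw) (dcont hw1) hw2 hs hr)
    (h.theta_ii hαβ m (dcont hw) (dcont hw1) hw2 hr (hr.trans_le hrt))
  linarith

/-- Passing from the open interval to the closed one. -/
lemma Good.of_Ioo {α β : ℝ} {f : ℝ → ℝ} {μ : ℝ} {u g ut ux uxx : ℝ → ℝ → ℝ} 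
    (h : Sol f μ u g ut ux uxx) (hαβ : α ≤ β) {l r : ℝ} (hl : 0 < l) (hlr : l < r)
    (h1 : ∀ s t, l < s → s ≤ t → t < r → Good α β f μ u g s t) : Good α β f μ u g l r := by
  intro w w1 w2 m hw hw1 hw2 ha hb
  set Φ : ℝ → ℝ := fun τ => Pos α β u w m τ - ∫ z in l..τ, Theta α β f μ g w w1 w2 m z with hΦ
  have hθ : ∀ s t, 0 < s → 0 < t → IntervalIntegrable (Theta α β f μ g w w1 w2 m) volume s t :=
    fun s t hs ht => h.theta_ii hαβ m (dcont hw) (dcont hw1) hw2 hs ht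
  have hsub : Set.Icc l r ⊆ Set.Ioi 0 := fun z hz => lt_of_lt_of_le hl hz.1
  have hc : ContinuousOn Φ (Set.Icc l r) := by
    refine ((h.pos_cont hαβ m (dcont hw)).mono hsub).sub ?_
    have := intervalIntegral.continuousOn_primitive_interval (μ := volume)
      (f := Theta α β f μ g w w1 w2 m) (a := l) (b := r)
      (by rw [Set.uIcc_of_le hlr.le]; exact ((h.theta_cont hαβ m (dcont hw) (dcont hw1) hw2).mono hsub).integrableOn_Icc)
    rwa [Set.uIcc_of_le hlr.le] at this
  have hanti : ∀ s t, l < s → s ≤ t → t < r → Φ t ≤ Φ s := by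
    intro s t hs hst ht
    have k := h1 s t hs hst ht w w1 w2 m hw hw1 hw2
      (fun τ hτ => ha τ ⟨hs.le.trans hτ.1, hτ.2.trans ht.le⟩)
      (fun τ hτ => hb τ ⟨hs.le.trans hτ.1, hτ.2.trans ht.le⟩)
    have hs0 : 0 < s := hl.trans hs
    have := intervalIntegral.integral_add_adjacent_intervals (hθ l s hl hs0) (hθ s t hs0 (hs0.trans_le hst))
    simp only [hΦ]; linarith
  obtain ⟨c, hc1, hc2⟩ := exists_between hlr
  have e1 : Φ r ≤ Φ c := by
    have ht : Tendsto Φ (nhdsWithin r (Set.Ioo l r)) (nhds (Φ r)) :=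
      (hc r ⟨hlr.le, le_rfl⟩).mono_left (nhdsWithin_mono _ Set.Ioo_subset_Icc_self)
    have : (nhdsWithin r (Set.Ioo l r)).NeBot := by
      rw [nhdsWithin_Ioo_eq_nhdsLT hlr]; infer_instance
    refine le_of_tendsto ht ?_
    have : Set.Ioi c ∈ nhds r := Ioi_mem_nhds hc2
    filter_upwards [mem_nhdsWithin_of_mem_nhds this, self_mem_nhdsWithin] with z hz hz2
    exact hanti c z hc1 (le_of_lt hz) hz2.2
  have e2 : Φ c ≤ Φ l := by
    have ht : Tendsto Φ (nhdsWithin l (Set.Ioo l r)) (nhds (Φ l)) :=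
      (hc l ⟨le_rfl, hlr.le⟩).mono_left (nhdsWithin_mono _ Set.Ioo_subset_Icc_self)
    have : (nhdsWithin l (Set.Ioo l r)).NeBot := by
      rw [nhdsWithin_Ioo_eq_nhdsGT hlr]; infer_instance
    refine ge_of_tendsto ht ?_
    have : Set.Iio c ∈ nhds l := Iio_mem_nhds hc1
    filter_upwards [mem_nhdsWithin_of_mem_nhds this, self_mem_nhdsWithin] with z hz hz2
    exact hanti z c hz2.1 (le_of_lt hz) hc2
  have e3 := e1.trans e2
  simp only [hΦ, intervalIntegral.integral_same] at e3
  linarith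

lemma ite_ii {k y : ℝ → ℝ} {a b : ℝ} (hk : IntervalIntegrable k volume a b) (hy : Measurable y) :
    IntervalIntegrable (fun x => if 0 < y x then k x else 0) volume a b := by
  rw [intervalIntegrable_iff] at hk ⊢
  have : (fun x => if 0 < y x then k x else 0) = Set.indicator {x | 0 < y x} k := by
    funext x; simp [Set.indicator_apply]
  rw [this]
  exact hk.indicator (measurableSet_lt measurable_const hy)

/-- Fixed-time estimate -/
lemma Sol.fixed {α β : ℝ} {f : ℝ → ℝ} {μ : ℝ} {u g ut ux uxx : ℝ → ℝ → ℝ} 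
    (h : Sol f μ u g ut ux uxx) (hαβ : α ≤ β) {w w1 w2 : ℝ → ℝ} {m τ : ℝ} (hτ : 0 < τ)
    (hw : ∀ x, HasDerivAt w (w1 x) x) (hw1 : ∀ x, HasDerivAt w1 (w2 x) x)
    (hw2 : Continuous w2) (ha : u τ α ≤ w α + m * τ) (hb : u τ β ≤ w β + m * τ) :
    ∫ x in α..β, (if 0 < u τ x - (w x + m * τ) then ut τ x - m else 0) ≤ Theta α β f μ g w w1 w2 m τ := by
  have cW : Continuous fun x => w x + m * τ := (dcont hw).add continuous_const
  have ym : Measurable fun x => u τ x - (w x + m * τ) := ((h.cu hτ).sub cW).measurable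
  have hF : ∀ p, HasDerivAt (fun p => ∫ z in (0:ℝ)..p, f z) (f p) p := fun p =>
    intervalIntegral.integral_hasDerivAt_right (h.hf.intervalIntegrable _ _)
      (h.hf.stronglyMeasurableAtFilter _ _) h.hf.continuousAt
  have hk := kato1 (W := fun x => w x + m * τ) (W1 := w1) (W2 := w2) h.hμ hαβ h.hf hF
    (h.hux τ hτ) (h.huxx τ hτ) (h.uxxc τ hτ) (fun x => (hw x).add_const _) hw1 hw2 ha hb
  have cρ : Continuous fun x => m + f (w x + m * τ) * w1 x - μ * w2 x :=
    (continuous_const.add ((h.hf.comp cW).mul (dcont hw1))).sub (continuous_const.mul hw2)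
  have ck : Continuous fun x => μ * (uxx τ x - w2 x) - (f (u τ x) * ux τ x - f (w x + m * τ) * w1 x) :=
    (continuous_const.mul ((h.uxxc τ hτ).sub hw2)).sub
      (((h.hf.comp (h.cu hτ)).mul (h.cux hτ)).sub ((h.hf.comp cW).mul (dcont hw1)))
  have i1 := ite_ii (ck.intervalIntegrable α β) ym
  have i2 : IntervalIntegrable (fun x => max (g τ x - (m + f (w x + m * τ) * w1 x - μ * w2 x)) 0) volume α β := by
    have := (h.gii hτ α β).sub (cρ.intervalIntegrable α β)
    rw [intervalIntegrable_iff] at this ⊢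
    exact this.sup (integrable_zero _ _ _)
  have i3 := ite_ii ((h.uti hτ α β).sub (intervalIntegrable_const (c := m))) ym
  have : ∫ x in α..β, (if 0 < u τ x - (w x + m * τ) then ut τ x - m else 0)
      ≤ ∫ x in α..β, ((max (g τ x - (m + f (w x + m * τ) * w1 x - μ * w2 x)) 0) +
        (if 0 < u τ x - (w x + m * τ) then 
          μ * (uxx τ x - w2 x) - (f (u τ x) * ux τ x - f (w x + m * τ) * w1 x) else 0)) := by
    apply intervalIntegral.integral_mono_on hαβ i3 (i2.add i1)
    intro x _
    split_ifs with hh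
    · rw [h.pde τ hτ x]
      have := le_max_left (g τ x - (m + f (w x + m * τ) * w1 x - μ * w2 x)) 0
      linarith
    · have := le_max_right (g τ x - (m + f (w x + m * τ) * w1 x - μ * w2 x)) 0
      linarith
  rw [intervalIntegral.integral_add i2 i1] at this
  unfold Theta
  linarith

lemma cont_abs {v : ℝ → ℝ → ℝ} {k : ℝ → ℝ} (hk : Measurable k) (hk1 : ∀ x, |k x| ≤ 1)
    (vi : ∀ t, 0 < t → Integrable (v t))
    (vc : ∀ t₀, 0 < t₀ → Tendsto (fun t => ∫ x, |v t x - v t₀ x|) (nhds t₀) (nhds 0)) :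
    ContinuousOn (fun τ => ∫ x, k x * |v τ x|) (Set.Ioi 0) := by
  intro t₀ ht₀
  apply ContinuousAt.continuousWithinAt
  have ht₀ : 0 < t₀ := ht₀
  have hi : ∀ t, 0 < t → Integrable fun x => k x * |v t x| := fun t ht =>
    (vi t ht).abs.bdd_mul hk.aestronglyMeasurable (Eventually.of_forall hk1)
  rw [ContinuousAt, tendsto_iff_norm_sub_tendsto_zero]
  apply squeeze_zero' (Eventually.of_forall fun t => norm_nonneg _) _ (vc t₀ ht₀)
  filter_upwards [Ioi_mem_nhds ht₀] with t ht
  rw [← integral_sub (hi t ht) (hi t₀ ht₀)]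
  refine (norm_integral_le_integral_norm _).trans ?_
  apply integral_mono_of_nonneg (Eventually.of_forall fun x => norm_nonneg _)
    ((vi t ht).sub (vi t₀ ht₀)).abs
  refine Eventually.of_forall fun x => ?_
  simp only
  rw [← mul_sub, norm_mul, Real.norm_eq_abs, Real.norm_eq_abs]
  calc |k x| * |(|v t x| - |v t₀ x|)| ≤ 1 * |v t x - v t₀ x| := by
        exact mul_le_mul (hk1 x) (abs_abs_sub_abs_le _ _) (abs_nonneg _) zero_le_one
    _ = _ := one_mul _

lemma bdd_abs {v : ℝ → ℝ → ℝ}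
    (vi : ∀ t, 0 < t → Integrable (v t))
    (vc : ∀ t₀, 0 < t₀ → Tendsto (fun t => ∫ x, |v t x - v t₀ x|) (nhds t₀) (nhds 0))
    {s : ℝ} (hs : 0 < s) (t : ℝ) : ∃ G, 0 ≤ G ∧ ∀ τ ∈ Set.Icc s t, ∫ x, |v τ x| ≤ G := by
  have := cont_abs (k := fun _ => 1) measurable_const (by simp) vi vc
  obtain ⟨C, hC⟩ := isCompact_Icc.exists_bound_of_continuousOn
    (this.mono (fun z (hz : z ∈ Set.Icc s t) => lt_of_lt_of_le hs hz.1))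
  refine ⟨max C 0, le_max_right _ _, fun τ hτ => ?_⟩
  have := hC τ hτ
  simp only [one_mul] at this
  exact (le_abs_self _).trans (this.trans (le_max_left _ _))

def TM (α β : ℝ) (u ut : ℝ → ℝ → ℝ) (M : ℝ) : Set ℝ :=
  {t | (∫ x in α..β, |ut t x|) ≤ M ∧ (∀ x ∈ Set.Icc α β, |u t x| ≤ M) ∧
    ∀ x ∈ Set.Icc (α-1) (β+1), ∀ x' ∈ Set.Icc (α-1) (β+1), |u t x - u t x'| ≤ M * |x - x'|}

lemma TM_mono {α β : ℝ} {u ut : ℝ → ℝ → ℝ} {M M' : ℝ} (h : M ≤ M') :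
    TM α β u ut M ⊆ TM α β u ut M' := by
  rintro t ⟨h1, h2, h3⟩
  refine ⟨h1.trans h, fun x hx => (h2 x hx).trans h, fun x hx x' hx' => (h3 x hx x' hx').trans ?_⟩
  gcongr

lemma TM_neg {α β : ℝ} {u ut : ℝ → ℝ → ℝ} {M t : ℝ} (h : t ∈ TM α β u ut M) :
    t ∈ TM α β (fun t x => - u t x) (fun t x => - ut t x) M := by
  obtain ⟨h1, h2, h3⟩ := h
  refine ⟨by simpa using h1, by simpa using h2, fun x hx x' hx' => ?_⟩
  have := h3 x hx x' hx'
  rw [← abs_neg]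
  convert this using 2
  ring

namespace Sol
variable {f : ℝ → ℝ} {μ : ℝ} {u g ut ux uxx : ℝ → ℝ → ℝ} {α β : ℝ}

lemma TM_exists (h : Sol f μ u g ut ux uxx) {t : ℝ} (ht : 0 < t) :
    ∃ M : ℕ, t ∈ TM α β u ut M := by
  obtain ⟨A, hA⟩ := isCompact_Icc.exists_bound_of_continuousOn
    ((h.cu ht).continuousOn (s := Set.Icc α β))
  obtain ⟨B, hB⟩ := isCompact_Icc.exists_bound_of_continuousOn
    ((h.cux ht).continuousOn (s := Set.Icc (α-1) (β+1)))
  obtain ⟨M, hM⟩ := exists_nat_ge (max (∫ x in α..β, |ut t x|) (max A B))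
  refine ⟨M, (le_max_left _ _).trans hM, fun x hx => (hA x hx).trans
    (((le_max_left _ _).trans (le_max_right _ _)).trans hM), fun x hx x' hx' => ?_⟩
  have := (convex_Icc (α-1) (β+1)).norm_image_sub_le_of_norm_hasDerivWithin_le
    (fun z _ => (h.hux t ht z).hasDerivWithinAt) (fun z hz => hB z hz) hx' hx
  refine this.trans ?_
  rw [Real.norm_eq_abs]
  gcongr
  exact ((le_max_right _ _).trans (le_max_right _ _)).trans hM

lemma TM_ux (h : Sol f μ u g ut ux uxx) {t M : ℝ} (ht : 0 < t) (hM : t ∈ TM α β u ut M)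
    {x : ℝ} (hx : x ∈ Set.Icc α β) : |ux t x| ≤ M := by
  have hαβ : α ≤ β := hx.1.trans hx.2
  have hM0 : 0 ≤ M := (abs_nonneg _).trans (hM.2.1 x hx)
  refine (h.hux t ht x).le_of_lip' hM0 ?_
  have : Set.Icc (α - 1) (β+1) ∈ nhds x := Icc_mem_nhds (by linarith [hx.1]) (by linarith [hx.2])
  filter_upwards [this] with z hz
  exact hM.2.2 z hz x ⟨by linarith [hx.1], by linarith [hx.2]⟩

lemma TM_closed (h : Sol f μ u g ut ux uxx) (hαβ : α ≤ β) {c : ℝ} (hc : 0 < c) (M : ℝ) :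
    IsClosed (TM α β u ut M ∩ Set.Ici c) := by
  apply IsSeqClosed.isClosed
  intro τ t hτ hlim
  have htc : c ≤ t := ge_of_tendsto' hlim fun n => (hτ n).2
  have ht : 0 < t := hc.trans_le htc
  have hτ0 : ∀ n, 0 < τ n := fun n => hc.trans_le (hτ n).2
  have hu : ∀ x, Tendsto (fun n => u (τ n) x) atTop (nhds (u t x)) := fun x =>
    (h.hut t ht x).continuousAt.tendsto.comp hlim
  have hut : ∀ x, Tendsto (fun n => ut (τ n) x) atTop (nhds (ut t x)) := fun x =>
    ((h.utc x).continuousAt (Ioi_mem_nhds ht)).tendsto.comp hlim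
  refine ⟨⟨?_, fun x hx => le_of_tendsto' (hu x).abs fun n => (hτ n).1.2.1 x hx, fun x hx x' hx' =>
    le_of_tendsto' ((hu x).sub (hu x')).abs fun n => (hτ n).1.2.2 x hx x' hx'⟩, htc⟩
  have hM0 : 0 ≤ M := (intervalIntegral.integral_nonneg hαβ (fun x _ => abs_nonneg _)).trans (hτ 0).1.1
  have hum : ∀ s, Measurable (ut s) := fun s => h.utm.of_uncurry_left
  rw [intervalIntegral.integral_of_le hαβ,
    integral_eq_lintegral_of_nonneg_ae (Eventually.of_forall fun x => abs_nonneg _)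
      (hum t).abs.aestronglyMeasurable]
  apply ENNReal.toReal_le_of_le_ofReal hM0
  have hF := lintegral_liminf_le (μ := volume.restrict (Set.Ioc α β)) (u := atTop)
    (f := fun n x => ENNReal.ofReal |ut (τ n) x|) (fun n => (hum _).abs.ennreal_ofReal)
  have e1 : ∀ x, liminf (fun n => ENNReal.ofReal |ut (τ n) x|) atTop = ENNReal.ofReal |ut t x| :=
    fun x => ((ENNReal.continuous_ofReal.tendsto _).comp (hut x).abs).liminf_eq
  simp only [e1] at hF
  refine hF.trans ?_
  refine liminf_le_of_le (by isBoundedDefault) fun b hb => ?_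
  obtain ⟨n, hn⟩ := hb.exists
  refine hn.trans ?_
  rw [← ofReal_integral_eq_lintegral_ofReal]
  · apply ENNReal.ofReal_le_ofReal
    have := (hτ n).1.1
    rwa [intervalIntegral.integral_of_le hαβ] at this
  · have := (h.uti (hτ0 n) α β).abs
    rwa [intervalIntegrable_iff, Set.uIoc_of_le hαβ] at this
  · exact Eventually.of_forall fun x => abs_nonneg _

lemma lipGap (h : Sol f μ u g ut ux uxx) (hαβ : α ≤ β) {s t M : ℝ} (hs : 0 < s) :
    ∃ C, 0 ≤ C ∧ ∀ l r, s ≤ l → l ≤ r → r ≤ t → l ∈ TM α β u ut M → Good α β f μ u g l r →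
      ∫ x in α..β, max (u r x - u l x) 0 ≤ C * (r - l) := by
  have hsub : Set.Icc s t ⊆ Set.Ioi 0 := fun z hz => lt_of_lt_of_le hs hz.1
  obtain ⟨n1, hn1⟩ := isCompact_Icc.exists_bound_of_continuousOn ((h.utc α).mono hsub)
  obtain ⟨n2, hn2⟩ := isCompact_Icc.exists_bound_of_continuousOn ((h.utc β).mono hsub)
  set n := max (max n1 n2) 0 with hn
  have hn0 : 0 ≤ n := le_max_right _ _
  have hnα : ∀ τ ∈ Set.Icc s t, ‖ut τ α‖ ≤ n := fun τ hτ =>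
    (hn1 τ hτ).trans ((le_max_left _ _).trans (le_max_left _ _))
  have hnβ : ∀ τ ∈ Set.Icc s t, ‖ut τ β‖ ≤ n := fun τ hτ =>
    (hn2 τ hτ).trans ((le_max_right _ _).trans (le_max_left _ _))
  obtain ⟨G, hG0, hG⟩ := bdd_abs h.gi h.gc hs t
  obtain ⟨L, hL⟩ := isCompact_Icc.exists_bound_of_continuousOn
    (h.hf.continuousOn (s := Set.Icc (-(|M| + n * (t - s))) (|M| + n * (t-s))))
  set Cθ := G + (n + 2 * (|L| * |M|)) * (β - α) + |M| + G with hCθ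
  have hb0 : 0 ≤ β - α := by linarith
  have hCθ0 : 0 ≤ Cθ := by positivity
  refine ⟨Cθ + n * (β - α), by positivity, ?_⟩
  intro l r hsl hlr hrt hl hgood
  have hl0 : 0 < l := hs.trans_le hsl
  have hr0 : 0 < r := hl0.trans_le hlr
  have hbd : ∀ x, (∀ τ ∈ Set.Icc s t, ‖ut τ x‖ ≤ n) → ∀ τ ∈ Set.Icc l r,
      u τ x ≤ u l x - n * l + n * τ := by
    intro x hx τ hτ
    have := (convex_Icc s t).norm_image_sub_le_of_norm_hasDerivWithin_le
      (f := fun s => u s x) (x := l) (y := τ)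
      (fun z hz => (h.hut z (hsub hz) x).hasDerivWithinAt) hx
      ⟨hsl, hlr.trans hrt⟩ ⟨hsl.trans hτ.1, hτ.2.trans hrt⟩
    rw [Real.norm_eq_abs, Real.norm_eq_abs, abs_of_nonneg (by linarith [hτ.1] : 0 ≤ τ - l)] at this
    have := (le_abs_self _).trans this
    linarith
  have key := hgood (fun x => u l x - n * l) (ux l) (uxx l) n (fun x => (h.hux l hl0 x).sub_const _)
    (h.huxx l hl0) (h.uxxc l hl0) (hbd α hnα) (hbd β hnβ)
  have P0 : Pos α β u (fun x => u l x - n * l) n l = 0 := by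
    simp [Pos]
  rw [P0, zero_add] at key
  -- bound Theta
  have hΘ : ∀ τ ∈ Set.Icc l r, Theta α β f μ g (fun x => u l x - n * l) (ux l) (uxx l) n τ ≤ Cθ := by
    intro τ hτ
    have hτ0 : 0 < τ := hl0.trans_le hτ.1
    have ig := (h.gii hτ0 α β).abs
    have ig2 := (h.gii hl0 α β).abs
    have iut := (h.uti hl0 α β).abs
    have ic : IntervalIntegrable (fun _ => n + 2 * (|L| * |M|)) volume α β := intervalIntegrable_const
    have e : ∫ x in α..β, (|g τ x| + (n + 2 * (|L| * |M|)) + |ut l x| + |g l x|)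
       = (∫ x in α..β, |g τ x|) + (n + 2 * (|L| * |M|)) * (β - α) + (∫ x in α..β, |ut l x|)
          + ∫ x in α..β, |g l x| := by
      rw [intervalIntegral.integral_add ((ig.add ic).add iut) ig2,
        intervalIntegral.integral_add (ig.add ic) iut, intervalIntegral.integral_add ig ic]
      simp; ring
    have e2 : ∫ x in α..β, (|g τ x| + (n + 2 * (|L| * |M|)) + |ut l x| + |g l x|) ≤ Cθ := by
      rw [e, hCθ]
      have a1 := (ii_le_full (h.gi τ hτ0) hαβ).trans (hG τ ⟨hsl.trans hτ.1, hτ.2.trans hrt⟩)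
      have a2 := (ii_le_full (h.gi l hl0) hαβ).trans (hG l ⟨hsl, hlr.trans hrt⟩)
      have a3 := hl.1.trans (le_abs_self M)
      linarith
    refine le_trans ?_ e2
    unfold Theta
    apply intervalIntegral.integral_mono_on hαβ _ (((ig.add ic).add iut).add ig2)
    · intro x hx
      have hux := (h.TM_ux hl0 hl hx).trans (le_abs_self M)
      have hu := (hl.2.1 x hx).trans (le_abs_self M)
      have p0 : 0 ≤ n * (t - s) := mul_nonneg hn0 (by linarith)
      have p1 : 0 ≤ n * (τ - l) := mul_nonneg hn0 (by linarith [hτ.1])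
      have p2 : n * (τ - l) ≤ n * (t - s) := mul_le_mul_of_nonneg_left (by linarith [hτ.2]) hn0
      have hu' := abs_le.1 hu
      have f1 : |f (u l x)| ≤ |L| := (hL _ ⟨by linarith [hu'.1], by linarith [hu'.2]⟩).trans (le_abs_self L)
      have f2 : |f (u l x - n * l + n * τ)| ≤ |L| := (hL _ ⟨by linarith [hu'.1], by linarith [hu'.2]⟩).trans (le_abs_self L)
      have g1 : |f (u l x) * ux l x| ≤ |L| * |M| := by rw [abs_mul]; gcongr
      have g2 : |f (u l x - n * l + n * τ) * ux l x| ≤ |L| * |M| := by rw [abs_mul]; gcongr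
      have hp := h.pde l hl0 x
      have z1 := abs_le.1 g1
      have z2 := abs_le.1 g2
      have z3 := le_abs_self (g τ x)
      have z4 := le_abs_self (ut l x)
      have z5 := le_abs_self (g l x)
      have z6 := neg_abs_le (g l x)
      apply max_le
      · linarith
      · positivity
    · have cρ : Continuous fun x => n + f (u l x - n * l + n * τ) * ux l x - μ * uxx l x :=
        (continuous_const.add ((h.hf.comp (((h.cu hl0).sub continuous_const).add continuous_const)).mul
          (h.cux hl0))).sub (continuous_const.mul (h.uxxc l hl0))
      have := (h.gii hτ0 α β).sub (cρ.intervalIntegrable α β)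
      rw [intervalIntegrable_iff] at this ⊢
      exact this.sup (integrable_zero _ _ _)
  have hI : ∫ τ in l..r, Theta α β f μ g (fun x => u l x - n * l) (ux l) (uxx l) n τ ≤ Cθ * (r - l) := by
    have : ∫ τ in l..r, (Cθ:ℝ) = Cθ * (r - l) := by simp; ring
    rw [← this]
    exact intervalIntegral.integral_mono_on hlr
      (h.theta_ii hαβ n ((h.cu hl0).sub continuous_const) (h.cux hl0) (h.uxxc l hl0) hl0 hr0)
      (by simp) hΘ
  have hfin : ∫ x in α..β, max (u r x - u l x) 0 ≤
      ∫ x in α..β, (max (u r x - (u l x - n * l + n * r)) 0 + n * (r - l)) := by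
    have c1 := h.cu hl0
    have c2 := h.cu hr0
    apply intervalIntegral.integral_mono_on hαβ (Continuous.intervalIntegrable (by fun_prop) _ _)
      (Continuous.intervalIntegrable (by fun_prop) _ _)
    intro x _
    have a1 := le_max_left (u r x - (u l x - n * l + n * r)) 0
    have a2 := le_max_right (u r x - (u l x - n * l + n * r)) 0
    have a3 : 0 ≤ n * (r - l) := mul_nonneg hn0 (by linarith)
    exact max_le (by linarith) (by linarith)
  have c1 := h.cu hl0
  have c2 := h.cu hr0
  rw [intervalIntegral.integral_add (Continuous.intervalIntegrable (by fun_prop) _ _)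
    (by simp)] at hfin
  simp only [intervalIntegral.integral_const, smul_eq_mul] at hfin
  unfold Pos at key
  nlinarith

end Sol

namespace Sol
variable {f : ℝ → ℝ} {μ : ℝ} {u g ut ux uxx : ℝ → ℝ → ℝ} {α β : ℝ}

lemma portion (h : Sol f μ u g ut ux uxx) (hαβ : α ≤ β) {s t M : ℝ} (hs : 0 < s) (hst : s ≤ t)
    {E : Set ℝ} (hE : IsClosed E) (hsE : s ∈ E) (htE : t ∈ E) (hsub : E ⊆ Set.Icc s t)
    (hET : E ⊆ TM α β u ut M)
    (hgap : ∀ p ∈ gapSet E, Good α β f μ u g p.1 p.2 ∧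
      Good α β f μ (fun t x => - u t x) (fun t x => - g t x) p.1 p.2) :
    Good α β f μ u g s t := by
  intro w w1 w2 m hw hw1 hw2 ha hb
  have hpos : Set.Icc s t ⊆ Set.Ioi 0 := fun z hz => lt_of_lt_of_le hs hz.1
  have cw := dcont hw
  obtain ⟨C1, hC10, hC1⟩ := h.lipGap hαβ (t := t) (M := M) hs
  obtain ⟨C2, hC20, hC2⟩ := h.neg.lipGap hαβ (t := t) (M := M) hs
  have hEm : MeasurableSet E := hE.measurableSet
  set y : ℝ → ℝ → ℝ := fun τ x => u τ x - (w x + m * τ) with hy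
  set κ : ℝ → ℝ → ℝ := fun τ x => if 0 < y τ x then ut τ x - m else 0 with hκ
  have hym : Measurable (Function.uncurry y) := by
    have := cw.measurable
    exact h.um.sub ((this.comp measurable_snd).add (measurable_const.mul measurable_fst))
  have hκm : Measurable (Function.uncurry κ) := by
    have : Function.uncurry κ = Set.indicator {p | 0 < Function.uncurry y p}
        (fun p => Function.uncurry ut p - m) := by
      funext p; simp [hκ, Set.indicator_apply, Function.uncurry_def]
    rw [this]
    exact (h.utm.sub measurable_const).indicator (measurableSet_lt measurable_const hym)
  have hdy : ∀ x, ∀ τ ∈ Set.Icc s t, HasDerivAt (fun τ => y τ x) (ut τ x - m) τ := by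
    intro x τ hτ
    have h1 : HasDerivAt (fun τ => u τ x - (w x + m * τ)) (ut τ x - m * 1) τ :=
      (h.hut τ (hpos hτ) x).sub (((hasDerivAt_id τ).const_mul m).const_add (w x))
    rw [mul_one] at h1
    exact h1
  have hcd : ∀ x, ContinuousOn (fun τ => ut τ x - m) (Set.Icc s t) := fun x =>
    ((h.utc x).mono hpos).sub continuousOn_const
  have hfiberii : ∀ x, IntegrableOn (fun τ => κ τ x) (Set.Icc s t) := by
    intro x
    have h1 : IntegrableOn (fun τ => ut τ x - m) (Set.Icc s t) := (hcd x).integrableOn_Icc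
    refine Integrable.mono h1 (hκm.of_uncurry_right).aestronglyMeasurable (Eventually.of_forall fun τ => ?_)
    simp only [hκ]; split_ifs <;> simp
  have hP : ∀ x a b, s ≤ a → a ≤ b → b ≤ t →
      ∫ τ in a..b, κ τ x = max (y b x) 0 - max (y a x) 0 := by
    intro x a b h1 h2 h3
    exact posFTC h2 (fun τ hτ => hdy x τ ⟨h1.trans hτ.1, hτ.2.trans h3⟩)
      ((hcd x).mono (Set.Icc_subset_Icc h1 h3))
  have hgmem : ∀ p : gapSet E, s ≤ p.1.1 ∧ p.1.1 < p.1.2 ∧ p.1.2 ≤ t := fun p =>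
    ⟨(hsub p.2.1).1, p.2.2.2.1, (hsub p.2.2.1).2⟩
  -- decomposition for each x
  have hsumx : ∀ x, HasSum (fun p : gapSet E => max (y p.1.2 x) 0 - max (y p.1.1 x) 0)
      (max (y t x) 0 - max (y s x) 0 - ∫ τ in E, κ τ x) := by
    intro x
    have := gap_hasSum hE hsE htE hsub (hfiberii x)
    rw [integral_Icc_eq_integral_Ioc, ← intervalIntegral.integral_of_le hst, hP x s t le_rfl hst le_rfl] at this
    convert this using 2 with p
    rw [hP x _ _ (hgmem p).1 (hgmem p).2.1.le (hgmem p).2.2]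
  -- bounds
  have cyx : ∀ τ ∈ Set.Icc s t, Continuous (y τ) := fun τ hτ =>
    (h.cu (hpos hτ)).sub (cw.add continuous_const)
  have hlen : Summable (fun p : gapSet E => p.1.2 - p.1.1) := by
    have := (gap_hasSum hE hsE htE hsub (ψ := fun _ => (1:ℝ)) (by simp)).summable
    simpa using this
  have : Countable (gapSet E) := (gapSet_countable E).to_subtype
  set ν := volume.restrict (Set.Ioc α β) with hν
  have hb0 : 0 ≤ β - α := by linarith
  have ccp : ∀ p : gapSet E, Continuous fun x => max (y p.1.2 x) 0 - max (y p.1.1 x) 0 := by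
    intro p
    obtain ⟨a1, a2, a3⟩ := hgmem p
    exact ((cyx _ ⟨a1.trans a2.le, a3⟩).sup continuous_const).sub
      ((cyx _ ⟨a1, a2.le.trans a3⟩).sup continuous_const)
  have icp : ∀ p : gapSet E, Integrable (fun x => max (y p.1.2 x) 0 - max (y p.1.1 x) 0) ν := by
    intro p
    have := (ccp p).intervalIntegrable (μ := volume) α β
    rwa [intervalIntegrable_iff, Set.uIoc_of_le hαβ] at this
  have hnorm : ∀ p : gapSet E, ∫ x, ‖max (y p.1.2 x) 0 - max (y p.1.1 x) 0‖ ∂ν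
      ≤ (C1 + C2 + |m| * (β - α)) * (p.1.2 - p.1.1) := by
    intro p
    obtain ⟨a1, a2, a3⟩ := hgmem p
    have c1 := h.cu (hpos ⟨a1, a2.le.trans a3⟩)
    have c2 := h.cu (hpos ⟨a1.trans a2.le, a3⟩)
    have k1 := hC1 p.1.1 p.1.2 a1 a2.le a3 (hET p.2.1) (hgap p.1 p.2).1
    have k2 := hC2 p.1.1 p.1.2 a1 a2.le a3 (TM_neg (hET p.2.1)) (hgap p.1 p.2).2
    rw [hν, ← intervalIntegral.integral_of_le hαβ]
    have : ∫ x in α..β, ‖max (y p.1.2 x) 0 - max (y p.1.1 x) 0‖ ≤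
        ∫ x in α..β, (max (u p.1.2 x - u p.1.1 x) 0 + max (- u p.1.2 x - (- u p.1.1 x)) 0
          + |m| * (p.1.2 - p.1.1)) := by
      apply intervalIntegral.integral_mono_on hαβ ((ccp p).norm.intervalIntegrable _ _)
        (Continuous.intervalIntegrable (by fun_prop) _ _)
      intro x _
      refine (max_sub_le _ _).trans ?_
      have e : y p.1.2 x - y p.1.1 x = (u p.1.2 x - u p.1.1 x) - m * (p.1.2 - p.1.1) := by
        simp only [hy]; ring
      rw [e]
      refine (abs_sub _ _).trans ?_
      rw [abs_mul, abs_of_nonneg (by linarith : 0 ≤ p.1.2 - p.1.1)]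
      gcongr
      rw [abs_le]
      have z1 := le_max_left (u p.1.2 x - u p.1.1 x) 0
      have z2 := le_max_right (u p.1.2 x - u p.1.1 x) 0
      have z3 := le_max_left (- u p.1.2 x - (- u p.1.1 x)) 0
      have z4 := le_max_right (- u p.1.2 x - (- u p.1.1 x)) 0
      constructor <;> linarith
    rw [intervalIntegral.integral_add (Continuous.intervalIntegrable (by fun_prop) _ _)
      (by simp), intervalIntegral.integral_add (Continuous.intervalIntegrable (by fun_prop) _ _)
      (Continuous.intervalIntegrable (by fun_prop) _ _)] at this
    simp only [intervalIntegral.integral_const, smul_eq_mul] at this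
    nlinarith
  have hsumm : Summable fun p : gapSet E => ∫ x, ‖max (y p.1.2 x) 0 - max (y p.1.1 x) 0‖ ∂ν :=
    Summable.of_nonneg_of_le (fun p => integral_nonneg fun x => norm_nonneg _) hnorm (hlen.mul_left _)
  have hS1 := hasSum_integral_of_summable_integral_norm icp hsumm
  have e1 : (∫ x, ∑' p : gapSet E, (max (y p.1.2 x) 0 - max (y p.1.1 x) 0) ∂ν)
      = ∫ x, (max (y t x) 0 - max (y s x) 0 - ∫ τ in E, κ τ x) ∂ν := by
    congr 1; funext x; exact (hsumx x).tsum_eq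
  rw [e1] at hS1
  have hθi : IntegrableOn (Theta α β f μ g w w1 w2 m) (Set.Icc s t) :=
    ((h.theta_cont hαβ m cw (dcont hw1) hw2).mono hpos).integrableOn_Icc
  have hS2 := gap_hasSum hE hsE htE hsub hθi
  have hle : (∫ x, (max (y t x) 0 - max (y s x) 0 - ∫ τ in E, κ τ x) ∂ν) ≤
      (∫ τ in Set.Icc s t, Theta α β f μ g w w1 w2 m τ) - ∫ τ in E, Theta α β f μ g w w1 w2 m τ := by
    refine hasSum_le (fun p => ?_) hS1 hS2
    obtain ⟨a1, a2, a3⟩ := hgmem p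
    have k := (hgap p.1 p.2).1 w w1 w2 m hw hw1 hw2 (fun τ hτ => ha τ ⟨a1.trans hτ.1, hτ.2.trans a3⟩)
      (fun τ hτ => hb τ ⟨a1.trans hτ.1, hτ.2.trans a3⟩)
    rw [hν, ← intervalIntegral.integral_of_le hαβ, intervalIntegral.integral_sub]
    · unfold Pos at k; simp only [hy]; linarith
    · exact ((cyx _ ⟨a1.trans a2.le, a3⟩).sup continuous_const).intervalIntegrable _ _
    · exact ((cyx _ ⟨a1, a2.le.trans a3⟩).sup continuous_const).intervalIntegrable _ _
  -- Fubini
  set νE := volume.restrict E with hνE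
  have hEfin : IsFiniteMeasure νE := by
    refine ⟨?_⟩
    rw [hνE, Measure.restrict_apply_univ]
    exact (measure_mono hsub).trans_lt (by simp)
  have hutν : ∀ τ ∈ E, Integrable (κ τ) ν := by
    intro τ hτ
    have := ite_ii ((h.uti (hpos (hsub hτ)) α β).sub (intervalIntegrable_const (c := m)))
      (cyx τ (hsub hτ)).measurable
    rw [intervalIntegrable_iff, Set.uIoc_of_le hαβ] at this
    exact this
  have hM : ∀ τ ∈ E, ∫ x, ‖κ τ x‖ ∂ν ≤ M + |m| * (β - α) := by
    intro τ hτ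
    have i1 := (h.uti (hpos (hsub hτ)) α β).abs
    have ht1 := (hET hτ).1
    have i2 : IntervalIntegrable (fun x => |ut τ x| + |m|) volume α β := i1.add intervalIntegrable_const
    have : ∫ x, ‖κ τ x‖ ∂ν ≤ ∫ x, (|ut τ x| + |m|) ∂ν := by
      apply integral_mono_of_nonneg (Eventually.of_forall fun x => norm_nonneg _)
      · rwa [intervalIntegrable_iff, Set.uIoc_of_le hαβ] at i2
      · refine Eventually.of_forall fun x => ?_
        simp only [hκ]
        split_ifs
        · exact abs_sub _ _
        · simp; positivity
    refine this.trans ?_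
    rw [hν, ← intervalIntegral.integral_of_le hαβ, intervalIntegral.integral_add i1 intervalIntegrable_const]
    simp only [intervalIntegral.integral_const, smul_eq_mul]
    linarith
  have hprod : Integrable (Function.uncurry κ) (νE.prod ν) := by
    rw [integrable_prod_iff hκm.aestronglyMeasurable]
    refine ⟨?_, ?_⟩
    · filter_upwards [ae_restrict_mem hEm] with τ hτ
      exact hutν τ hτ
    · refine Integrable.mono' (integrable_const (M + |m| * (β - α))) ?_ ?_
      · exact hκm.aestronglyMeasurable.norm.integral_prod_right'
      · filter_upwards [ae_restrict_mem hEm] with τ hτ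
        rw [Real.norm_eq_abs, abs_of_nonneg (integral_nonneg fun x => norm_nonneg _)]
        exact hM τ hτ
  have hswap := integral_integral_swap hprod
  have hEle : ∫ x, (∫ τ in E, κ τ x) ∂ν ≤ ∫ τ in E, Theta α β f μ g w w1 w2 m τ := by
    rw [← hswap]
    apply integral_mono_ae hprod.integral_prod_left (hθi.mono_set hsub)
    filter_upwards [ae_restrict_mem hEm] with τ hτ
    have := h.fixed hαβ (m := m) (hpos (hsub hτ)) hw hw1 hw2 (ha τ (hsub hτ)) (hb τ (hsub hτ))
    rw [intervalIntegral.integral_of_le hαβ] at this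
    exact this
  have iy : ∀ τ ∈ Set.Icc s t, Integrable (fun x => max (y τ x) 0) ν := by
    intro τ hτ
    have := ((cyx τ hτ).sup continuous_const (f := y τ) (g := fun _ => (0:ℝ))).intervalIntegrable (μ := volume) α β
    rwa [intervalIntegrable_iff, Set.uIoc_of_le hαβ] at this
  have is := iy s ⟨le_rfl, hst⟩
  have it := iy t ⟨hst, le_rfl⟩
  have hi2 : Integrable (fun x => ∫ τ in E, κ τ x) ν := hprod.integral_prod_right
  have e2 : ∫ x, (max (y t x) 0 - max (y s x) 0 - ∫ τ in E, κ τ x) ∂ν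
      = ∫ x, max (y t x) 0 ∂ν - ∫ x, max (y s x) 0 ∂ν - ∫ x, (∫ τ in E, κ τ x) ∂ν := by
    rw [integral_sub (f := fun x => max (y t x) 0 - max (y s x) 0) (it.sub is) hi2, integral_sub it is]
  rw [e2, integral_Icc_eq_integral_Ioc] at hle
  unfold Pos
  rw [intervalIntegral.integral_of_le hst, intervalIntegral.integral_of_le hαβ, intervalIntegral.integral_of_le hαβ]
  simp only [hy] at hle
  linarith

/-- The comparison inequality holds on every time interval. -/
theorem good (h : Sol f μ u g ut ux uxx) (hαβ : α ≤ β) {s t : ℝ} (hs : 0 < s) (hst : s ≤ t) :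
    Good α β f μ u g s t := by
  set G2 : ℝ → ℝ → Prop := fun s t => Good α β f μ u g s t ∧
      Good α β f μ (fun t x => - u t x) (fun t x => - g t x) s t with hG2
  have trans2 : ∀ a b c, 0 < a → a ≤ b → b ≤ c → G2 a b → G2 b c → G2 a c :=
    fun a b c h1 h2 h3 h4 h5 => ⟨Good.trans h hαβ h1 h2 h3 h4.1 h5.1, Good.trans h.neg hαβ h1 h2 h3 h4.2 h5.2⟩
  set U : Set ℝ := {τ | ∃ ε > 0, ∀ a b, |a - τ| < ε → |b - τ| < ε → s ≤ a → a ≤ b → G2 a b} with hU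
  have hUo : IsOpen U := by
    rw [Metric.isOpen_iff]
    rintro τ ⟨ε, hε, hh⟩
    refine ⟨ε/2, by linarith, fun z hz => ⟨ε/2, by linarith, fun a b ha hb h1 h2 => hh a b ?_ ?_ h1 h2⟩⟩
    · rw [Metric.mem_ball, Real.dist_eq] at hz
      have := abs_sub_le a z τ
      linarith
    · rw [Metric.mem_ball, Real.dist_eq] at hz
      have := abs_sub_le b z τ
      linarith
  -- chaining
  have chain : ∀ a b, s ≤ a → a ≤ b → Set.Icc a b ⊆ U → G2 a b := by
    intro a b hsa hab hsubU
    choose! ε hε hh using fun τ (hτ : τ ∈ U) => hτ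
    have hcov : Set.Icc a b ⊆ ⋃ i : Set.Icc a b, Metric.ball i.1 (ε i.1) := by
      intro z hz
      exact Set.mem_iUnion.2 ⟨⟨z, hz⟩, Metric.mem_ball_self (hε z (hsubU hz))⟩
    have := exists_monotone_Icc_subset_open_cover_Icc hab (c := fun i : Set.Icc a b => {x : Set.Icc a b | x.1 ∈ Metric.ball i.1 (ε i.1)})
      (fun i => Metric.isOpen_ball.preimage continuous_subtype_val)
      (fun z _ => by
        obtain ⟨i, hi⟩ := Set.mem_iUnion.1 (hcov z.2)
        exact Set.mem_iUnion.2 ⟨i, hi⟩)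
    obtain ⟨T, hT0, hTm, ⟨N, hN⟩, hTc⟩ := this
    have step : ∀ n, G2 a (T n) := by
      intro n
      induction n with
      | zero => rw [hT0]; exact ⟨Good.refl _, Good.refl _⟩
      | succ n ih =>
        obtain ⟨i, hi⟩ := hTc n
        have hle : T n ≤ T (n+1) := hTm (Nat.le_succ n)
        have m1 := hi ⟨le_rfl, hle⟩
        have m2 := hi ⟨hle, le_rfl⟩
        simp only [Set.mem_setOf_eq, Metric.mem_ball, Real.dist_eq] at m1 m2
        exact trans2 _ _ _ (hs.trans_le hsa) (T n).2.1 hle ih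
          (hh i.1 (hsubU i.2) _ _ m1 m2 (hsa.trans (T n).2.1) hle)
    have := step N
    rwa [hN N le_rfl] at this
  have gapgood : ∀ l r, s ≤ l → l < r → Set.Ioo l r ⊆ U → G2 l r := by
    intro l r hsl hlr hsubU
    have hh : ∀ a b, l < a → a ≤ b → b < r → G2 a b := fun a b h1 h2 h3 =>
      chain a b (hsl.trans h1.le) h2 fun z hz => hsubU ⟨h1.trans_le hz.1, hz.2.trans_lt h3⟩
    exact ⟨Good.of_Ioo h hαβ (hs.trans_le hsl) hlr fun a b h1 h2 h3 => (hh a b h1 h2 h3).1,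
      Good.of_Ioo h.neg hαβ (hs.trans_le hsl) hlr fun a b h1 h2 h3 => (hh a b h1 h2 h3).2⟩
  suffices hUu : U = Set.univ by
    exact (chain s t le_rfl hst (by rw [hUu]; exact Set.subset_univ _)).1
  by_contra hne
  set F : Set ℝ := Uᶜ with hF
  have hFc : IsClosed F := hUo.isClosed_compl
  have hFne : F.Nonempty := by
    rw [hF, Set.nonempty_compl]; exact hne
  have hFs : F ⊆ Set.Ici s := by
    intro τ hτ
    by_contra hlt
    have hlt : τ < s := not_le.1 hlt
    apply hτ
    refine ⟨s - τ, by linarith, fun a b ha _ hsa _ => ?_⟩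
    exfalso
    have := (abs_lt.1 ha).2
    linarith
  have : CompleteSpace F := hFc.completeSpace_coe
  have : Nonempty F := hFne.to_subtype
  have hcl : ∀ M : ℕ, IsClosed {x : F | x.1 ∈ TM α β u ut M} := by
    intro M
    have h1 := (h.TM_closed hαβ hs (M : ℝ)).preimage (continuous_subtype_val (p := fun x => x ∈ F))
    convert h1 using 1
    ext x
    simp only [Set.mem_setOf_eq, Set.mem_preimage, Set.mem_inter_iff]
    exact ⟨fun hx => ⟨hx, hFs x.2⟩, fun hx => hx.1⟩
  have hun : (⋃ M : ℕ, {x : F | x.1 ∈ TM α β u ut M}) = Set.univ := by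
    apply Set.eq_univ_of_forall
    intro x
    obtain ⟨M, hM⟩ := h.TM_exists (α := α) (β := β) (hs.trans_le (hFs x.2))
    exact Set.mem_iUnion.2 ⟨M, hM⟩
  obtain ⟨M, ⟨t0, ht0⟩⟩ := nonempty_interior_of_iUnion_of_closed hcl hun
  obtain ⟨δ, hδ, hball⟩ := Metric.isOpen_iff.1 isOpen_interior t0 ht0
  have hball2 : ∀ τ ∈ F, |τ - t0.1| < δ → τ ∈ TM α β u ut M := by
    intro τ hτ hd
    have : (⟨τ, hτ⟩ : F) ∈ Metric.ball t0 δ := by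
      rw [Metric.mem_ball, Subtype.dist_eq, Real.dist_eq]; exact hd
    have h3 : (⟨τ, hτ⟩ : F) ∈ {x : F | x.1 ∈ TM α β u ut M} := interior_subset (hball this)
    exact h3
  apply t0.2
  refine ⟨δ, hδ, fun a b ha hb hsa hab => ?_⟩
  rcases hab.eq_or_lt with rfl | hab'
  · exact ⟨Good.refl _, Good.refl _⟩
  have ha0 : 0 < a := hs.trans_le hsa
  obtain ⟨Ma, hMa⟩ := h.TM_exists (α := α) (β := β) ha0
  obtain ⟨Mb, hMb⟩ := h.TM_exists (α := α) (β := β) (ha0.trans_le hab)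
  set E : Set ℝ := (F ∩ Set.Icc a b) ∪ {a, b} with hE
  have hEc : IsClosed E := (hFc.inter isClosed_Icc).union (Set.toFinite _).isClosed
  have haE : a ∈ E := Or.inr (by simp)
  have hbE : b ∈ E := Or.inr (by simp)
  have hEsub : E ⊆ Set.Icc a b := by
    rintro z (hz | hz)
    · exact hz.2
    · rcases hz with rfl | hz
      · exact ⟨le_rfl, hab⟩
      · rw [Set.mem_singleton_iff] at hz; subst hz; exact ⟨hab, le_rfl⟩
  have hET : E ⊆ TM α β u ut (max (M:ℝ) (max Ma Mb)) := by
    rintro z (hz | hz)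
    · refine TM_mono (le_max_left _ _) (hball2 z hz.1 ?_)
      rw [abs_lt] at ha hb ⊢
      exact ⟨by linarith [hz.2.1, ha.1], by linarith [hz.2.2, hb.2]⟩
    · rcases hz with rfl | hz
      · exact TM_mono ((le_max_left _ _).trans (le_max_right _ _)) hMa
      · rw [Set.mem_singleton_iff] at hz; subst hz
        exact TM_mono ((le_max_right _ _).trans (le_max_right _ _)) hMb
  have hgap : ∀ p ∈ gapSet E, G2 p.1 p.2 := by
    intro p hp
    apply gapgood _ _ (hsa.trans (hEsub hp.1).1) hp.2.2.1
    intro z hz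
    by_contra hzU
    exact hp.2.2.2 z hz (Or.inl ⟨hzU, (hEsub hp.1).1.trans hz.1.le, hz.2.le.trans (hEsub hp.2.1).2⟩)
  refine ⟨h.portion hαβ ha0 hab hEc haE hbE hEsub hET hgap, ?_⟩
  refine h.neg.portion hαβ ha0 hab hEc haE hbE hEsub (fun z hz => TM_neg (hET hz)) fun p hp => ?_
  refine ⟨(hgap p hp).2, ?_⟩
  simpa using (hgap p hp).1

end Sol

namespace Sol
variable {f : ℝ → ℝ} {μ : ℝ} {u g ut ux uxx : ℝ → ℝ → ℝ} {α β : ℝ}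

lemma half (h : Sol f μ u g ut ux uxx) (hαβ : α ≤ β) {s n : ℝ} (hs : 0 < s)
    (h1 : ut s α < n) (h2 : ut s β < n) {ε : ℝ} (hε : 0 < ε) :
    ∀ᶠ k in nhdsWithin (0:ℝ) (Set.Ioi 0), ∫ x in α..β, max ((u (s+k) x - u s x)/k - n) 0
      ≤ (∫ x in α..β, max (ut s x - n) 0) + ε := by
  have bdry : ∀ x, ut s x < n → ∃ δ > 0, ∀ τ, s ≤ τ → τ < s + δ → u τ x ≤ u s x - n * s + n * τ := by
    intro x hx
    have h3 := (hasDerivAt_iff_tendsto_slope.1 (h.hut s hs x)).eventually (Iio_mem_nhds hx)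
    rw [eventually_nhdsWithin_iff, Metric.eventually_nhds_iff] at h3
    obtain ⟨δ, hδ, h4⟩ := h3
    refine ⟨δ, hδ, fun τ hτ hτ2 => ?_⟩
    rcases hτ.eq_or_lt with rfl | hlt
    · linarith
    · have h5 := h4 (y := τ) (by rw [Real.dist_eq, abs_of_pos] <;> linarith) (by simpa using hlt.ne')
      rw [slope_def_field, div_lt_iff₀ (by linarith)] at h5
      linarith
  obtain ⟨δ1, hδ1, hb1⟩ := bdry α h1
  obtain ⟨δ2, hδ2, hb2⟩ := bdry β h2
  set w : ℝ → ℝ := fun x => u s x - n * s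
  have hw : ∀ x, HasDerivAt w (ux s x) x := fun x => (h.hux s hs x).sub_const _
  have cw := dcont hw
  have hc := h.theta_cont hαβ n cw (h.cux hs) (h.uxxc s hs)
  have hT : Theta α β f μ g w (ux s) (uxx s) n s = ∫ x in α..β, max (ut s x - n) 0 := by
    unfold Theta
    congr 1; funext x
    rw [h.pde s hs x]
    simp only [w]
    congr 1
    ring_nf
  have h3 := (hc.continuousAt (Ioi_mem_nhds hs)).eventually
    (Iio_mem_nhds (show Theta α β f μ g w (ux s) (uxx s) n s < (∫ x in α..β, max (ut s x - n) 0) + ε by linarith))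
  obtain ⟨δ3, hδ3, h4⟩ := Metric.eventually_nhds_iff.1 h3
  have hmem : Set.Ioo 0 (min δ1 (min δ2 δ3)) ∈ nhdsWithin (0:ℝ) (Set.Ioi 0) :=
    Ioo_mem_nhdsGT (by positivity)
  filter_upwards [hmem] with k hk
  have hk0 := hk.1
  have hk1 : k < δ1 := hk.2.trans_le (min_le_left _ _)
  have hk2 : k < δ2 := hk.2.trans_le ((min_le_right _ _).trans (min_le_left _ _))
  have hk3 : k < δ3 := hk.2.trans_le ((min_le_right _ _).trans (min_le_right _ _))
  have hG := h.good hαβ hs (show s ≤ s + k by linarith) w (ux s) (uxx s) n hw (h.huxx s hs) (h.uxxc s hs)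
    (fun τ hτ => hb1 τ hτ.1 (by linarith [hτ.2])) (fun τ hτ => hb2 τ hτ.1 (by linarith [hτ.2]))
  have e0 : Pos α β u w n s = 0 := by
    unfold Pos; simp [w]
  have e1 : Pos α β u w n (s+k) = k * ∫ x in α..β, max ((u (s+k) x - u s x)/k - n) 0 := by
    unfold Pos
    rw [← intervalIntegral.integral_const_mul]
    congr 1; funext x
    rw [mul_max_of_nonneg _ _ hk0.le, mul_zero]
    congr 1
    field_simp
    simp only [w]; ring
  have e2 : ∫ τ in s..(s+k), Theta α β f μ g w (ux s) (uxx s) n τ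
      ≤ ∫ τ in s..(s+k), ((∫ x in α..β, max (ut s x - n) 0) + ε) := by
    apply intervalIntegral.integral_mono_on (by linarith)
      (h.theta_ii hαβ n cw (h.cux hs) (h.uxxc s hs) hs (by linarith)) (by simp)
    intro τ hτ
    refine (h4 (y := τ) ?_).le
    rw [Real.dist_eq, abs_of_nonneg] <;> linarith [hτ.1, hτ.2]
  rw [intervalIntegral.integral_const, smul_eq_mul] at e2
  rw [e0, e1] at hG
  have : k * ∫ x in α..β, max ((u (s+k) x - u s x)/k - n) 0 ≤ k * ((∫ x in α..β, max (ut s x - n) 0) + ε) := by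
    have : s + k - s = k := by ring
    rw [this] at e2; linarith
  exact le_of_mul_le_mul_left this hk0

lemma clamp_ineq {n D v : ℝ} (hn : 0 ≤ n) :
    |D - v| ≤ |max (-n) (min n D) - max (-n) (min n v)| + (max (D - n) 0 + max (-D - n) 0)
      + (max (v - n) 0 + max (-v - n) 0) := by
  have key : ∀ p : ℝ, |p - max (-n) (min n p)| ≤ max (p - n) 0 + max (-p-n) 0 := by
    intro p
    have m1 := le_max_left (p-n) 0
    have m2 := le_max_left (-p-n) 0
    have m3 := le_max_right (p-n) 0
    have m4 := le_max_right (-p-n) 0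
    rcases le_total n p with h1 | h1
    · rw [min_eq_left h1, max_eq_right (by linarith), abs_of_nonneg (by linarith)]; linarith
    · rw [min_eq_right h1]
      rcases le_total (-n) p with h2 | h2
      · rw [max_eq_right h2]; simp; linarith
      · rw [max_eq_left h2, abs_of_nonpos (by linarith)]; linarith
  have h1 := key D
  have h2 := key v
  have e : D - v = (D - max (-n) (min n D)) + (max (-n) (min n D) - max (-n) (min n v)) - (v - max (-n) (min n v)) := by ring
  rw [e]
  have k1 := abs_sub (D - max (-n) (min n D) + (max (-n) (min n D) - max (-n) (min n v))) (v - max (-n) (min n v))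
  have k2 := abs_add_le (D - max (-n) (min n D)) (max (-n) (min n D) - max (-n) (min n v))
  linarith

theorem diffquot (h : Sol f μ u g ut ux uxx) (hαβ : α ≤ β) {s : ℝ} (hs : 0 < s) :
    Tendsto (fun k => ∫ x in α..β, |(u (s+k) x - u s x)/k - ut s x|) (nhdsWithin (0:ℝ) (Set.Ioi 0)) (nhds 0) := by
  have hv := h.uti hs α β
  have hv' : Integrable (ut s) (volume.restrict (Set.Ioc α β)) := by
    rwa [intervalIntegrable_iff_integrableOn_Ioc_of_le hαβ] at hv
  have tail : ∀ v : ℝ → ℝ, Integrable v (volume.restrict (Set.Ioc α β)) →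
      Tendsto (fun n : ℕ => ∫ x in α..β, max (v x - n) 0) atTop (nhds 0) := by
    intro v hv
    simp only [intervalIntegral.integral_of_le hαβ]
    have := tendsto_integral_filter_of_dominated_convergence (μ := volume.restrict (Set.Ioc α β))
      (F := fun (n : ℕ) x => max (v x - n) 0) (f := fun _ => (0:ℝ)) (l := atTop) (fun x => |v x|)
      (Eventually.of_forall fun n => (hv.1.sub aestronglyMeasurable_const).sup aestronglyMeasurable_const)
      (Eventually.of_forall fun n => Eventually.of_forall fun x => by
        rw [Real.norm_eq_abs, abs_of_nonneg (le_max_right _ _)]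
        exact max_le (by have := le_abs_self (v x); have : (0:ℝ) ≤ n := by positivity
                         linarith [le_abs_self (v x)]) (abs_nonneg _))
      hv.abs
      (Eventually.of_forall fun x => by
        refine tendsto_const_nhds.congr' ?_
        filter_upwards [eventually_ge_atTop (Nat.ceil (v x))] with n hn
        rw [max_eq_right]
        have := Nat.ceil_le.1 hn
        linarith)
    simpa using this
  rw [Metric.tendsto_nhds]
  intro ε hε
  have hε6 : 0 < ε / 7 := by positivity
  have t1 := (tail _ hv').eventually (Iio_mem_nhds hε6)
  have t2 := (tail _ hv'.neg).eventually (Iio_mem_nhds hε6)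
  obtain ⟨n, h1, h2, h3⟩ := (t1.and (t2.and (eventually_ge_atTop (Nat.ceil (max |ut s α| |ut s β|) + 1)))).exists
  have h3' : max |ut s α| |ut s β| < n := by
    have : ((Nat.ceil (max |ut s α| |ut s β|) + 1 : ℕ) : ℝ) ≤ n := by exact_mod_cast h3
    push_cast at this
    linarith [Nat.le_ceil (max |ut s α| |ut s β|)]
  have hα := (le_max_left _ _).trans_lt h3'
  have hβ := (le_max_right _ _).trans_lt h3'
  rw [abs_lt] at hα hβ
  have n0 : (0:ℝ) ≤ n := by positivity
  have a1 := h.half hαβ hs hα.2 hβ.2 hε6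
  have a2 := h.neg.half hαβ hs (n := n) (by linarith [hα.1]) (by linarith [hβ.1]) hε6
  have cD : ∀ k, 0 < k → Continuous (fun x => (u (s+k) x - u s x)/k) := fun k hk =>
    ((h.cu (by linarith)).sub (h.cu hs)).div_const _
  have a3 : Tendsto (fun k => ∫ x in α..β, |max (-n:ℝ) (min n ((u (s+k) x - u s x)/k)) - max (-n:ℝ) (min n (ut s x))|)
      (nhdsWithin (0:ℝ) (Set.Ioi 0)) (nhds 0) := by
    simp only [intervalIntegral.integral_of_le hαβ]
    have := tendsto_integral_filter_of_dominated_convergence (μ := volume.restrict (Set.Ioc α β))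
      (F := fun (k : ℝ) x => |max (-n:ℝ) (min n ((u (s+k) x - u s x)/k)) - max (-n:ℝ) (min n (ut s x))|)
      (f := fun _ => (0:ℝ)) (l := nhdsWithin (0:ℝ) (Set.Ioi 0)) (fun x => 2 * n)
      (by
        filter_upwards [self_mem_nhdsWithin] with k hk
        have := (cD k hk)
        have c1 : Continuous (fun x => max (-n:ℝ) (min n ((u (s+k) x - u s x)/k))) := by fun_prop
        exact (c1.aestronglyMeasurable.sub (aestronglyMeasurable_const.sup (aestronglyMeasurable_const.inf hv'.1))).norm)
      (Eventually.of_forall fun k => Eventually.of_forall fun x => by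
        rw [Real.norm_eq_abs, abs_abs]
        have b : ∀ p : ℝ, |max (-n:ℝ) (min n p)| ≤ n := fun p => by
          rw [abs_le]; exact ⟨le_max_left _ _, max_le (by linarith) (min_le_left _ _)⟩
        have := abs_sub (max (-n:ℝ) (min n ((u (s+k) x - u s x)/k))) (max (-n:ℝ) (min n (ut s x)))
        linarith [b ((u (s+k) x - u s x)/k), b (ut s x)])
      (integrable_const _)
      (Eventually.of_forall fun x => by
        have hd : Tendsto (fun k => (u (s+k) x - u s x)/k) (nhdsWithin (0:ℝ) (Set.Ioi 0)) (nhds (ut s x)) := by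
          have := ((h.hut s hs x).tendsto_slope_zero).mono_left (nhdsWithin_mono 0 (fun z (hz : z ∈ Set.Ioi (0:ℝ)) => ne_of_gt hz : Set.Ioi (0:ℝ) ⊆ {0}ᶜ))
          refine this.congr fun k => ?_
          rw [smul_eq_mul, inv_mul_eq_div]
        have c2 : Continuous (fun p : ℝ => |max (-n:ℝ) (min n p) - max (-n:ℝ) (min n (ut s x))|) := by fun_prop
        have := (c2.tendsto (ut s x)).comp hd
        simpa [Function.comp_def] using this)
    simpa using this
  filter_upwards [a1, a2, a3.eventually (Iio_mem_nhds hε6), self_mem_nhdsWithin] with k b1 b2 b3 hk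
  have hk : 0 < k := hk
  rw [Real.dist_eq, sub_zero, abs_of_nonneg (intervalIntegral.integral_nonneg hαβ fun x _ => abs_nonneg _)]
  have cDk := cD k hk
  have i1 : IntervalIntegrable (fun x => |max (-n:ℝ) (min n ((u (s+k) x - u s x)/k)) - max (-n:ℝ) (min n (ut s x))|) volume α β := by
    rw [intervalIntegrable_iff_integrableOn_Ioc_of_le hαβ]
    have c1 : Continuous (fun x => max (-n:ℝ) (min n ((u (s+k) x - u s x)/k))) := by fun_prop
    have j1 := c1.intervalIntegrable (μ := volume) α β
    rw [intervalIntegrable_iff_integrableOn_Ioc_of_le hαβ] at j1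
    exact (j1.sub ((integrable_const _).sup ((integrable_const _).inf hv'))).abs
  have i2 : IntervalIntegrable (fun x => max ((u (s+k) x - u s x)/k - n) 0) volume α β :=
    Continuous.intervalIntegrable (by fun_prop) _ _
  have i3 : IntervalIntegrable (fun x => max (-((u (s+k) x - u s x)/k) - n) 0) volume α β :=
    Continuous.intervalIntegrable (by fun_prop) _ _
  have i4 : IntervalIntegrable (fun x => max (ut s x - n) 0) volume α β := by
    rw [intervalIntegrable_iff_integrableOn_Ioc_of_le hαβ]
    exact (hv'.sub (integrable_const _)).sup (integrable_const _)
  have i5 : IntervalIntegrable (fun x => max (- ut s x - n) 0) volume α β := by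
    rw [intervalIntegrable_iff_integrableOn_Ioc_of_le hαβ]
    exact (hv'.neg.sub (integrable_const _)).sup (integrable_const _)
  have i0 : IntervalIntegrable (fun x => |(u (s+k) x - u s x)/k - ut s x|) volume α β :=
    ((cDk.intervalIntegrable _ _).sub hv).abs
  have := intervalIntegral.integral_mono_on hαβ i0 ((i1.add (i2.add i3)).add (i4.add i5))
    (fun x _ => clamp_ineq (n := n) (D := (u (s+k) x - u s x)/k) (v := ut s x) n0)
  have e : ∫ x in α..β, max (-((u (s+k) x - u s x)/k) - n) 0 = ∫ x in α..β, max ((-u (s+k) x - -u s x)/k - n) 0 := by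
    congr 1; funext x; congr 2; ring
  simp only [Pi.neg_apply] at b3 h2 h1
  erw [intervalIntegral.integral_add (i1.add (i2.add i3)) (i4.add i5),
    intervalIntegral.integral_add i1 (i2.add i3), intervalIntegral.integral_add i2 i3,
    intervalIntegral.integral_add i4 i5, e] at this
  refine this.trans_lt ?_
  linarith

end Sol

/-- A convex pair entropy, Lipschitz on `S × S`. -/
structure Ent (S : Set ℝ) (C : ℝ) (ψ ψp ψr : ℝ → ℝ → ℝ) : Prop where
  C0 : 0 ≤ C
  mem0 : (0:ℝ) ∈ S
  chain : ∀ (y1 y2 : ℝ → ℝ) (t d1 d2 : ℝ), HasDerivAt y1 d1 t → HasDerivAt y2 d2 t →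
    HasDerivAt (fun s => ψ (y1 s) (y2 s)) (ψp (y1 t) (y2 t) * d1 + ψr (y1 t) (y2 t) * d2) t
  cont : Continuous (Function.uncurry ψ)
  contp : Continuous (Function.uncurry ψp)
  contr : Continuous (Function.uncurry ψr)
  lip : ∀ p ∈ S, ∀ r ∈ S, ∀ p' ∈ S, ∀ r' ∈ S, |ψ p' r' - ψ p r| ≤ C * (|p' - p| + |r' - r|)
  bp : ∀ p ∈ S, ∀ r ∈ S, |ψp p r| ≤ C
  br : ∀ p ∈ S, ∀ r ∈ S, |ψr p r| ≤ C
  zero : ψ 0 0 = 0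
  conv : ∀ p ∈ S, ∀ r ∈ S, ∀ p' ∈ S, ∀ r' ∈ S,
    ψp p r * (p' - p) + ψr p r * (r' - r) ≤ ψ p' r' - ψ p r

noncomputable def Fz (α β : ℝ) (χ : ℝ → ℝ) (ψ : ℝ → ℝ → ℝ) (u : ℝ → ℝ → ℝ) (t z : ℝ) : ℝ :=
  ∫ x in α..β, χ x * ψ (u t x) (u t (x + z))

namespace Sol
variable {f : ℝ → ℝ} {μ : ℝ} {u g ut ux uxx : ℝ → ℝ → ℝ} {α β : ℝ} {S : Set ℝ} {C : ℝ}
  {ψ ψp ψr : ℝ → ℝ → ℝ} {χ : ℝ → ℝ}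

lemma cPsi (h : Sol f μ u g ut ux uxx) (e : Ent S C ψ ψp ψr) {t : ℝ} (ht : 0 < t) (z : ℝ) :
    Continuous (fun x => ψ (u t x) (u t (x + z))) := by
  have := h.cu ht
  exact e.cont.comp (this.prodMk (this.comp (continuous_id.add continuous_const)))

lemma iiPsi (h : Sol f μ u g ut ux uxx) (e : Ent S C ψ ψp ψr) (cχ : Continuous χ) {t : ℝ} (ht : 0 < t) (z : ℝ)
    (a b : ℝ) : IntervalIntegrable (fun x => χ x * ψ (u t x) (u t (x + z))) volume a b :=
  (cχ.mul (h.cPsi e ht z)).intervalIntegrable a b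

lemma Fz_cont (h : Sol f μ u g ut ux uxx) (e : Ent S C ψ ψp ψr) (cχ : Continuous χ) {t : ℝ} (ht : 0 < t) :
    Continuous (Fz α β χ ψ u t) := by
  have c := h.cu ht
  unfold Fz
  apply intervalIntegral.continuous_parametric_intervalIntegral_of_continuous'
  have := e.cont
  simp only [Function.uncurry_def]
  refine (cχ.comp continuous_snd).mul (e.cont.comp ((c.comp continuous_snd).prodMk (c.comp (continuous_snd.add continuous_fst))))

/-- local bound of the increments -/
lemma Fz_incr (h : Sol f μ u g ut ux uxx) (e : Ent S C ψ ψp ψr) (cχ : Continuous χ)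
    (hχ1 : ∀ x ∈ Set.Icc α β, |χ x| ≤ 1) (hαβ : α ≤ β)
    {t t' z : ℝ} (ht : 0 < t) (ht' : 0 < t') (hS : ∀ x, u t x ∈ S) (hS' : ∀ x, u t' x ∈ S)
    (hz : z ∈ Set.Icc (0:ℝ) 1) :
    |Fz α β χ ψ u t' z - Fz α β χ ψ u t z| ≤ C * (2 * ∫ x in α..(β+1), |u t' x - u t x|) := by
  have c := h.cu ht
  have c' := h.cu ht'
  unfold Fz
  have cd : Continuous fun x => |u t' x - u t x| := by fun_prop
  rw [← intervalIntegral.integral_sub (h.iiPsi e cχ ht' z _ _)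
    (h.iiPsi e cχ ht z _ _)]
  have h1 : |∫ x in α..β, (χ x * ψ (u t' x) (u t' (x + z)) - χ x * ψ (u t x) (u t (x + z)))|
      ≤ ∫ x in α..β, C * (|u t' x - u t x| + |u t' (x+z) - u t (x+z)|) := by
    refine (intervalIntegral.abs_integral_le_integral_abs hαβ).trans ?_
    apply intervalIntegral.integral_mono_on hαβ
    · exact (((cχ.mul (h.cPsi e ht' z)).sub (cχ.mul (h.cPsi e ht z))).abs).intervalIntegrable _ _
    · apply Continuous.intervalIntegrable; fun_prop
    · intro x hx
      rw [← mul_sub, abs_mul]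
      have := e.lip _ (hS x) _ (hS (x+z)) _ (hS' x) _ (hS' (x+z))
      calc _ ≤ 1 * _ := mul_le_mul (hχ1 x hx) this (abs_nonneg _) zero_le_one
        _ = _ := one_mul _
  refine h1.trans ?_
  rw [intervalIntegral.integral_const_mul]
  apply mul_le_mul_of_nonneg_left _ e.C0
  have cdz : Continuous fun x => |u t' (x+z) - u t (x+z)| := by fun_prop
  rw [intervalIntegral.integral_add (cd.intervalIntegrable _ _) (cdz.intervalIntegrable _ _)]
  have h2 : ∫ x in α..β, |u t' (x+z) - u t (x+z)| = ∫ x in (α+z)..(β+z), |u t' x - u t x| :=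
    intervalIntegral.integral_comp_add_right (fun x => |u t' x - u t x|) z
  have h3 : ∫ x in (α+z)..(β+z), |u t' x - u t x| ≤ ∫ x in α..(β+1), |u t' x - u t x| :=
    intervalIntegral.integral_mono_interval (by linarith [hz.1]) (by linarith) (by linarith [hz.2])
      (Eventually.of_forall fun x => abs_nonneg _) (cd.intervalIntegrable _ _)
  have h4 : ∫ x in α..β, |u t' x - u t x| ≤ ∫ x in α..(β+1), |u t' x - u t x| :=
    intervalIntegral.integral_mono_interval le_rfl hαβ (by linarith)
      (Eventually.of_forall fun x => abs_nonneg _) (cd.intervalIntegrable _ _)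
  rw [h2]
  linarith

lemma Fz_rderiv (h : Sol f μ u g ut ux uxx) (e : Ent S C ψ ψp ψr) (cχ : Continuous χ)
    (hχ1 : ∀ x ∈ Set.Icc α β, |χ x| ≤ 1) (hαβ : α ≤ β)
    {s z : ℝ} (hs : 0 < s) (hS : ∀ t, s ≤ t → ∀ x, u t x ∈ S) :
    Tendsto (fun k => (Fz α β χ ψ u (s+k) z - Fz α β χ ψ u s z)/k) (nhdsWithin (0:ℝ) (Set.Ioi 0))
      (nhds (∫ x in α..β, χ x * (ψp (u s x) (u s (x+z)) * ut s x + ψr (u s x) (u s (x+z)) * ut s (x+z)))) := by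
  have hk0 : ∀ᶠ k in nhdsWithin (0:ℝ) (Set.Ioi 0), 0 < k := self_mem_nhdsWithin
  have hlim : ∀ x, Tendsto (fun k => χ x * ((ψ (u (s+k) x) (u (s+k) (x+z)) - ψ (u s x) (u s (x+z)))/k))
      (nhdsWithin (0:ℝ) (Set.Ioi 0))
      (nhds (χ x * (ψp (u s x) (u s (x+z)) * ut s x + ψr (u s x) (u s (x+z)) * ut s (x+z)))) := by
    intro x
    have h1 := (e.chain _ _ s _ _ (h.hut s hs x) (h.hut s hs (x+z))).tendsto_slope_zero.mono_left
      (nhdsWithin_mono 0 (fun z (hz : z ∈ Set.Ioi (0:ℝ)) => ne_of_gt hz : Set.Ioi (0:ℝ) ⊆ {0}ᶜ))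
    refine (h1.congr fun k => ?_).const_mul _
    rw [smul_eq_mul, inv_mul_eq_div]
  have hutz : ∀ a b : ℝ, IntervalIntegrable (fun x => ut s (x+z)) volume a b := fun a b => by
    have := (h.uti hs (a+z) (b+z)).comp_add_right z
    simpa using this
  have cu := h.cu hs
  have hmain := gdct (X := ℝ) (ν := volume.restrict (Set.Ioc α β)) (l := nhdsWithin (0:ℝ) (Set.Ioi 0))
    (a := fun k x => χ x * ((ψ (u (s+k) x) (u (s+k) (x+z)) - ψ (u s x) (u s (x+z)))/k))
    (b := fun x => χ x * (ψp (u s x) (u s (x+z)) * ut s x + ψr (u s x) (u s (x+z)) * ut s (x+z)))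
    (d := fun x => C * (|ut s x| + |ut s (x+z)|))
    (e := fun k x => C * (|(u (s+k) x - u s x)/k - ut s x| + |(u (s+k) (x+z) - u s (x+z))/k - ut s (x+z)|))
    ?_ ?_ ?_ ?_ ?_ ?_ ?_
  · rw [← intervalIntegral.integral_of_le hαβ] at hmain
    refine hmain.congr' ?_
    filter_upwards [hk0] with k hk
    unfold Fz
    rw [← intervalIntegral.integral_of_le hαβ, ← intervalIntegral.integral_sub
      (h.iiPsi e cχ (show 0 < s + k by linarith) z _ _)
      (h.iiPsi e cχ hs z _ _), ← intervalIntegral.integral_div]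
    congr 1; funext x; ring
  · filter_upwards [hk0] with k hk
    exact (cχ.mul (((h.cPsi e (by linarith) z).sub (h.cPsi e hs z)).div_const _)).aestronglyMeasurable
  · have := (((h.uti hs α β).abs).add ((hutz α β).abs)).const_mul C
    rwa [intervalIntegrable_iff_integrableOn_Ioc_of_le hαβ] at this
  · filter_upwards [hk0] with k hk
    have c1 : Continuous fun x => (u (s+k) x - u s x)/k := ((h.cu (by linarith)).sub cu).div_const _
    have c2 : Continuous fun x => (u (s+k) (x+z) - u s (x+z))/k := c1.comp (continuous_id.add continuous_const)
    have := ((((c1.intervalIntegrable _ _).sub (h.uti hs α β)).abs).add (((c2.intervalIntegrable _ _).sub (hutz α β)).abs)).const_mul C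
    rwa [intervalIntegrable_iff_integrableOn_Ioc_of_le hαβ] at this
  · filter_upwards [hk0] with k hk
    filter_upwards [ae_restrict_mem measurableSet_Ioc] with x hx
    have hl := e.lip _ (hS s le_rfl x) _ (hS s le_rfl (x+z)) _ (hS (s+k) (by linarith) x) _ (hS (s+k) (by linarith) (x+z))
    have b1 : |(u (s+k) x - u s x)/k| ≤ |ut s x| + |(u (s+k) x - u s x)/k - ut s x| := by
      have := abs_add_le (ut s x) ((u (s+k) x - u s x)/k - ut s x)
      simpa using this
    have b2 : |(u (s+k) (x+z) - u s (x+z))/k| ≤ |ut s (x+z)| + |(u (s+k) (x+z) - u s (x+z))/k - ut s (x+z)| := by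
      have := abs_add_le (ut s (x+z)) ((u (s+k) (x+z) - u s (x+z))/k - ut s (x+z))
      simpa using this
    rw [abs_div, abs_of_pos hk] at b1 b2
    rw [abs_mul, abs_div, abs_of_pos hk]
    have hdiv : |ψ (u (s+k) x) (u (s+k) (x+z)) - ψ (u s x) (u s (x+z))|/k ≤ C * (|u (s+k) x - u s x|/k + |u (s+k) (x+z) - u s (x+z)|/k) := by
      rw [← add_div, ← mul_div_assoc]
      gcongr
    calc _ ≤ 1 * (|ψ (u (s+k) x) (u (s+k) (x+z)) - ψ (u s x) (u s (x+z))|/k) :=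
          mul_le_mul_of_nonneg_right (hχ1 x ⟨hx.1.le, hx.2⟩) (by positivity)
      _ ≤ C * (|u (s+k) x - u s x|/k + |u (s+k) (x+z) - u s (x+z)|/k) := by rw [one_mul]; exact hdiv
      _ ≤ C * ((|ut s x| + |(u (s+k) x - u s x)/k - ut s x|) + (|ut s (x+z)| + |(u (s+k) (x+z) - u s (x+z))/k - ut s (x+z)|)) :=
          mul_le_mul_of_nonneg_left (add_le_add b1 b2) e.C0
      _ = _ := by ring
  · filter_upwards [ae_restrict_mem measurableSet_Ioc] with x hx
    rw [abs_mul]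
    have b1 := mul_le_mul_of_nonneg_right (e.bp _ (hS s le_rfl x) _ (hS s le_rfl (x+z))) (abs_nonneg (ut s x))
    have b2 := mul_le_mul_of_nonneg_right (e.br _ (hS s le_rfl x) _ (hS s le_rfl (x+z))) (abs_nonneg (ut s (x+z)))
    have b3 := abs_add_le (ψp (u s x) (u s (x+z)) * ut s x) (ψr (u s x) (u s (x+z)) * ut s (x+z))
    rw [abs_mul, abs_mul] at b3
    calc _ ≤ 1 * _ := mul_le_mul_of_nonneg_right (hχ1 x ⟨hx.1.le, hx.2⟩) (abs_nonneg _)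
      _ ≤ _ := by rw [one_mul]; linarith
  · exact Eventually.of_forall hlim
  · have t1 := (h.diffquot hαβ hs)
    have t2 := (h.diffquot (α := α+z) (β := β+z) (by linarith) hs)
    have t3 := (t1.add t2).const_mul C
    rw [add_zero, mul_zero] at t3
    refine t3.congr' ?_
    filter_upwards [hk0] with k hk
    have c1 : Continuous fun x => (u (s+k) x - u s x)/k := ((h.cu (by linarith)).sub cu).div_const _
    have c2 : Continuous fun x => (u (s+k) (x+z) - u s (x+z))/k := c1.comp (continuous_id.add continuous_const)
    rw [← intervalIntegral.integral_comp_add_right (fun x => |(u (s+k) x - u s x)/k - ut s x|) z,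
      ← intervalIntegral.integral_add (((c1.intervalIntegrable _ _).sub (h.uti hs α β)).abs)
      (((c2.intervalIntegrable _ _).sub (hutz α β)).abs), ← intervalIntegral.integral_const_mul,
      intervalIntegral.integral_of_le hαβ]
    congr 1; funext x
    exact (abs_of_nonneg (mul_nonneg e.C0 (add_nonneg (abs_nonneg _) (abs_nonneg _)))).symm

/-- continuity in time -/
lemma Fz_tcont (h : Sol f μ u g ut ux uxx) (e : Ent S C ψ ψp ψr) (cχ : Continuous χ)
    (hχ1 : ∀ x ∈ Set.Icc α β, |χ x| ≤ 1) (hαβ : α ≤ β)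
    {s t z : ℝ} (hs : 0 < s) (hS : ∀ t, s ≤ t → ∀ x, u t x ∈ S) (hz : z ∈ Set.Icc (0:ℝ) 1) :
    ContinuousOn (fun t => Fz α β χ ψ u t z) (Set.Icc s t) := by
  intro t0 ht0
  have ht00 : 0 < t0 := hs.trans_le ht0.1
  rw [ContinuousWithinAt, tendsto_iff_norm_sub_tendsto_zero]
  have h1 := ((h.uc t0 ht00).const_mul (C*2)).mono_left (nhdsWithin_le_nhds (s := Set.Icc s t))
  rw [mul_zero] at h1
  refine squeeze_zero' (Eventually.of_forall fun _ => norm_nonneg _) ?_ h1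
  filter_upwards [self_mem_nhdsWithin] with τ hτ
  have hτ0 : 0 < τ := hs.trans_le hτ.1
  refine (h.Fz_incr e cχ hχ1 hαβ ht00 hτ0 (hS _ ht0.1) (hS _ hτ.1) hz).trans ?_
  rw [← mul_assoc]
  exact mul_le_mul_of_nonneg_left (ii_le_full ((h.ui _ hτ0).sub (h.ui _ ht00)) (by linarith)) (by have := e.C0; positivity)

end Sol

noncomputable def NLop (N : ℝ) (j v : ℝ → ℝ) (x : ℝ) : ℝ := N * ((∫ y, j y * v (x - y)) - v x)

section nl
variable {j v : ℝ → ℝ} {N : ℝ}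

lemma convi (hj : Integrable j) (hv : Integrable v) :
    Integrable (fun p : ℝ × ℝ => j p.2 * v (p.1 - p.2)) (volume.prod volume) := by
  have := Integrable.convolution_integrand (ContinuousLinearMap.mul ℝ ℝ) hj hv
  simpa using this

lemma tensi (hj : Integrable j) (hv : Integrable v) :
    Integrable (fun p : ℝ × ℝ => j p.2 * v p.1) (volume.prod volume) := by
  have := hv.mul_prod hj
  refine this.congr (Eventually.of_forall fun p => ?_)
  simp only; ring

lemma conv_total (hj : Integrable j) (hj1 : ∫ y, j y = 1) (hv : Integrable v) :
    ∫ x, ∫ y, j y * v (x - y) = ∫ x, v x := by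
  rw [integral_integral_swap (convi hj hv)]
  have : ∀ y, ∫ x, j y * v (x - y) = j y * ∫ x, v x := fun y => by
    rw [integral_const_mul, integral_sub_right_eq_self v y]
  simp only [this]
  rw [integral_mul_const, hj1, one_mul]

lemma tens_total (hj1 : ∫ y, j y = 1) (x : ℝ) : ∫ y, j y * v x = v x := by
  rw [integral_mul_const, hj1, one_mul]

lemma NL_int (hj : Integrable j) (hv : Integrable v) : Integrable (NLop N j v) := by
  have h1 : Integrable (fun x => ∫ y, j y * v (x - y)) := (convi hj hv).integral_prod_left
  exact (h1.sub hv).const_mul N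

lemma NL_l1 (hj0 : ∀ x, 0 ≤ j x) (hj : Integrable j) (hj1 : ∫ y, j y = 1) (hN : 0 ≤ N) (hv : Integrable v) :
    ∫ x, |NLop N j v x| ≤ N * (2 * ∫ x, |v x|) := by
  have h1 : Integrable (fun x => ∫ y, j y * v (x - y)) := (convi hj hv).integral_prod_left
  have h2 : Integrable (fun x => ∫ y, j y * |v (x - y)|) := (convi hj hv.abs).integral_prod_left
  have h3 := conv_total hj hj1 hv.abs
  have : ∫ x, |NLop N j v x| ≤ ∫ x, N * ((∫ y, j y * |v (x - y)|) + |v x|) := by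
    apply integral_mono (NL_int hj hv).abs ((h2.add hv.abs).const_mul N)
    intro x
    simp only [NLop, abs_mul, abs_of_nonneg hN]
    apply mul_le_mul_of_nonneg_left _ hN
    refine (abs_sub _ _).trans (add_le_add_left ?_ _)
    refine (abs_integral_le_integral_abs).trans (le_of_eq ?_)
    congr 1; funext y; rw [abs_mul, abs_of_nonneg (hj0 y)]
  refine this.trans (le_of_eq ?_)
  rw [integral_const_mul, integral_add h2 hv.abs, h3]; ring

lemma NL_sub (hj : Integrable j) {w : ℝ → ℝ} (hv : Integrable v) (hw : Integrable w) :
    (fun x => NLop N j v x - NLop N j w x) =ᵐ[volume] NLop N j (fun x => v x - w x) := by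
  filter_upwards [(convi hj hv).prod_right_ae, (convi hj hw).prod_right_ae] with x h1 h2
  simp only [NLop]
  have : ∫ y, j y * (v (x - y) - w (x - y)) = (∫ y, j y * v (x-y)) - ∫ y, j y * w (x - y) := by
    rw [← integral_sub h1 h2]; congr 1; funext y; ring
  rw [this]; ring

variable {S : Set ℝ} {C : ℝ} {ψ ψp ψr : ℝ → ℝ → ℝ}

lemma Psi_int (hv : Integrable v) (cv : Continuous v) (e : Ent S C ψ ψp ψr) (hS : ∀ x, v x ∈ S) (z : ℝ) :
    Integrable (fun x => ψ (v x) (v (x + z))) := by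
  have hvz : Integrable (fun x => v (x+z)) := hv.comp_add_right z
  refine Integrable.mono' ((hv.abs.add hvz.abs).const_mul C) ?_ (Eventually.of_forall fun x => ?_)
  · exact (e.cont.comp (cv.prodMk (cv.comp (continuous_id.add continuous_const)))).aestronglyMeasurable
  · have := e.lip 0 e.mem0 0 e.mem0 _ (hS x) _ (hS (x+z))
    simpa [e.zero] using this

lemma NL_le (hj0 : ∀ x, 0 ≤ j x) (hj : Integrable j) (hj1 : ∫ y, j y = 1) (hN : 0 ≤ N)
    (hv : Integrable v) (cv : Continuous v) (e : Ent S C ψ ψp ψr) (hS : ∀ x, v x ∈ S) (z : ℝ) :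
    ∫ x, (ψp (v x) (v (x+z)) * NLop N j v x + ψr (v x) (v (x+z)) * NLop N j v (x+z)) ≤ 0 := by
  have hvz : Integrable (fun x => v (x+z)) := hv.comp_add_right z
  have hΨ := Psi_int hv cv e hS z
  have c2 : Continuous fun x => (v x, v (x+z)) := cv.prodMk (cv.comp (continuous_id.add continuous_const))
  have cA : Continuous fun x => ψp (v x) (v (x+z)) := e.contp.comp c2
  have cB : Continuous fun x => ψr (v x) (v (x+z)) := e.contr.comp c2
  have i1 := convi hj hv
  have i2 := tensi hj hv
  have i3 := convi hj hvz
  have i4 := tensi hj hvz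
  have i5 := convi hj hΨ
  have i6 := tensi hj hΨ
  have j1 : Integrable (fun p : ℝ × ℝ => ψp (v p.1) (v (p.1+z)) * (j p.2 * v (p.1 - p.2) - j p.2 * v p.1)) (volume.prod volume) :=
    (i1.sub i2).bdd_mul (c := C) (cA.comp continuous_fst).aestronglyMeasurable
      (Eventually.of_forall fun p => e.bp _ (hS _) _ (hS _))
  have j2 : Integrable (fun p : ℝ × ℝ => ψr (v p.1) (v (p.1+z)) * (j p.2 * v (p.1 - p.2 + z) - j p.2 * v (p.1+z))) (volume.prod volume) :=
    (i3.sub i4).bdd_mul (c := C) (cB.comp continuous_fst).aestronglyMeasurable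
      (Eventually.of_forall fun p => e.br _ (hS _) _ (hS _))
  have hle : ∫ p : ℝ × ℝ, (ψp (v p.1) (v (p.1+z)) * (j p.2 * v (p.1 - p.2) - j p.2 * v p.1)
      + ψr (v p.1) (v (p.1+z)) * (j p.2 * v (p.1 - p.2 + z) - j p.2 * v (p.1+z))) ∂(volume.prod volume)
      ≤ ∫ p : ℝ × ℝ, (j p.2 * ψ (v (p.1 - p.2)) (v (p.1 - p.2 + z)) - j p.2 * ψ (v p.1) (v (p.1 + z))) ∂(volume.prod volume) := by
    apply integral_mono (j1.add j2) (i5.sub i6)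
    intro p
    have := e.conv _ (hS p.1) _ (hS (p.1+z)) _ (hS (p.1 - p.2)) _ (hS (p.1 - p.2 + z))
    have := mul_le_mul_of_nonneg_left this (hj0 p.2)
    simp only [Pi.add_apply, Pi.sub_apply]
    linarith
  have e1 : ∫ p : ℝ × ℝ, (j p.2 * ψ (v (p.1 - p.2)) (v (p.1 - p.2 + z)) - j p.2 * ψ (v p.1) (v (p.1 + z))) ∂(volume.prod volume) = 0 := by
    rw [integral_sub i5 i6, integral_prod _ i5, integral_prod _ i6]
    have := conv_total hj hj1 hΨ
    simp only at this ⊢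
    rw [this]
    have : ∀ x, ∫ y, j y * ψ (v x) (v (x+z)) = ψ (v x) (v (x+z)) := fun x => by
      rw [integral_mul_const, hj1, one_mul]
    simp only [this, sub_self]
  have e2 : ∫ x, (ψp (v x) (v (x+z)) * NLop N j v x + ψr (v x) (v (x+z)) * NLop N j v (x+z))
      = N * ∫ p : ℝ × ℝ, (ψp (v p.1) (v (p.1+z)) * (j p.2 * v (p.1 - p.2) - j p.2 * v p.1)
      + ψr (v p.1) (v (p.1+z)) * (j p.2 * v (p.1 - p.2 + z) - j p.2 * v (p.1+z))) ∂(volume.prod volume) := by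
    have j12 : Integrable (fun p : ℝ × ℝ => ψp (v p.1) (v (p.1+z)) * (j p.2 * v (p.1 - p.2) - j p.2 * v p.1)
      + ψr (v p.1) (v (p.1+z)) * (j p.2 * v (p.1 - p.2 + z) - j p.2 * v (p.1+z))) (volume.prod volume) := j1.add j2
    rw [integral_prod _ j12, ← integral_const_mul]
    apply integral_congr_ae
    filter_upwards [i1.prod_right_ae, i2.prod_right_ae, i3.prod_right_ae, i4.prod_right_ae] with x k1 k2 k3 k4
    have s1 : ∫ y, (j y * v (x - y) - j y * v x) = (∫ y, j y * v (x-y)) - v x := by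
      rw [integral_sub k1 k2, tens_total hj1]
    have s2 : ∫ y, (j y * v (x - y + z) - j y * v (x+z)) = (∫ y, j y * v (x + z -y)) - v (x+z) := by
      rw [integral_sub k3 k4, integral_mul_const, hj1, one_mul]
      congr 2; funext y; congr 2; ring
    have k12 : Integrable (fun y => j y * v (x - y) - j y * v x) := k1.sub k2
    have k34 : Integrable (fun y => j y * v (x - y + z) - j y * v (x+z)) := k3.sub k4
    rw [integral_add (k12.const_mul _) (k34.const_mul _), integral_const_mul, integral_const_mul, s1, s2]
    simp only [NLop]; ring
  rw [e2]
  exact mul_nonpos_of_nonneg_of_nonpos hN (by linarith)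

lemma NL_sq (hj : Integrable j) (hj1 : ∫ y, j y = 1)
    (hv : Integrable v) (cv : Continuous v) {k : ℝ} (hk : ∀ x, |v x| ≤ k) :
    N * ∫ x, ∫ y, j y * (v x - v (x - y))^2 = - ∫ x, 2 * v x * NLop N j v x := by
  have hv2 : Integrable (fun x => v x ^ 2) := by
    have := hv.bdd_mul (c := k) cv.aestronglyMeasurable (Eventually.of_forall hk)
    refine this.congr (Eventually.of_forall fun x => ?_)
    simp only; ring
  have i1 := convi hj hv
  have i2 := tensi hj hv
  have i5 := convi hj hv2
  have i6 := tensi hj hv2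
  have j1 : Integrable (fun p : ℝ × ℝ => v p.1 * (j p.2 * v (p.1 - p.2) - j p.2 * v p.1)) (volume.prod volume) :=
    (i1.sub i2).bdd_mul (c := k) (cv.comp continuous_fst).aestronglyMeasurable
      (Eventually.of_forall fun p => hk _)
  have e0 : (fun p : ℝ × ℝ => j p.2 * (v p.1 - v (p.1 - p.2))^2) = fun p =>
      (j p.2 * v (p.1 - p.2)^2 - j p.2 * v p.1 ^2) - 2 * (v p.1 * (j p.2 * v (p.1 - p.2) - j p.2 * v p.1)) := by
    funext p; ring
  have i56 : Integrable (fun p : ℝ × ℝ => j p.2 * v (p.1 - p.2)^2 - j p.2 * v p.1 ^2) (volume.prod volume) := i5.sub i6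
  have iT : Integrable (fun p : ℝ × ℝ => j p.2 * (v p.1 - v (p.1 - p.2))^2) (volume.prod volume) := by
    rw [e0]; exact i56.sub (j1.const_mul 2)
  have e1 : ∫ x, ∫ y, j y * (v x - v (x - y))^2 = ∫ p : ℝ × ℝ, j p.2 * (v p.1 - v (p.1 - p.2))^2 ∂(volume.prod volume) := by
    rw [integral_prod _ iT]
  rw [e1, e0, integral_sub i56 (j1.const_mul 2), integral_sub i5 i6, integral_prod _ i5, integral_prod _ i6, integral_const_mul,
    integral_prod _ j1]
  have := conv_total hj hj1 hv2
  simp only at this ⊢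
  rw [this]
  have t2 : ∀ x, ∫ y, j y * v x ^ 2 = v x ^ 2 := fun x => by rw [integral_mul_const, hj1, one_mul]
  simp only [t2, sub_self, zero_sub]
  rw [mul_neg, ← integral_const_mul, ← integral_const_mul]
  congr 1
  apply integral_congr_ae
  filter_upwards [i1.prod_right_ae, i2.prod_right_ae] with x k1 k2
  have s1 : ∫ y, (j y * v (x - y) - j y * v x) = (∫ y, j y * v (x-y)) - v x := by
    rw [integral_sub k1 k2, tens_total hj1]
  rw [integral_const_mul, s1]
  simp only [NLop]; ring

end nl

noncomputable def xi (R x : ℝ) : ℝ := 1 - x^2/R^2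
noncomputable def chi (n : ℕ) (R x : ℝ) : ℝ := xi R x ^ (n+2)
noncomputable def chi1 (n : ℕ) (R x : ℝ) : ℝ := (n+2) * xi R x ^ (n+1) * (-2*x/R^2)
noncomputable def chi2 (n : ℕ) (R x : ℝ) : ℝ :=
  (n+2) * ((n+1) * xi R x ^ n * (-2*x/R^2) * (-2*x/R^2) + xi R x ^ (n+1) * (-2/R^2))
noncomputable def T0 (n : ℕ) (R x : ℝ) : ℝ := min 1 ((n+2) * x^2/R^2)
noncomputable def TT (n : ℕ) (R x : ℝ) : ℝ := min 1 ((n+2) * (2*x^2+2)/R^2)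

section cut
variable {n : ℕ} {R : ℝ}

lemma hd_xi (R x : ℝ) : HasDerivAt (xi R) (-2*x/R^2) x := by
  unfold xi
  have := (((hasDerivAt_id x).pow 2).div_const (R^2)).const_sub 1
  refine this.congr_deriv ?_
  simp; ring

lemma hd_chi (n : ℕ) (R x : ℝ) : HasDerivAt (chi n R) (chi1 n R x) x := by
  unfold chi chi1
  refine ((hd_xi R x).pow (n+2)).congr_deriv ?_
  push_cast; simp

lemma hd_chi1 (n : ℕ) (R x : ℝ) : HasDerivAt (chi1 n R) (chi2 n R x) x := by
  unfold chi2
  have h1 := (((hd_xi R x).pow (n+1)).mul (((hasDerivAt_id x).const_mul (-2)).div_const (R^2))).const_mul ((n:ℝ)+2)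
  have e : chi1 n R = fun y => ((n:ℝ)+2) * ((xi R y)^(n+1) * (-2 * id y / R^2)) := by
    funext y; simp only [chi1, id]; ring
  rw [e]
  refine h1.congr_deriv ?_
  push_cast; simp

lemma c_xi (R : ℝ) : Continuous (xi R) := by unfold xi; fun_prop
lemma c_chi (n : ℕ) (R : ℝ) : Continuous (chi n R) := (c_xi R).pow _
lemma c_chi1 (n : ℕ) (R : ℝ) : Continuous (chi1 n R) := by
  unfold chi1; have := c_xi R; fun_prop
lemma c_chi2 (n : ℕ) (R : ℝ) : Continuous (chi2 n R) := by
  unfold chi2; have := c_xi R; fun_prop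
lemma c_T0 (n : ℕ) (R : ℝ) : Continuous (T0 n R) := by unfold T0; fun_prop
lemma c_TT (n : ℕ) (R : ℝ) : Continuous (TT n R) := by unfold TT; fun_prop

lemma xi_R (hR : 0 < R) : xi R R = 0 := by unfold xi; field_simp; ring
lemma xi_nR (hR : 0 < R) : xi R (-R) = 0 := by unfold xi; field_simp; ring
lemma chi_R (hR : 0 < R) : chi n R R = 0 := by simp [chi, xi_R hR]
lemma chi_nR (hR : 0 < R) : chi n R (-R) = 0 := by simp [chi, xi_nR hR]
lemma chi1_R (hR : 0 < R) : chi1 n R R = 0 := by simp [chi1, xi_R hR]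
lemma chi1_nR (hR : 0 < R) : chi1 n R (-R) = 0 := by simp [chi1, xi_nR hR]

lemma xi_mem (hR : 0 < R) {x : ℝ} (hx : x ∈ Set.Icc (-R) R) : 0 ≤ xi R x ∧ xi R x ≤ 1 := by
  have : x^2 ≤ R^2 := sq_le_sq' hx.1 hx.2
  unfold xi
  constructor
  · have : x^2/R^2 ≤ 1 := by rw [div_le_one (by positivity)]; exact this
    linarith
  · have : 0 ≤ x^2/R^2 := by positivity
    linarith

lemma chi_mem (hR : 0 < R) {x : ℝ} (hx : x ∈ Set.Icc (-R) R) : 0 ≤ chi n R x ∧ chi n R x ≤ 1 := by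
  obtain ⟨h1, h2⟩ := xi_mem hR hx
  exact ⟨pow_nonneg h1 _, pow_le_one₀ h1 h2⟩

lemma chi_abs (hR : 0 < R) {x : ℝ} (hx : x ∈ Set.Icc (-R) R) : |chi n R x| ≤ 1 := by
  obtain ⟨h1, h2⟩ := chi_mem (n := n) hR hx
  rwa [abs_of_nonneg h1]

lemma aux_x (hR : 0 < R) {x : ℝ} (hx : x ∈ Set.Icc (-R) R) : |-2*x/R^2| ≤ 2/R := by
  have : |x| ≤ R := abs_le.2 hx
  rw [abs_div, abs_mul, abs_of_pos (show 0 < R^2 by positivity)]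
  rw [div_le_div_iff₀ (by positivity) hR]
  simp
  nlinarith

lemma chi1_abs (hR : 0 < R) {x : ℝ} (hx : x ∈ Set.Icc (-R) R) :
    |chi1 n R x| ≤ 2*(n+2)/R * xi R x ^ (n+1) := by
  obtain ⟨h1, h2⟩ := xi_mem hR hx
  unfold chi1
  rw [abs_mul, abs_mul, abs_of_nonneg (show (0:ℝ) ≤ n+2 by positivity), abs_of_nonneg (pow_nonneg h1 _)]
  have := aux_x hR hx
  calc _ ≤ (n+2:ℝ) * xi R x ^ (n+1) * (2/R) := by gcongr
    _ = _ := by ring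

lemma chi1_abs' (hR : 0 < R) {x : ℝ} (hx : x ∈ Set.Icc (-R) R) : |chi1 n R x| ≤ 2*(n+2)/R := by
  obtain ⟨h1, h2⟩ := xi_mem hR hx
  refine (chi1_abs hR hx).trans ?_
  have : xi R x ^ (n+1) ≤ 1 := pow_le_one₀ h1 h2
  have h3 : (0:ℝ) ≤ 2*(n+2)/R := by positivity
  nlinarith

lemma chi2_abs (hR : 0 < R) {x : ℝ} (hx : x ∈ Set.Icc (-R) R) : |chi2 n R x| ≤ (n+2)*(4*(n+1)+2)/R^2 := by
  obtain ⟨h1, h2⟩ := xi_mem hR hx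
  have a1 := aux_x hR hx
  have p1 : xi R x ^ (n+1) ≤ 1 := pow_le_one₀ h1 h2
  have p0 : xi R x ^ n ≤ 1 := pow_le_one₀ h1 h2
  unfold chi2
  rw [abs_mul, abs_of_nonneg (show (0:ℝ) ≤ n+2 by positivity), mul_div_assoc (a := (n:ℝ)+2)]
  apply mul_le_mul_of_nonneg_left _ (by positivity)
  refine (abs_add_le _ _).trans ?_
  have b1 : |(n+1:ℝ) * xi R x ^ n * (-2*x/R^2) * (-2*x/R^2)| ≤ (n+1) * 1 * (2/R) * (2/R) := by
    rw [abs_mul, abs_mul, abs_mul, abs_of_nonneg (show (0:ℝ) ≤ n+1 by positivity), abs_of_nonneg (pow_nonneg h1 _)]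
    gcongr
  have b2 : |xi R x ^ (n+1) * (-2/R^2)| ≤ 1 * (2/R^2) := by
    rw [abs_mul, abs_of_nonneg (pow_nonneg h1 _), abs_div, abs_neg, abs_of_pos (show 0 < R^2 by positivity), abs_two]
    gcongr
  refine (add_le_add b1 b2).trans (le_of_eq ?_)
  field_simp; ring

lemma one_sub_chi (hR : 0 < R) {x : ℝ} (hx : x ∈ Set.Icc (-R) R) : 1 - chi n R x ≤ T0 n R x := by
  have h0 := chi_mem (n := n) hR hx
  unfold T0
  apply le_min (by linarith [h0.1])
  have hx2 : x^2/R^2 ≤ 1 := by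
    have := (xi_mem hR hx).1; unfold xi at this; linarith
  have := one_add_mul_le_pow (a := -(x^2/R^2)) (by linarith) (n+2)
  unfold chi xi
  push_cast at this
  have e : (1 + -(x^2/R^2))^(n+2) = (1 - x^2/R^2)^(n+2) := by ring
  rw [e] at this
  have e2 : ((n:ℝ)+2) * x^2/R^2 = (n+2) * (x^2/R^2) := by ring
  rw [e2]; linarith

lemma T0_nonneg (x : ℝ) : 0 ≤ T0 n R x := le_min zero_le_one (by positivity)
lemma TT_nonneg (x : ℝ) : 0 ≤ TT n R x := le_min zero_le_one (by positivity)
lemma T0_le1 (x : ℝ) : T0 n R x ≤ 1 := min_le_left _ _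
lemma TT_le1 (x : ℝ) : TT n R x ≤ 1 := min_le_left _ _
lemma TT_abs (x : ℝ) : |TT n R x| ≤ 1 := by rw [abs_of_nonneg (TT_nonneg x)]; exact TT_le1 x

lemma T0_out (hR : 0 < R) {x : ℝ} (hx : x ∉ Set.Ioc (-R) R) : T0 n R x = 1 := by
  unfold T0
  apply min_eq_left
  have : R^2 ≤ x^2 := by
    rw [Set.mem_Ioc, not_and_or, not_lt, not_le] at hx
    rcases hx with hx | hx <;> nlinarith
  rw [le_div_iff₀ (by positivity)]
  have : (0:ℝ) ≤ n := by positivity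
  nlinarith [sq_nonneg R]

lemma T0_shift {x z : ℝ} (hz : z ∈ Set.Icc (0:ℝ) 1) : T0 n R x ≤ TT n R (x+z) := by
  unfold T0 TT
  apply min_le_min le_rfl
  gcongr
  have := hz.1; have := hz.2
  nlinarith [sq_nonneg (x + 2*z)]

lemma T0_le_TT (x : ℝ) : T0 n R x ≤ TT n R x := by
  have := T0_shift (n := n) (R := R) (x := x) (z := 0) (by simp)
  simpa using this

/-- localisation -/
lemma loc (hR : 0 < R) {k : ℝ → ℝ} (hk : Integrable k) :
    |(∫ x in (-R)..R, chi n R x * k x) - ∫ x, k x| ≤ ∫ x, T0 n R x * |k x| := by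
  have hRR : -R ≤ R := by linarith
  have hk1 : Integrable (fun x => (Set.Ioc (-R) R).indicator (chi n R) x * k x) := by
    refine hk.bdd_mul (c := 1) ((c_chi n R).measurable.indicator measurableSet_Ioc).aestronglyMeasurable
      (Eventually.of_forall fun x => ?_)
    by_cases hx : x ∈ Set.Ioc (-R) R
    · rw [Set.indicator_of_mem hx]; exact chi_abs hR ⟨hx.1.le, hx.2⟩
    · rw [Set.indicator_of_notMem hx]; simp
  have e1 : (∫ x in (-R)..R, chi n R x * k x) = ∫ x, (Set.Ioc (-R) R).indicator (chi n R) x * k x := by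
    rw [intervalIntegral.integral_of_le hRR, ← integral_indicator measurableSet_Ioc]
    congr 1; funext x
    by_cases hx : x ∈ Set.Ioc (-R) R <;> simp [hx]
  rw [e1, ← integral_sub hk1 hk]
  refine abs_integral_le_integral_abs.trans ?_
  apply integral_mono (hk1.sub hk).abs
  · exact hk.abs.bdd_mul (c := 1) (c_T0 n R).aestronglyMeasurable (Eventually.of_forall fun x => by
      rw [Real.norm_eq_abs, abs_of_nonneg (T0_nonneg x)]; exact T0_le1 x)
  intro x
  simp only [Pi.sub_apply]
  have : (Set.Ioc (-R) R).indicator (chi n R) x * k x - k x = ((Set.Ioc (-R) R).indicator (chi n R) x - 1) * k x := by ring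
  rw [this, abs_mul]
  apply mul_le_mul_of_nonneg_right _ (abs_nonneg _)
  by_cases hx : x ∈ Set.Ioc (-R) R
  · have hx' : x ∈ Set.Icc (-R) R := ⟨hx.1.le, hx.2⟩
    rw [Set.indicator_of_mem hx, abs_of_nonpos (by linarith [(chi_mem (n := n) hR hx').2])]
    linarith [one_sub_chi (n := n) hR hx']
  · rw [Set.indicator_of_notMem hx, T0_out hR hx]; simp

lemma TT_int {k : ℝ → ℝ} (hk : Integrable k) : Integrable (fun x => TT n R x * k x) :=
  hk.bdd_mul (c := 1) (c_TT n R).aestronglyMeasurable (Eventually.of_forall fun x => TT_abs x)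

lemma T0_int {k : ℝ → ℝ} (hk : Integrable k) : Integrable (fun x => T0 n R x * k x) :=
  hk.bdd_mul (c := 1) (c_T0 n R).aestronglyMeasurable (Eventually.of_forall fun x => by
      rw [Real.norm_eq_abs, abs_of_nonneg (T0_nonneg x)]; exact T0_le1 x)

/-- localisation with a bound by two translates -/
lemma loc2 (hR : 0 < R) {k a : ℝ → ℝ} {C z : ℝ} (hk : Integrable k) (ha : Integrable a) (hC : 0 ≤ C)
    (hz : z ∈ Set.Icc (0:ℝ) 1) (hb : ∀ x, |k x| ≤ C * (|a x| + |a (x+z)|)) :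
    |(∫ x in (-R)..R, chi n R x * k x) - ∫ x, k x| ≤ C * (2 * ∫ x, TT n R x * |a x|) := by
  refine (loc hR hk).trans ?_
  have haz : Integrable (fun x => a (x+z)) := ha.comp_add_right z
  have h1 : ∫ x, T0 n R x * |k x| ≤ ∫ x, C * (TT n R x * |a x| + TT n R (x+z) * |a (x+z)|) := by
    have i2 : Integrable (fun x => TT n R (x+z) * |a (x+z)|) := (TT_int ha.abs).comp_add_right z
    apply integral_mono (T0_int hk.abs) (((TT_int ha.abs).add i2).const_mul C)
    intro x
    simp only
    have t1 := T0_le_TT (n := n) (R := R) x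
    have t2 := T0_shift (n := n) (R := R) (x := x) hz
    have t0 := T0_nonneg (n := n) (R := R) x
    calc T0 n R x * |k x| ≤ T0 n R x * (C * (|a x| + |a (x+z)|)) := mul_le_mul_of_nonneg_left (hb x) t0
      _ = C * (T0 n R x * |a x| + T0 n R x * |a (x+z)|) := by ring
      _ ≤ C * (TT n R x * |a x| + TT n R (x+z) * |a (x+z)|) := by gcongr
  refine h1.trans (le_of_eq ?_)
  rw [integral_const_mul, integral_add (TT_int ha.abs) ((TT_int ha.abs).comp_add_right z),
    integral_add_right_eq_self (fun x => TT n R x * |a x|) z]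
  ring

lemma TT_tend (x : ℝ) : Tendsto (fun R : ℕ => TT n R x) atTop (nhds 0) := by
  have h1 : Tendsto (fun R : ℕ => ((n:ℝ)+2) * (2*x^2+2)/(R:ℝ)^2) atTop (nhds 0) := by
    apply Tendsto.div_atTop tendsto_const_nhds
    exact (tendsto_pow_atTop two_ne_zero).comp tendsto_natCast_atTop_atTop
  refine squeeze_zero (fun R => TT_nonneg x) (fun R => min_le_right _ _) h1

lemma TT_tend_int {k : ℝ → ℝ} (hk : Integrable k) : Tendsto (fun R : ℕ => ∫ x, TT n R x * |k x|) atTop (nhds 0) := by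
  have := tendsto_integral_of_dominated_convergence (μ := volume) (F := fun (R : ℕ) x => TT n R x * |k x|)
    (f := fun _ => (0:ℝ)) (fun x => |k x|)
    (fun R => (TT_int hk.abs).1) hk.abs
    (fun R => Eventually.of_forall fun x => by
      rw [norm_mul, Real.norm_eq_abs, Real.norm_eq_abs, abs_abs]
      exact mul_le_of_le_one_left (abs_nonneg _) (TT_abs x))
    (Eventually.of_forall fun x => by
      have := (TT_tend (n := n) x).mul_const |k x|
      simpa using this)
  simpa using this

lemma TT_tend_time {v : ℝ → ℝ → ℝ} (vi : ∀ t, 0 < t → Integrable (v t))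
    (vc : ∀ t₀, 0 < t₀ → Tendsto (fun t => ∫ x, |v t x - v t₀ x|) (nhds t₀) (nhds 0))
    {s t : ℝ} (hs : 0 < s) (hst : s ≤ t) :
    Tendsto (fun R : ℕ => ∫ τ in s..t, ∫ x, TT n R x * |v τ x|) atTop (nhds 0) := by
  obtain ⟨G, hG0, hG⟩ := bdd_abs vi vc hs t
  have := intervalIntegral.tendsto_integral_filter_of_dominated_convergence (μ := volume) (a := s) (b := t)
    (l := atTop) (F := fun (R : ℕ) τ => ∫ x, TT n R x * |v τ x|) (f := fun _ => (0:ℝ)) (fun _ => G)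
    (Eventually.of_forall fun R => by
      rw [Set.uIoc_of_le hst]
      exact ((cont_abs (c_TT n R).measurable TT_abs vi vc).mono
        (fun z hz => lt_trans hs hz.1)).aestronglyMeasurable measurableSet_Ioc)
    (Eventually.of_forall fun R => Eventually.of_forall fun τ hτ => by
      rw [Set.uIoc_of_le hst] at hτ
      have hτ0 : 0 < τ := hs.trans hτ.1
      rw [Real.norm_eq_abs, abs_of_nonneg (integral_nonneg fun x => mul_nonneg (TT_nonneg x) (abs_nonneg _))]
      refine le_trans ?_ (hG τ ⟨hτ.1.le, hτ.2⟩)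
      apply integral_mono (TT_int (vi τ hτ0).abs) (vi τ hτ0).abs
      intro x
      exact mul_le_of_le_one_left (abs_nonneg _) (TT_le1 x))
    (by simp)
    (Eventually.of_forall fun τ hτ => by
      rw [Set.uIoc_of_le hst] at hτ
      exact TT_tend_int (vi τ (hs.trans hτ.1)))
  simpa using this

end cut

lemma energy_ftc {E A φ : ℝ → ℝ} {s t : ℝ} (hst : s ≤ t) (hE : ContinuousOn E (Set.Icc s t))
    (hd : ∀ τ ∈ Set.Ico s t, Tendsto (fun k => (E (τ+k) - E τ)/k) (nhdsWithin (0:ℝ) (Set.Ioi 0)) (nhds (A τ)))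
    (hφ : ContinuousOn φ (Set.Icc s t)) (hA : ∀ τ ∈ Set.Ioo s t, A τ ≤ φ τ) :
    E t - E s ≤ ∫ τ in s..t, φ τ := by
  refine intervalIntegral.sub_le_integral_of_hasDeriv_right_of_le hst hE (g' := A) ?_ hφ.integrableOn_Icc hA
  intro τ hτ
  rw [hasDerivWithinAt_iff_tendsto_slope' (by simp)]
  have h1 := hd τ ⟨hτ.1.le, hτ.2⟩
  have h2 : Tendsto (fun y => y - τ) (nhdsWithin τ (Set.Ioi τ)) (nhdsWithin (0:ℝ) (Set.Ioi 0)) := by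
    apply tendsto_nhdsWithin_of_tendsto_nhds_of_eventually_within
    · have : Tendsto (fun y => y - τ) (nhds τ) (nhds (τ - τ)) := (continuous_id.sub continuous_const).tendsto τ
      rw [sub_self] at this
      exact this.mono_left nhdsWithin_le_nhds
    · filter_upwards [self_mem_nhdsWithin] with y hy
      have hy : τ < y := hy
      exact sub_pos.2 hy
  refine (h1.comp h2).congr fun y => ?_
  simp only [Function.comp, slope_def_field]
  congr 2; ring_nf

lemma tangent_of_deriv2 {η η1 η2 : ℝ → ℝ} (h1 : ∀ p, HasDerivAt η (η1 p) p) (h2 : ∀ p, HasDerivAt η1 (η2 p) p)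
    (h0 : ∀ p, 0 ≤ η2 p) (p p' : ℝ) : η1 p * (p' - p) ≤ η p' - η p := by
  have hm : Monotone η1 := monotone_of_deriv_nonneg (fun p => (h2 p).differentiableAt)
    (fun p => by rw [(h2 p).deriv]; exact h0 p)
  rcases lt_trichotomy p p' with h | h | h
  · obtain ⟨c, hc, e⟩ := exists_hasDerivAt_eq_slope η η1 h (fun x _ => (h1 x).continuousAt.continuousWithinAt) (fun x _ => h1 x)
    have := hm hc.1.le
    rw [e, le_div_iff₀ (by linarith)] at this
    exact this
  · subst h; simp
  · obtain ⟨c, hc, e⟩ := exists_hasDerivAt_eq_slope η η1 h (fun x _ => (h1 x).continuousAt.continuousWithinAt) (fun x _ => h1 x)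
    have := hm hc.2.le
    rw [e, div_le_iff₀ (by linarith)] at this
    linarith

lemma Ent.ofSingle {S : Set ℝ} {C : ℝ} {η η1 η2 : ℝ → ℝ} (hC : 0 ≤ C) (h0S : (0:ℝ) ∈ S)
    (h1 : ∀ p, HasDerivAt η (η1 p) p) (h2 : ∀ p, HasDerivAt η1 (η2 p) p)
    (h0 : ∀ p, 0 ≤ η2 p) (hb : ∀ p ∈ S, |η1 p| ≤ C) (hz : η 0 = 0) :
    Ent S C (fun p _ => η p) (fun p _ => η1 p) (fun _ _ => 0) where
  C0 := hC
  mem0 := h0S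
  chain y1 y2 t d1 d2 hy1 hy2 := by
    have := (h1 (y1 t)).comp t hy1
    exact HasDerivAt.congr_deriv (f' := η1 (y1 t) * d1) this (by simp)
  cont := (dcont h1).comp continuous_fst
  contp := (dcont h2).comp continuous_fst
  contr := continuous_const
  lip p hp r hr p' hp' r' hr' := by
    have a1 := tangent_of_deriv2 h1 h2 h0 p p'
    have a2 := tangent_of_deriv2 h1 h2 h0 p' p
    have b1 : |η1 p * (p' - p)| ≤ C * |p' - p| := by
      rw [abs_mul]; exact mul_le_mul_of_nonneg_right (hb p hp) (abs_nonneg _)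
    have b2 : |η1 p' * (p - p')| ≤ C * |p' - p| := by
      rw [abs_mul, abs_sub_comm p p']; exact mul_le_mul_of_nonneg_right (hb p' hp') (abs_nonneg _)
    have b3 : 0 ≤ C * |r' - r| := by positivity
    rw [abs_le] at b1 b2
    rw [mul_add, abs_le]
    constructor <;> linarith [b1.1, b1.2, b2.1, b2.2]
  bp p hp r hr := hb p hp
  br p hp r hr := by simpa using hC
  zero := hz
  conv p hp r hr p' hp' r' hr' := by
    have := tangent_of_deriv2 h1 h2 h0 p p'
    simpa using this

lemma single_space {f η η1 η2 Q v v1 v2 : ℝ → ℝ} {μ R : ℝ} (n : ℕ) (hR : 0 < R)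
    (hf : Continuous f)
    (h1 : ∀ p, HasDerivAt η (η1 p) p) (h2 : ∀ p, HasDerivAt η1 (η2 p) p) (c2 : Continuous η2)
    (hQ : ∀ p, HasDerivAt Q (η1 p * f p) p)
    (hv : ∀ x, HasDerivAt v (v1 x) x) (hv1 : ∀ x, HasDerivAt v1 (v2 x) x) (cv2 : Continuous v2) :
    ∫ x in (-R)..R, chi n R x * (η1 (v x) * (-(f (v x) * v1 x) + μ * v2 x))
     = (∫ x in (-R)..R, chi1 n R x * Q (v x)) + μ * (∫ x in (-R)..R, chi2 n R x * η (v x))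
       - μ * ∫ x in (-R)..R, chi n R x * (η2 (v x) * v1 x^2) := by
  have cv := dcont hv
  have cv1 := dcont hv1
  have cη := dcont h1
  have cη1 := dcont h2
  have cQ := dcont hQ
  have k0 := c_chi n R
  have k1 := c_chi1 n R
  have k2 := c_chi2 n R
  have hd : ∀ x ∈ Set.uIcc (-R) R, HasDerivAt (fun x => - (chi n R x * Q (v x)) + μ * (chi n R x * (η1 (v x) * v1 x) - chi1 n R x * η (v x)))
      (chi n R x * (η1 (v x) * (-(f (v x) * v1 x) + μ * v2 x)) - (chi1 n R x * Q (v x) + μ * (chi2 n R x * η (v x))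
       - μ * (chi n R x * (η2 (v x) * v1 x^2)))) x := by
    intro x _
    have a1 := (hd_chi n R x).mul ((hQ (v x)).comp x (hv x))
    have a2 := (hd_chi n R x).mul (((h2 (v x)).comp x (hv x)).mul (hv1 x))
    have a3 := (hd_chi1 n R x).mul ((h1 (v x)).comp x (hv x))
    have := a1.neg.add ((a2.sub a3).const_mul μ)
    refine this.congr_deriv ?_
    simp only [Pi.mul_apply, Function.comp]
    ring
  have i1 : Continuous fun x => chi n R x * (η1 (v x) * (-(f (v x) * v1 x) + μ * v2 x)) := by fun_prop
  have i2 : Continuous fun x => chi1 n R x * Q (v x) := by fun_prop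
  have i3 : Continuous fun x => μ * (chi2 n R x * η (v x)) := by fun_prop
  have i4 : Continuous fun x => μ * (chi n R x * (η2 (v x) * v1 x^2)) := by fun_prop
  have i5 : Continuous fun x => chi1 n R x * Q (v x) + μ * (chi2 n R x * η (v x)) := by fun_prop
  have i6 : Continuous fun x => chi1 n R x * Q (v x) + μ * (chi2 n R x * η (v x)) - μ * (chi n R x * (η2 (v x) * v1 x^2)) := by fun_prop
  have := intervalIntegral.integral_eq_sub_of_hasDerivAt hd ((i1.sub i6).intervalIntegrable _ _)
  rw [intervalIntegral.integral_sub (i1.intervalIntegrable _ _) (i6.intervalIntegrable _ _),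
    intervalIntegral.integral_sub (i5.intervalIntegrable _ _) (i4.intervalIntegrable _ _),
    intervalIntegral.integral_add (i2.intervalIntegrable _ _) (i3.intervalIntegrable _ _),
    intervalIntegral.integral_const_mul, intervalIntegral.integral_const_mul,
    chi_R hR, chi_nR hR, chi1_R hR, chi1_nR hR] at this
  linarith

structure SolN (σ N : ℝ) (j : ℝ → ℝ) (μ : ℝ) (u g ut ux uxx : ℝ → ℝ → ℝ) : Prop where
  sol : Sol (fun p => |p| ^ σ) μ u g ut ux uxx
  hσ0 : 0 < σ
  hσ1 : σ < 1
  hN : 0 ≤ N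
  hj0 : ∀ x, 0 ≤ j x
  hj : Integrable j
  hj1 : ∫ y, j y = 1
  hg : ∀ t, 0 < t → g t = NLop N j (u t)

namespace SolN
variable {σ N : ℝ} {j : ℝ → ℝ} {μ : ℝ} {u g ut ux uxx : ℝ → ℝ → ℝ} {S : Set ℝ} {C : ℝ}
  {η η1 η2 Q : ℝ → ℝ}

lemma single_A (h : SolN σ N j μ u g ut ux uxx) (n : ℕ) {R : ℝ} (hR : 0 < R)
    (e : Ent S C (fun p _ => η p) (fun p _ => η1 p) (fun _ _ => 0))
    (h1 : ∀ p, HasDerivAt η (η1 p) p) (h2 : ∀ p, HasDerivAt η1 (η2 p) p) (c2 : Continuous η2)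
    (hQ : ∀ p, HasDerivAt Q (η1 p * |p|^σ) p) {τ : ℝ} (hτ : 0 < τ) (hS : ∀ x, u τ x ∈ S) :
    ∫ x in (-R)..R, chi n R x * (η1 (u τ x) * ut τ x + 0 * ut τ (x+0)) ≤
      (∫ x, η1 (u τ x) * g τ x) + C * (2 * ∫ x, TT n R x * |g τ x|)
      + ((∫ x in (-R)..R, chi1 n R x * Q (u τ x)) + μ * (((n:ℝ)+2)*(4*(n+1)+2)/R^2 * (C * ∫ x, |u τ x|))
       - μ * ∫ x in (-R)..R, chi n R x * (η2 (u τ x) * ux τ x^2)) := by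
  have hRR : -R ≤ R := by linarith
  have s := h.sol
  have cu := s.cu hτ
  have cux := s.cux hτ
  have cη1 := dcont h2
  have cη := dcont h1
  have k0 := c_chi n R
  have cf := s.hf
  have cuxx := s.uxxc τ hτ
  have cmain : Continuous fun x => chi n R x * (η1 (u τ x) * (-(|u τ x|^σ * ux τ x) + μ * uxx τ x)) := by
    have : Continuous fun x => |u τ x|^σ := cf.comp cu
    fun_prop
  have ig : IntervalIntegrable (fun x => chi n R x * (η1 (u τ x) * g τ x)) volume (-R) R := by
    have c : Continuous fun x => chi n R x * η1 (u τ x) := by fun_prop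
    have := (s.gii hτ (-R) R).continuousOn_mul c.continuousOn
    refine this.congr (fun x _ => ?_)
    ring
  have e1 : ∫ x in (-R)..R, chi n R x * (η1 (u τ x) * ut τ x + 0 * ut τ (x+0))
      = (∫ x in (-R)..R, chi n R x * (η1 (u τ x) * g τ x))
        + ∫ x in (-R)..R, chi n R x * (η1 (u τ x) * (-(|u τ x|^σ * ux τ x) + μ * uxx τ x)) := by
    rw [← intervalIntegral.integral_add ig (cmain.intervalIntegrable _ _)]
    congr 1; funext x
    rw [s.pde τ hτ x]; ring
  have e2 := single_space (μ := μ) n hR cf h1 h2 c2 hQ (s.hux τ hτ) (s.huxx τ hτ) cuxx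
  have ik : Integrable (fun x => η1 (u τ x) * g τ x) :=
    (s.gi τ hτ).bdd_mul (c := C) (cη1.comp cu).aestronglyMeasurable
      (Eventually.of_forall fun x => e.bp _ (hS x) _ (hS x))
  have e3 := loc2 (n := n) hR ik (s.gi τ hτ) e.C0 (z := 0) (by simp) (fun x => by
    rw [abs_mul, mul_add]
    have := mul_le_mul_of_nonneg_right (e.bp _ (hS x) _ (hS x)) (abs_nonneg (g τ x))
    have : 0 ≤ C * |g τ (x+0)| := mul_nonneg e.C0 (abs_nonneg _)
    linarith)
  have e3' := (abs_le.1 e3).2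
  have e4 : ∫ x in (-R)..R, chi2 n R x * η (u τ x) ≤ ((n:ℝ)+2)*(4*(n+1)+2)/R^2 * (C * ∫ x, |u τ x|) := by
    have k2 := c_chi2 n R
    calc ∫ x in (-R)..R, chi2 n R x * η (u τ x) ≤ ∫ x in (-R)..R, ((n:ℝ)+2)*(4*(n+1)+2)/R^2 * (C * |u τ x|) := by
          apply intervalIntegral.integral_mono_on hRR (Continuous.intervalIntegrable (by fun_prop) _ _)
            (Continuous.intervalIntegrable (by fun_prop) _ _)
          intro x hx
          refine (le_abs_self _).trans ?_
          rw [abs_mul]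
          have l := e.lip 0 e.mem0 0 e.mem0 _ (hS x) 0 e.mem0
          have z := e.zero
          rw [z] at l
          simp only [sub_zero, abs_zero, add_zero] at l
          exact mul_le_mul (chi2_abs hR hx) l (abs_nonneg _) (by positivity)
      _ ≤ _ := by
          rw [intervalIntegral.integral_const_mul, intervalIntegral.integral_const_mul]
          have := ii_le_full (s.ui τ hτ) hRR
          have := e.C0
          gcongr
  have e5 := mul_le_mul_of_nonneg_left e4 s.hμ.le
  rw [e1, e2]
  linarith

end SolN

noncomputable def E1 (h : ℝ → ℝ) (p : ℝ) : ℝ := ∫ s in (0:ℝ)..p, h s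
noncomputable def E0 (h : ℝ → ℝ) (p : ℝ) : ℝ := ∫ s in (0:ℝ)..p, E1 h s

section ee
variable {h : ℝ → ℝ}

lemma hd_E1 (hc : Continuous h) (p : ℝ) : HasDerivAt (E1 h) (h p) p :=
  intervalIntegral.integral_hasDerivAt_right (hc.intervalIntegrable _ _) (hc.stronglyMeasurableAtFilter _ _) hc.continuousAt

lemma hd_E0 (hc : Continuous h) (p : ℝ) : HasDerivAt (E0 h) (E1 h p) p :=
  hd_E1 (dcont (hd_E1 hc)) p

lemma E0_zero : E0 h 0 = 0 := by simp [E0]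
lemma E1_zero : E1 h 0 = 0 := by simp [E1]

lemma E1_bd (hc : Continuous h) (hi : Integrable h) (h0 : ∀ p, 0 ≤ h p) (p : ℝ) : |E1 h p| ≤ ∫ s, h s := by
  unfold E1
  rcases le_total 0 p with hp | hp
  · rw [intervalIntegral.integral_of_le hp, abs_of_nonneg (integral_nonneg h0)]
    exact setIntegral_le_integral hi (Eventually.of_forall h0)
  · rw [intervalIntegral.integral_symm, intervalIntegral.integral_of_le hp, abs_neg, abs_of_nonneg (integral_nonneg h0)]
    exact setIntegral_le_integral hi (Eventually.of_forall h0)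

lemma E0_nonneg (hc : Continuous h) (h0 : ∀ p, 0 ≤ h p) (p : ℝ) : 0 ≤ E0 h p := by
  have := tangent_of_deriv2 (hd_E0 hc) (hd_E1 hc) h0 0 p
  rw [E1_zero, E0_zero] at this
  linarith

lemma E0_pos (hc : Continuous h) (h0 : ∀ p, 0 ≤ h p) {p : ℝ} (hp : 0 < h p) (hp0 : p ≠ 0) : E0 h p ≠ 0 := by
  intro hz
  have hmin : IsLocalMin (E0 h) p := Eventually.of_forall fun x => by
    rw [hz]; exact E0_nonneg hc h0 x
  have h1 := hmin.hasDerivAt_eq_zero (hd_E0 hc p)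
  unfold E1 at h1
  rcases lt_or_gt_of_ne hp0 with h | h
  · have := intervalIntegral.integral_pos h hc.continuousOn (fun x _ => h0 x) ⟨p, ⟨le_rfl, h.le⟩, hp⟩
    rw [intervalIntegral.integral_symm] at h1; linarith
  · have := intervalIntegral.integral_pos h hc.continuousOn (fun x _ => h0 x) ⟨p, ⟨h.le, le_rfl⟩, hp⟩
    linarith

lemma E0_van {k : ℝ} (hk : ∀ p, |p| ≤ k → h p = 0) {p : ℝ} (hp : |p| ≤ k) : E0 h p = 0 := by
  have key : ∀ s, |s| ≤ |p| → E1 h s = 0 := by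
    intro s hs
    unfold E1
    have : ∫ r in (0:ℝ)..s, h r = ∫ r in (0:ℝ)..s, 0 := by
      apply intervalIntegral.integral_congr
      intro r hr
      apply hk
      have := Set.abs_sub_left_of_mem_uIcc hr
      simp only [sub_zero] at this
      linarith
    rw [this]; simp
  unfold E0
  have : ∫ r in (0:ℝ)..p, E1 h r = ∫ r in (0:ℝ)..p, 0 := by
    apply intervalIntegral.integral_congr
    intro r hr
    apply key
    have := Set.abs_sub_left_of_mem_uIcc hr
    simp only [sub_zero] at this
    linarith
  rw [this]; simp
end ee

/-! the auxiliary function -/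
noncomputable def Vb (θ p : ℝ) : ℝ := (1+p^2)^(θ/2) - 1
noncomputable def Vb1 (θ p : ℝ) : ℝ := θ * p * (1+p^2)^(θ/2-1)

lemma hd_Vb (θ p : ℝ) : HasDerivAt (Vb θ) (Vb1 θ p) p := by
  have h0 : (0:ℝ) < 1 + p^2 := by positivity
  have h1 : HasDerivAt (fun p:ℝ => 1 + p^2) (2*p) p := by
    have := ((hasDerivAt_id p).pow 2).const_add 1
    refine this.congr_deriv (by simp)
  have := (h1.rpow_const (p := θ/2) (Or.inl h0.ne')).sub_const 1
  refine this.congr_deriv ?_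
  unfold Vb1; ring

lemma c_Vb1 (θ : ℝ) : Continuous (Vb1 θ) := by
  unfold Vb1
  have : Continuous fun p : ℝ => (1+p^2)^(θ/2-1) := by
    apply Continuous.rpow_const (by fun_prop)
    intro x; left; positivity
  fun_prop

lemma Vb_nonneg {θ : ℝ} (hθ : 0 < θ) (p : ℝ) : 0 ≤ Vb θ p := by
  unfold Vb
  have := Real.one_le_rpow (x := 1+p^2) (z := θ/2) (by nlinarith [sq_nonneg p]) (by positivity)
  linarith

lemma Vb_sq {θ : ℝ} (hθ : 0 < θ) (hθ1 : θ < 1/2) (p : ℝ) : Vb θ p ^2 ≤ |p| := by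
  have h0 := Vb_nonneg hθ p
  have h1 : (Vb θ p + 1)^4 ≤ 1 + p^2 := by
    unfold Vb
    rw [sub_add_cancel, ← Real.rpow_natCast, ← Real.rpow_mul (by positivity)]
    calc (1+p^2)^(θ/2*(4:ℕ)) ≤ (1+p^2)^(1:ℝ) := by
          apply Real.rpow_le_rpow_of_exponent_le (by nlinarith [sq_nonneg p])
          push_cast; linarith
      _ = _ := Real.rpow_one _
  have h2 : (Vb θ p ^2)^2 ≤ |p|^2 := by
    rw [sq_abs]
    have : (Vb θ p + 1)^4 = (Vb θ p ^2)^2 + 1 + (4 * Vb θ p ^3 + 6 * Vb θ p^2 + 4 * Vb θ p) := by ring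
    have : 0 ≤ (4 * Vb θ p ^3 + 6 * Vb θ p^2 + 4 * Vb θ p) := by positivity
    linarith
  exact (pow_le_pow_iff_left₀ (by positivity) (by positivity) two_ne_zero).1 h2

lemma Vb_low {θ : ℝ} (hθ : 0 < θ) (p : ℝ) : |p|^(2*θ) ≤ 2 * Vb θ p^2 + 2 := by
  have h1 : |p|^(2*θ) ≤ (Vb θ p + 1)^2 := by
    unfold Vb
    rw [sub_add_cancel, ← Real.rpow_natCast ((1+p^2)^(θ/2)), ← Real.rpow_mul (by positivity), Real.rpow_mul (abs_nonneg p)]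
    have : |p|^(2:ℝ) = p^2 := by
      have := Real.rpow_natCast |p| 2
      push_cast at this
      rw [this, sq_abs]
    rw [this]
    have e : θ/2*((2:ℕ):ℝ) = θ := by push_cast; ring
    rw [e]
    apply Real.rpow_le_rpow (by positivity) (by linarith) hθ.le
  nlinarith [sq_nonneg (Vb θ p - 1)]

lemma Vb_bd {θ B : ℝ} (hθ : 0 < θ) {p : ℝ} (h : Vb θ p ^2 ≤ B) : |p| ≤ (B+2)^(2/θ) := by
  have h0 := Vb_nonneg hθ p
  have h1 : (1+p^2)^(θ/2) ≤ B + 2 := by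
    have : (1+p^2)^(θ/2) = Vb θ p + 1 := by unfold Vb; ring
    rw [this]
    nlinarith [sq_nonneg (Vb θ p - 1)]
  have h2 : 1 + p^2 ≤ (B+2)^(2/θ) := by
    have := Real.rpow_le_rpow (z := 2/θ) (by positivity) h1 (by positivity)
    rw [← Real.rpow_mul (by positivity)] at this
    have e : θ/2*(2/θ) = 1 := by field_simp
    rwa [e, Real.rpow_one] at this
  have : |p| ≤ 1 + p^2 := by nlinarith [sq_abs p, sq_nonneg (|p| - 1)]
  linarith

lemma Vb1_int {θ : ℝ} (hθ : 0 < θ) (hθ1 : θ < 1/2) : Integrable (fun p => Vb1 θ p ^2) := by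
  have h := integrable_rpow_neg_one_add_norm_sq (E := ℝ) (μ := volume) (r := 2*(1-θ)) (by simp; linarith)
  refine h.mono' ((c_Vb1 θ).pow 2).aestronglyMeasurable (Eventually.of_forall fun p => ?_)
  have hw : (0:ℝ) < 1 + p^2 := by positivity
  rw [Real.norm_eq_abs, abs_of_nonneg (by positivity)]
  have e : -(2*(1-θ))/2 = θ - 1 := by ring
  rw [e, Real.norm_eq_abs, sq_abs]
  unfold Vb1
  have e2 : (1+p^2)^(θ-1) = ((1+p^2)^(θ/2-1))^2 * (1+p^2) := by
    rw [← Real.rpow_natCast ((1+p^2)^(θ/2-1)), ← Real.rpow_mul hw.le]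
    nth_rewrite 3 [← Real.rpow_one (1+p^2)]
    rw [← Real.rpow_add hw]
    congr 1; push_cast; ring
  rw [e2, mul_pow, mul_comm]
  gcongr
  have : θ^2 ≤ 1 := by nlinarith
  rw [mul_pow]
  nlinarith [sq_nonneg p]

lemma flux_pt {σ θ ξ p : ℝ} {n : ℕ} (hσ : 0 < σ) (hθ : 2*θ = σ*((n+2)/(n+1))) (hξ : 0 ≤ ξ) (hξ1 : ξ ≤ 1) :
    |p|^σ * ξ^(n+1) ≤ 3 + 2 * Vb θ p^2 * ξ^(n+2) := by
  have hθ0 : 0 < θ := by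
    have : 0 < σ*(((n:ℝ)+2)/(n+1)) := by positivity
    linarith
  set a := |p|^σ * ξ^(n+1) with ha
  have ha0 : 0 ≤ a := by positivity
  have hr : (1:ℝ) ≤ ((n:ℝ)+2)/(n+1) := by rw [le_div_iff₀ (by positivity)]; linarith
  have h1 : a ≤ 1 + a^(((n:ℝ)+2)/(n+1)) := by
    rcases le_total a 1 with h | h
    · have := Real.rpow_nonneg ha0 (((n:ℝ)+2)/(n+1)); linarith
    · have := Real.rpow_le_rpow_of_exponent_le h hr
      rw [Real.rpow_one] at this; linarith
  have h2 : a^(((n:ℝ)+2)/(n+1)) = |p|^(2*θ) * ξ^(n+2) := by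
    rw [ha, Real.mul_rpow (by positivity) (by positivity), ← Real.rpow_mul (abs_nonneg p), hθ]
    congr 1
    rw [← Real.rpow_natCast, ← Real.rpow_mul hξ, ← Real.rpow_natCast]
    congr 1; push_cast; field_simp
  have h3 := Vb_low hθ0 p
  have h4 : ξ^(n+2) ≤ 1 := pow_le_one₀ hξ hξ1
  have h5 : 0 ≤ ξ^(n+2) := by positivity
  rw [h2] at h1
  nlinarith

/-- choice of the exponent -/
lemma exists_theta {σ : ℝ} (hσ : 0 < σ) (hσ1 : σ < 1) : ∃ (n : ℕ) (θ : ℝ), 0 < θ ∧ θ < 1/2 ∧ 2*θ = σ*(((n:ℝ)+2)/(n+1)) := by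
  obtain ⟨n, hn⟩ := exists_nat_gt (1/(1-σ))
  refine ⟨n, σ*(((n:ℝ)+2)/(n+1))/2, by positivity, ?_, by ring⟩
  rw [div_lt_iff₀ (by linarith)] at hn
  have : σ*(((n:ℝ)+2)/(n+1)) < 1 := by
    rw [← mul_div_assoc, div_lt_one (by positivity)]
    nlinarith
  linarith

noncomputable def Dt (θ : ℝ) (n : ℕ) (R : ℝ) (v v1 : ℝ → ℝ) : ℝ :=
  ∫ x in (-R)..R, chi n R x * (Vb1 θ (v x)^2 * v1 x^2)

lemma sup_V {θ R : ℝ} {n : ℕ} {v v1 : ℝ → ℝ} (hθ : 0 < θ) (hθ1 : θ < 1/2) (hR : 0 < R)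
    (hv : ∀ x, HasDerivAt v (v1 x) x) (cv1 : Continuous v1) (vi : Integrable v)
    {x : ℝ} (hx : x ∈ Set.Icc (-R) R) :
    Vb θ (v x)^2 * chi n R x ≤ (1 + 2*(n+2)/R) * (∫ y, |v y|) + Dt θ n R v v1 := by
  have hRR : -R ≤ R := by linarith
  have cv := dcont hv
  have cV := (dcont (hd_Vb θ)).comp cv
  have cV1 := (c_Vb1 θ).comp cv
  have k0 := c_chi n R
  have k1 := c_chi1 n R
  have cV' : Continuous fun y => Vb θ (v y) := cV
  have cV1' : Continuous fun y => Vb1 θ (v y) := cV1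
  have hd : ∀ y ∈ Set.uIcc (-R) x, HasDerivAt (fun y => Vb θ (v y)^2 * chi n R y)
      (2 * Vb θ (v y) * (Vb1 θ (v y) * v1 y) * chi n R y + Vb θ (v y)^2 * chi1 n R y) y := by
    intro y _
    have a := (((hd_Vb θ (v y)).comp y (hv y)).pow 2).mul (hd_chi n R y)
    refine a.congr_deriv ?_
    simp
  have e := intervalIntegral.integral_eq_sub_of_hasDerivAt hd (Continuous.intervalIntegrable (by fun_prop) _ _)
  rw [chi_nR hR, mul_zero, sub_zero] at e
  rw [← e]
  have c1 : Continuous fun y => (1 + 2*((n:ℝ)+2)/R) * |v y| := by fun_prop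
  have c2 : Continuous fun y => chi n R y * (Vb1 θ (v y)^2 * v1 y^2) := by fun_prop
  have pos : ∀ y ∈ Set.Icc (-R) R, 0 ≤ (1 + 2*((n:ℝ)+2)/R) * |v y| + chi n R y * (Vb1 θ (v y)^2 * v1 y^2) := by
    intro y hy
    have := (chi_mem (n := n) hR hy).1
    positivity
  calc _ ≤ ∫ y in (-R)..x, ((1 + 2*((n:ℝ)+2)/R) * |v y| + chi n R y * (Vb1 θ (v y)^2 * v1 y^2)) := by
        apply intervalIntegral.integral_mono_on hx.1 (Continuous.intervalIntegrable (by fun_prop) _ _)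
          ((c1.add c2).intervalIntegrable _ _)
        intro y hy
        have hy' : y ∈ Set.Icc (-R) R := ⟨hy.1, hy.2.trans hx.2⟩
        obtain ⟨q1, q2⟩ := chi_mem (n := n) hR hy'
        have b1 := chi1_abs' (n := n) hR hy'
        have b2 := Vb_sq hθ hθ1 (v y)
        have b3 : Vb θ (v y)^2 * chi1 n R y ≤ |v y| * (2*((n:ℝ)+2)/R) := by
          refine mul_le_mul_of_nonneg_left (le_abs_self _) (sq_nonneg _) |>.trans ?_
          exact mul_le_mul b2 b1 (abs_nonneg _) (abs_nonneg _)
        have b4 : 2 * Vb θ (v y) * (Vb1 θ (v y) * v1 y) * chi n R y ≤ |v y| + chi n R y * (Vb1 θ (v y)^2 * v1 y^2) := by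
          have : 2 * Vb θ (v y) * (Vb1 θ (v y) * v1 y) ≤ Vb θ (v y)^2 + Vb1 θ (v y)^2 * v1 y^2 := by
            nlinarith [sq_nonneg (Vb θ (v y) - Vb1 θ (v y) * v1 y)]
          have := mul_le_mul_of_nonneg_right this q1
          have : Vb θ (v y)^2 * chi n R y ≤ |v y| * 1 := mul_le_mul b2 q2 q1 (abs_nonneg _)
          linarith
        simp only [Pi.add_apply]
        linarith
    _ ≤ ∫ y in (-R)..R, ((1 + 2*((n:ℝ)+2)/R) * |v y| + chi n R y * (Vb1 θ (v y)^2 * v1 y^2)) := by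
        apply intervalIntegral.integral_mono_interval le_rfl hx.1 hx.2 _ ((c1.add c2).intervalIntegrable _ _)
        filter_upwards [ae_restrict_mem measurableSet_Ioc] with y hy
        exact pos y ⟨hy.1.le, hy.2⟩
    _ ≤ _ := by
        rw [intervalIntegral.integral_add (c1.intervalIntegrable _ _) (c2.intervalIntegrable _ _),
          intervalIntegral.integral_const_mul]
        have := ii_le_full vi hRR
        unfold Dt
        gcongr

lemma Dt_nonneg {θ R : ℝ} {n : ℕ} {v v1 : ℝ → ℝ} (hR : 0 < R) : 0 ≤ Dt θ n R v v1 := by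
  apply intervalIntegral.integral_nonneg (by linarith)
  intro y hy
  have := (chi_mem (n := n) hR hy).1
  positivity

lemma Q_bd {σ C : ℝ} {η1 : ℝ → ℝ} (hσ : 0 ≤ σ) (k : ℝ) (hb : ∀ p, |p| ≤ k → |η1 p| ≤ C) {p : ℝ} (hp : |p| ≤ k) :
    |∫ s in (0:ℝ)..p, η1 s * |s|^σ| ≤ C * (|p| * |p|^σ) := by
  have := intervalIntegral.norm_integral_le_of_norm_le_const (a := 0) (b := p) (C := C * |p|^σ) (f := fun s => η1 s * |s|^σ) (by
    intro s hs
    have h1 : |s| ≤ |p| := by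
      have := Set.abs_sub_left_of_mem_uIcc (Set.uIoc_subset_uIcc hs)
      simpa using this
    have h2 : |s|^σ ≤ |p|^σ := Real.rpow_le_rpow (abs_nonneg _) h1 hσ
    rw [Real.norm_eq_abs, abs_mul, abs_of_nonneg (Real.rpow_nonneg (abs_nonneg s) σ)]
    have h3 := hb s (h1.trans hp)
    exact mul_le_mul h3 h2 (by positivity) ((abs_nonneg _).trans h3))
  rw [sub_zero, Real.norm_eq_abs] at this
  linarith

lemma hd_Q {σ : ℝ} {η1 : ℝ → ℝ} (hσ : 0 < σ) (c : Continuous η1) (p : ℝ) :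
    HasDerivAt (fun p => ∫ s in (0:ℝ)..p, η1 s * |s|^σ) (η1 p * |p|^σ) p := by
  have cc : Continuous fun s => η1 s * |s|^σ :=
    c.mul (Continuous.rpow_const continuous_abs (fun _ => Or.inr hσ.le))
  exact hd_E1 cc p

/-- flux bound -/
lemma flux_bd {σ θ R C : ℝ} {n : ℕ} {v v1 Q : ℝ → ℝ} (hσ : 0 < σ) (hθ : 0 < θ) (hθ1 : θ < 1/2)
    (hθn : 2*θ = σ*(((n:ℝ)+2)/(n+1))) (hR : 0 < R) (hC : 0 ≤ C)
    (hv : ∀ x, HasDerivAt v (v1 x) x) (cv1 : Continuous v1) (vi : Integrable v)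
    (cQ : Continuous Q) (hQ : ∀ p, |Q p| ≤ C * (|p| * |p|^σ)) :
    ∫ x in (-R)..R, chi1 n R x * Q (v x) ≤
      2*(n+2)/R * C * (∫ y, |v y|) * (3 + 2*((1 + 2*(n+2)/R) * (∫ y, |v y|) + Dt θ n R v v1)) := by
  have hRR : -R ≤ R := by linarith
  have cv := dcont hv
  have k1 := c_chi1 n R
  set B := (1 + 2*((n:ℝ)+2)/R) * (∫ y, |v y|) + Dt θ n R v v1 with hB
  have hI : 0 ≤ ∫ y, |v y| := integral_nonneg fun _ => abs_nonneg _
  have hB0 : 0 ≤ B := by have := Dt_nonneg (θ := θ) (n := n) (v := v) (v1 := v1) hR; positivity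
  calc _ ≤ ∫ x in (-R)..R, 2*((n:ℝ)+2)/R * C * (3+2*B) * |v x| := by
        apply intervalIntegral.integral_mono_on hRR (Continuous.intervalIntegrable (by fun_prop) _ _)
          (Continuous.intervalIntegrable (by fun_prop) _ _)
        intro x hx
        obtain ⟨x0, x1⟩ := xi_mem hR hx
        refine (le_abs_self _).trans ?_
        rw [abs_mul]
        have b1 := chi1_abs (n := n) hR hx
        have b2 := hQ (v x)
        have b3 := sup_V (n := n) hθ hθ1 hR hv cv1 vi hx
        rw [← hB] at b3
        have b4 := flux_pt (p := v x) hσ hθn x0 x1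
        have b5 : |v x|^σ * xi R x^(n+1) ≤ 3 + 2*B := by
          have : chi n R x = xi R x^(n+2) := rfl
          rw [this] at b3; linarith
        calc _ ≤ (2*(n+2)/R * xi R x ^ (n+1)) * (C * (|v x| * |v x|^σ)) :=
              mul_le_mul b1 b2 (abs_nonneg _) (by positivity)
          _ = 2*((n:ℝ)+2)/R * C * |v x| * (|v x|^σ * xi R x^(n+1)) := by ring
          _ ≤ 2*((n:ℝ)+2)/R * C * |v x| * (3+2*B) := by gcongr
          _ = _ := by ring
    _ ≤ _ := by
        rw [intervalIntegral.integral_const_mul]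
        have := ii_le_full vi hRR
        calc _ ≤ 2*((n:ℝ)+2)/R * C * (3+2*B) * ∫ y, |v y| := by gcongr
          _ = _ := by ring

namespace SolN
variable {σ N : ℝ} {j : ℝ → ℝ} {μ : ℝ} {u g ut ux uxx : ℝ → ℝ → ℝ} {S : Set ℝ} {C : ℝ}
  {η η1 η2 Q : ℝ → ℝ}

noncomputable def C1 (n : ℕ) (μ C G : ℝ) : ℝ :=
  2*(n+2)*C*G*(3+2*((1+2*(n+2))*G)) + μ * (((n:ℝ)+2)*(4*(n+1)+2)*(C*G))

lemma gle (h : SolN σ N j μ u g ut ux uxx)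
    (e : Ent S C (fun p _ => η p) (fun p _ => η1 p) (fun _ _ => 0)) {τ : ℝ} (hτ : 0 < τ) (hS : ∀ x, u τ x ∈ S) :
    ∫ x, η1 (u τ x) * g τ x ≤ 0 := by
  have := NL_le h.hj0 h.hj h.hj1 h.hN (h.sol.ui τ hτ) (h.sol.cu hτ) e hS 0
  rw [h.hg τ hτ]
  simpa using this

lemma key (h : SolN σ N j μ u g ut ux uxx) {n : ℕ} {θ : ℝ} (hθ : 0 < θ) (hθ1 : θ < 1/2)
    (hθn : 2*θ = σ*(((n:ℝ)+2)/(n+1))) {ε G R : ℝ} (hε : 0 < ε)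
    (e : Ent Set.univ C (fun p _ => η p) (fun p _ => η1 p) (fun _ _ => 0))
    (h1 : ∀ p, HasDerivAt η (η1 p) p) (h2 : ∀ p, HasDerivAt η1 (η2 p) p) (c2 : Continuous η2)
    (hlow : ∀ p, ε * Vb1 θ p^2 ≤ η2 p)
    {τ : ℝ} (hτ : 0 < τ) (hG : ∫ x, |u τ x| ≤ G) (hR1 : 1 ≤ R) (hR : 2*(n+2)*C*G*4 ≤ μ*ε*R) :
    ∫ x in (-R)..R, chi n R x * (η1 (u τ x) * ut τ x + 0 * ut τ (x+0)) ≤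
      C * (2 * ∫ x, TT n R x * |g τ x|) + C1 n μ C G / R - μ*ε/2 * Dt θ n R (u τ) (ux τ) := by
  have hR0 : 0 < R := by linarith
  have s := h.sol
  have hμ := s.hμ
  have cη1 := dcont h2
  have C0 := e.C0
  have hQ := hd_Q h.hσ0 cη1
  have a := h.single_A n hR0 e h1 h2 c2 hQ hτ (fun _ => Set.mem_univ _)
  have b := flux_bd (n := n) h.hσ0 hθ hθ1 hθn hR0 e.C0 (s.hux τ hτ) (s.cux hτ) (s.ui τ hτ) (dcont hQ)
    (fun p => Q_bd h.hσ0.le |p| (fun q _ => e.bp q (Set.mem_univ _) 0 (Set.mem_univ _)) le_rfl)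
  have c := h.gle e hτ (fun _ => Set.mem_univ _)
  have hI : 0 ≤ ∫ y, |u τ y| := integral_nonneg fun _ => abs_nonneg _
  have hD := Dt_nonneg (θ := θ) (n := n) (v := u τ) (v1 := ux τ) hR0
  set D := Dt θ n R (u τ) (ux τ) with hDd
  have hG0 : 0 ≤ G := hI.trans hG
  have hdiv : 2*((n:ℝ)+2)/R ≤ 2*(n+2) := div_le_self (by positivity) hR1
  have b' : 2*((n:ℝ)+2)/R * C * (∫ y, |u τ y|) * (3 + 2*((1 + 2*(n+2)/R) * (∫ y, |u τ y|) + D))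
      ≤ 2*((n:ℝ)+2)/R * C * G * (3 + 2*((1 + 2*(n+2)) * G + D)) := by gcongr
  have b'' : 2*((n:ℝ)+2)/R * C * G * (3 + 2*((1 + 2*(n+2)) * G + D))
     = 2*(n+2)*C*G*(3+2*((1+2*(n+2))*G))/R + 2*(n+2)*C*G*2/R * D := by ring
  have b3 : 2*((n:ℝ)+2)*C*G*2/R * D ≤ μ*ε/2 * D := by
    apply mul_le_mul_of_nonneg_right _ hD
    rw [div_le_iff₀ hR0]; linarith
  have d : μ * (((n:ℝ)+2)*(4*(n+1)+2)/R^2 * (C * ∫ x, |u τ x|)) ≤ μ * (((n:ℝ)+2)*(4*(n+1)+2)*(C*G))/R := by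
    have : R ≤ R^2 := by nlinarith
    calc _ ≤ μ * (((n:ℝ)+2)*(4*(n+1)+2)/R * (C * G)) := by gcongr
      _ = _ := by ring
  have f : ε * D ≤ ∫ x in (-R)..R, chi n R x * (η2 (u τ x) * ux τ x^2) := by
    rw [hDd]; unfold Dt
    rw [← intervalIntegral.integral_const_mul]
    have cu := s.cu hτ
    have cux := s.cux hτ
    have k0 := c_chi n R
    have cV := (c_Vb1 θ).comp cu
    have cV' : Continuous fun x => Vb1 θ (u τ x) := cV
    apply intervalIntegral.integral_mono_on (by linarith) (Continuous.intervalIntegrable (by fun_prop) _ _)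
      (Continuous.intervalIntegrable (by fun_prop) _ _)
    intro x hx
    have q := (chi_mem (n := n) hR0 hx).1
    have := hlow (u τ x)
    calc _ = chi n R x * ((ε * Vb1 θ (u τ x)^2) * ux τ x^2) := by ring
      _ ≤ _ := by gcongr
  have f' := mul_le_mul_of_nonneg_left f hμ.le
  have hC1 : C1 n μ C G / R = 2*(n+2)*C*G*(3+2*((1+2*(n+2))*G))/R + μ * (((n:ℝ)+2)*(4*(n+1)+2)*(C*G))/R := by
    unfold C1; ring
  rw [hC1]
  linarith

lemma E_bd (h : SolN σ N j μ u g ut ux uxx) {n : ℕ} {R : ℝ} (hR : 0 < R)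
    (e : Ent S C (fun p _ => η p) (fun p _ => η1 p) (fun _ _ => 0)) (cη : Continuous η)
    {τ : ℝ} (hτ : 0 < τ) (hS : ∀ x, u τ x ∈ S) :
    |Fz (-R) R (chi n R) (fun p _ => η p) u τ 0| ≤ C * ∫ x, |u τ x| := by
  have hRR : -R ≤ R := by linarith
  have cu := h.sol.cu hτ
  have k0 := c_chi n R
  unfold Fz
  refine (intervalIntegral.abs_integral_le_integral_abs hRR).trans ?_
  calc _ ≤ ∫ x in (-R)..R, C * |u τ x| := by
        apply intervalIntegral.integral_mono_on hRR (Continuous.intervalIntegrable (by fun_prop) _ _)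
          (Continuous.intervalIntegrable (by fun_prop) _ _)
        intro x hx
        have l := e.lip 0 e.mem0 0 e.mem0 _ (hS x) 0 e.mem0
        have z := e.zero
        rw [z] at l
        simp only [sub_zero, abs_zero, add_zero] at l
        rw [abs_mul]
        have := chi_abs (n := n) hR hx
        have := mul_le_mul this l (abs_nonneg _) zero_le_one
        linarith
    _ ≤ _ := by
        rw [intervalIntegral.integral_const_mul]
        have := ii_le_full (h.sol.ui τ hτ) hRR
        have := e.C0
        gcongr

lemma E_lim (h : SolN σ N j μ u g ut ux uxx) {n : ℕ}
    (e : Ent S C (fun p _ => η p) (fun p _ => η1 p) (fun _ _ => 0))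
    {τ : ℝ} (hτ : 0 < τ) (hS : ∀ x, u τ x ∈ S) :
    Tendsto (fun R : ℕ => Fz (-(R:ℝ)) R (chi n R) (fun p _ => η p) u τ 0) atTop (nhds (∫ x, η (u τ x))) := by
  have ui := h.sol.ui τ hτ
  have ii := Psi_int ui (h.sol.cu hτ) e hS 0
  have := (TT_tend_int (n := n) ui).const_mul 2 |>.const_mul C
  simp only [mul_zero] at this
  rw [tendsto_iff_dist_tendsto_zero]
  refine squeeze_zero' (Eventually.of_forall fun _ => dist_nonneg) ?_ this
  filter_upwards [eventually_gt_atTop 0] with R hR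
  rw [Real.dist_eq]
  refine loc2 (Nat.cast_pos.2 hR) ii ui e.C0 (z := 0) (by simp) fun x => ?_
  have l := e.lip 0 e.mem0 0 e.mem0 _ (hS x) 0 e.mem0
  have z := e.zero
  rw [z] at l
  simp only [sub_zero, abs_zero, add_zero] at l
  have := mul_nonneg e.C0 (abs_nonneg (u τ (x+0)))
  rw [mul_add]; linarith

lemma cTT (h : SolN σ N j μ u g ut ux uxx) (n : ℕ) (R : ℝ) {s : ℝ} (hs : 0 < s) (t : ℝ) :
    ContinuousOn (fun τ => ∫ x, TT n R x * |g τ x|) (Set.Icc s t) :=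
  (cont_abs (c_TT n R).measurable (fun x => TT_abs x) h.sol.gi h.sol.gc).mono
    fun x hx => lt_of_lt_of_le hs hx.1

lemma cTTu (h : SolN σ N j μ u g ut ux uxx) (n : ℕ) (R : ℝ) {s : ℝ} (hs : 0 < s) (t : ℝ) :
    ContinuousOn (fun τ => ∫ x, TT n R x * |u τ x|) (Set.Icc s t) :=
  (cont_abs (c_TT n R).measurable (fun x => TT_abs x) h.sol.ui h.sol.uc).mono
    fun x hx => lt_of_lt_of_le hs hx.1

end SolN

namespace SolN
variable {σ N : ℝ} {j : ℝ → ℝ} {μ : ℝ} {u g ut ux uxx : ℝ → ℝ → ℝ} {S : Set ℝ} {C : ℝ}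
  {η η1 η2 Q : ℝ → ℝ}

lemma E_ftc (h : SolN σ N j μ u g ut ux uxx) {n : ℕ} {R : ℝ} (hR : 0 < R)
    (e : Ent S C (fun p _ => η p) (fun p _ => η1 p) (fun _ _ => 0))
    {s t : ℝ} (hs : 0 < s) (hst : s ≤ t) (hS : ∀ t, s ≤ t → ∀ x, u t x ∈ S) {φ : ℝ → ℝ}
    (hφ : ContinuousOn φ (Set.Icc s t))
    (hA : ∀ τ ∈ Set.Icc s t, ∫ x in (-R)..R, chi n R x * (η1 (u τ x) * ut τ x + 0 * ut τ (x+0)) ≤ φ τ) :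
    Fz (-R) R (chi n R) (fun p _ => η p) u t 0 - Fz (-R) R (chi n R) (fun p _ => η p) u s 0 ≤ ∫ τ in s..t, φ τ := by
  have hRR : -R ≤ R := by linarith
  refine energy_ftc (E := fun t => Fz (-R) R (chi n R) (fun p _ => η p) u t 0) hst
    (h.sol.Fz_tcont e (c_chi n R) (fun x hx => chi_abs hR hx) hRR hs hS (by simp))
    (fun τ hτ => h.sol.Fz_rderiv e (c_chi n R) (fun x hx => chi_abs hR hx) hRR (hs.trans_le hτ.1)
      (fun t' ht' => hS t' (hτ.1.trans ht'))) hφ (fun τ hτ => hA τ ⟨hτ.1.le, hτ.2.le⟩)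

lemma EI0 (h : SolN σ N j μ u g ut ux uxx) {n : ℕ} {θ : ℝ} (hθ : 0 < θ) (hθ1 : θ < 1/2)
    (hθn : 2*θ = σ*(((n:ℝ)+2)/(n+1))) {ε : ℝ} (hε : 0 < ε)
    (e : Ent Set.univ C (fun p _ => η p) (fun p _ => η1 p) (fun _ _ => 0))
    (h1 : ∀ p, HasDerivAt η (η1 p) p) (h2 : ∀ p, HasDerivAt η1 (η2 p) p) (c2 : Continuous η2)
    (hlow : ∀ p, ε * Vb1 θ p^2 ≤ η2 p) {s t : ℝ} (hs : 0 < s) (hst : s ≤ t) :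
    ∫ x, η (u t x) ≤ ∫ x, η (u s x) := by
  obtain ⟨G, hG0, hG⟩ := bdd_abs h.sol.ui h.sol.uc hs t
  have hμ := h.sol.hμ
  have l1 := (h.E_lim (n := n) e (hs.trans_le hst) (fun _ => Set.mem_univ _)).sub
    (h.E_lim (n := n) e hs (fun _ => Set.mem_univ _))
  have l2 : Tendsto (fun R : ℕ => C * (2 * ∫ τ in s..t, ∫ x, TT n R x * |g τ x|) + (t-s) * (C1 n μ C G / (R:ℝ))) atTop (nhds 0) := by
    have a := ((TT_tend_time (n := n) h.sol.gi h.sol.gc hs hst).const_mul 2).const_mul C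
    have b := (tendsto_const_div_atTop_nhds_zero_nat (C1 n μ C G)).const_mul (t-s)
    simpa using a.add b
  have := le_of_tendsto_of_tendsto l1 l2 ?_
  · linarith
  obtain ⟨R0, hR0⟩ := exists_nat_gt (2*(n+2)*C*G*4/(μ*ε))
  filter_upwards [eventually_ge_atTop 1, eventually_ge_atTop R0] with R hR1 hR2
  have hR1' : (1:ℝ) ≤ R := by exact_mod_cast hR1
  have hR2' : (R0:ℝ) ≤ R := by exact_mod_cast hR2
  have hR3 : 2*(n+2)*C*G*4 ≤ μ*ε*R := by
    rw [div_lt_iff₀ (by positivity)] at hR0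
    nlinarith [mul_pos hμ hε]
  have cT := h.cTT n R hs t
  have iT : IntervalIntegrable (fun τ => ∫ x, TT n R x * |g τ x|) volume s t := by
    apply ContinuousOn.intervalIntegrable
    rwa [Set.uIcc_of_le hst]
  have := h.E_ftc (n := n) (R := R) (by linarith) e hs hst (fun _ _ _ => Set.mem_univ _)
    (φ := fun τ => C * (2 * ∫ x, TT n R x * |g τ x|) + C1 n μ C G / R) (by fun_prop)
    (fun τ hτ => by
      have k := h.key hθ hθ1 hθn hε e h1 h2 c2 hlow (hs.trans_le hτ.1) (hG τ hτ) hR1' hR3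
      have d := Dt_nonneg (θ := θ) (n := n) (v := u τ) (v1 := ux τ) (R := R) (by linarith)
      have : 0 ≤ μ*ε/2 * Dt θ n R (u τ) (ux τ) := by positivity
      linarith)
  refine this.trans ?_
  rw [intervalIntegral.integral_add ((iT.const_mul 2).const_mul C) intervalIntegrable_const,
    intervalIntegral.integral_const_mul, intervalIntegral.integral_const_mul, intervalIntegral.integral_const, smul_eq_mul]

lemma EI (h : SolN σ N j μ u g ut ux uxx) (hC : 0 ≤ C)
    (h1 : ∀ p, HasDerivAt η (η1 p) p) (h2 : ∀ p, HasDerivAt η1 (η2 p) p) (c2 : Continuous η2)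
    (h0 : ∀ p, 0 ≤ η2 p) (hb : ∀ p, |η1 p| ≤ C) (hz : η 0 = 0) {s t : ℝ} (hs : 0 < s) (hst : s ≤ t) :
    ∫ x, η (u t x) ≤ ∫ x, η (u s x) := by
  obtain ⟨n, θ, hθ, hθ1, hθn⟩ := exists_theta h.hσ0 h.hσ1
  set hV : ℝ → ℝ := fun p => Vb1 θ p^2 with hVd
  have cV : Continuous hV := (c_Vb1 θ).pow 2
  have iV : Integrable hV := Vb1_int hθ hθ1
  have pV : ∀ p, 0 ≤ hV p := fun p => sq_nonneg _
  have I0 : 0 ≤ ∫ p, hV p := integral_nonneg pV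
  have e1 : Ent Set.univ C (fun p _ => η p) (fun p _ => η1 p) (fun _ _ => 0) :=
    Ent.ofSingle hC (Set.mem_univ _) h1 h2 h0 (fun p _ => hb p) hz
  have e2 : Ent Set.univ (∫ p, hV p) (fun p _ => E0 hV p) (fun p _ => E1 hV p) (fun _ _ => 0) :=
    Ent.ofSingle I0 (Set.mem_univ _) (hd_E0 cV) (hd_E1 cV) pV (fun p _ => E1_bd cV iV pV p) E0_zero
  have i1 : ∀ τ, 0 < τ → Integrable (fun x => η (u τ x)) := fun τ hτ =>
    Psi_int (h.sol.ui τ hτ) (h.sol.cu hτ) e1 (fun _ => Set.mem_univ _) 0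
  have i2 : ∀ τ, 0 < τ → Integrable (fun x => E0 hV (u τ x)) := fun τ hτ =>
    Psi_int (h.sol.ui τ hτ) (h.sol.cu hτ) e2 (fun _ => Set.mem_univ _) 0
  have key : ∀ ε : ℝ, 0 < ε → (∫ x, η (u t x)) + ε * (∫ x, E0 hV (u t x)) ≤ (∫ x, η (u s x)) + ε * ∫ x, E0 hV (u s x) := by
    intro ε hε
    have a1 : ∀ p, HasDerivAt (fun p => η p + ε * E0 hV p) (η1 p + ε * E1 hV p) p := fun p =>
      (h1 p).add ((hd_E0 cV p).const_mul ε)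
    have a2 : ∀ p, HasDerivAt (fun p => η1 p + ε * E1 hV p) (η2 p + ε * hV p) p := fun p =>
      (h2 p).add ((hd_E1 cV p).const_mul ε)
    have e3 : Ent Set.univ (C + ε * ∫ p, hV p) (fun p _ => η p + ε * E0 hV p) (fun p _ => η1 p + ε * E1 hV p) (fun _ _ => 0) := by
      refine Ent.ofSingle (η2 := fun p => η2 p + ε * hV p) (by positivity) (Set.mem_univ _) a1 a2 (fun p => ?_) (fun p _ => ?_) ?_
      · have := h0 p; have := pV p; positivity
      · refine (abs_add_le _ _).trans ?_
        rw [abs_mul, abs_of_pos hε]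
        have := hb p; have := E1_bd cV iV pV p
        gcongr
      · rw [hz, E0_zero]; simp
    have := h.EI0 hθ hθ1 hθn hε e3 a1 a2 (by fun_prop) (fun p => by
      show ε * hV p ≤ η2 p + ε * hV p
      linarith [h0 p]) hs hst
    rwa [integral_add (i1 t (hs.trans_le hst)) ((i2 t (hs.trans_le hst)).const_mul ε), integral_add (i1 s hs) ((i2 s hs).const_mul ε),
      integral_const_mul, integral_const_mul] at this
  set a := ∫ x, η (u t x)
  set b := ∫ x, E0 hV (u t x)
  set c := ∫ x, η (u s x)
  set d := ∫ x, E0 hV (u s x)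
  have l1 : Tendsto (fun ε : ℝ => a + ε * b) (nhdsWithin 0 (Set.Ioi 0)) (nhds (a + 0 * b)) :=
    (Continuous.tendsto (by fun_prop) 0).mono_left nhdsWithin_le_nhds
  have l2 : Tendsto (fun ε : ℝ => c + ε * d) (nhdsWithin 0 (Set.Ioi 0)) (nhds (c + 0 * d)) :=
    (Continuous.tendsto (by fun_prop) 0).mono_left nhdsWithin_le_nhds
  have := le_of_tendsto_of_tendsto l1 l2 (by
    filter_upwards [self_mem_nhdsWithin] with ε hε
    exact key ε hε)
  simpa using this

/-- boundedness at some time in `[s,t]` -/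
lemma exists_bdd (h : SolN σ N j μ u g ut ux uxx) {s t : ℝ} (hs : 0 < s) (hst : s < t) :
    ∃ τ ∈ Set.Icc s t, ∃ k, ∀ x, |u τ x| ≤ k := by
  obtain ⟨n, θ, hθ, hθ1, hθn⟩ := exists_theta h.hσ0 h.hσ1
  set hV : ℝ → ℝ := fun p => Vb1 θ p^2 with hVd
  have cV : Continuous hV := (c_Vb1 θ).pow 2
  have iV : Integrable hV := Vb1_int hθ hθ1
  have pV : ∀ p, 0 ≤ hV p := fun p => sq_nonneg _
  have I0 : 0 ≤ ∫ p, hV p := integral_nonneg pV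
  set C := ∫ p, hV p with hCd
  have e : Ent Set.univ C (fun p _ => E0 hV p) (fun p _ => E1 hV p) (fun _ _ => 0) :=
    Ent.ofSingle I0 (Set.mem_univ _) (hd_E0 cV) (hd_E1 cV) pV (fun p _ => E1_bd cV iV pV p) E0_zero
  obtain ⟨G, hG0, hG⟩ := bdd_abs h.sol.ui h.sol.uc hs t
  obtain ⟨Gg, hGg0, hGg⟩ := bdd_abs h.sol.gi h.sol.gc hs t
  have hμ := h.sol.hμ
  have hC10 : 0 ≤ C1 n μ C G := by unfold C1; positivity
  have hts : 0 < t - s := by linarith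
  -- the bound
  set B := (C * (2*Gg) + C1 n μ C G + (2*C*G + 1)/(t-s)) * (2/μ) with hB
  have hB1 : μ/2*B = C * (2*Gg) + C1 n μ C G + (2*C*G + 1)/(t-s) := by rw [hB]; field_simp
  have claim : ∀ R : ℕ, 1 ≤ (R:ℝ) → 2*(n+2)*C*G*4 ≤ μ*1*R → ∃ τ ∈ Set.Icc s t, Dt θ n R (u τ) (ux τ) ≤ B := by
    intro R hR1 hR3
    by_contra! hcon
    have := h.E_ftc (n := n) (R := R) (by linarith) e hs hst.le (fun _ _ _ => Set.mem_univ _)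
      (φ := fun τ => C * (2 * Gg) + C1 n μ C G - μ/2*B) continuousOn_const
      (fun τ hτ => by
        have k := h.key hθ hθ1 hθn zero_lt_one e (hd_E0 cV) (hd_E1 cV) cV (fun p => by simp [hVd]) (hs.trans_le hτ.1) (hG τ hτ) hR1 hR3
        have d := (hcon τ hτ).le
        have d' : μ*1/2*B ≤ μ*1/2 * Dt θ n R (u τ) (ux τ) := by gcongr
        have gg : ∫ x, TT n R x * |g τ x| ≤ Gg := by
          refine le_trans ?_ (hGg τ hτ)
          have gi := (h.sol.gi τ (hs.trans_le hτ.1)).abs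
          apply integral_mono (TT_int gi) gi
          intro x
          exact mul_le_of_le_one_left (abs_nonneg _) (TT_le1 x)
        have gg' : C * (2 * ∫ x, TT n R x * |g τ x|) ≤ C * (2*Gg) := by gcongr
        have cc : C1 n μ C G / R ≤ C1 n μ C G := div_le_self hC10 hR1
        linarith)
    rw [intervalIntegral.integral_const, smul_eq_mul, hB1] at this
    have b1 := abs_le.1 (h.E_bd (n := n) (R := R) (by linarith) e (dcont (hd_E0 cV)) (hs.trans hst) (fun _ => Set.mem_univ _))
    have b2 := abs_le.1 (h.E_bd (n := n) (R := R) (by linarith) e (dcont (hd_E0 cV)) hs (fun _ => Set.mem_univ _))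
    have g1 : C * ∫ x, |u t x| ≤ C * G := mul_le_mul_of_nonneg_left (hG t ⟨hst.le, le_rfl⟩) I0
    have g2 : C * ∫ x, |u s x| ≤ C * G := mul_le_mul_of_nonneg_left (hG s ⟨le_rfl, hst.le⟩) I0
    have e3 : (t-s) * (C * (2*Gg) + C1 n μ C G - (C * (2*Gg) + C1 n μ C G + (2*C*G + 1)/(t-s))) = -(2*C*G+1) := by
      field_simp; ring
    rw [e3] at this
    linarith [b1.1, b2.2]
  obtain ⟨R0, hR0⟩ := exists_nat_gt (2*(n+2)*C*G*4/(μ*1))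
  have claim2 : ∀ m : ℕ, ∃ τ ∈ Set.Icc s t, ∀ x ∈ Set.Icc (-((m+R0+1:ℕ):ℝ)) ((m+R0+1:ℕ):ℝ),
      Vb θ (u τ x)^2 * chi n ((m+R0+1:ℕ):ℝ) x ≤ (1+2*(n+2))*G + B := by
    intro m
    have hR1 : (1:ℝ) ≤ ((m+R0+1:ℕ):ℝ) := by push_cast; have : (0:ℝ) ≤ m := by positivity
                                            have : (0:ℝ) ≤ R0 := by positivity
                                            linarith
    have hR2 : (R0:ℝ) ≤ ((m+R0+1:ℕ):ℝ) := by exact_mod_cast (by omega)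
    have hR3 : 2*(n+2)*C*G*4 ≤ μ*1*((m+R0+1:ℕ):ℝ) := by
      rw [div_lt_iff₀ (by positivity)] at hR0
      nlinarith
    obtain ⟨τ, hτ, hD⟩ := claim _ hR1 hR3
    refine ⟨τ, hτ, fun x hx => ?_⟩
    have hτ0 := hs.trans_le hτ.1
    have := sup_V (n := n) hθ hθ1 (by linarith) (h.sol.hux τ hτ0) (h.sol.cux hτ0) (h.sol.ui τ hτ0) hx
    have hdiv : 2*((n:ℝ)+2)/((m+R0+1:ℕ):ℝ) ≤ 2*(n+2) := div_le_self (by positivity) hR1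
    have hg := hG τ hτ
    have hI : 0 ≤ ∫ y, |u τ y| := integral_nonneg fun _ => abs_nonneg _
    have : (1 + 2*((n:ℝ)+2)/((m+R0+1:ℕ):ℝ)) * (∫ y, |u τ y|) ≤ (1+2*(n+2))*G := by gcongr
    linarith
  choose τs hτs hV2 using claim2
  obtain ⟨τ, hτ, ψ, hψ, hlim⟩ := isCompact_Icc.tendsto_subseq hτs
  have hτ0 := hs.trans_le hτ.1
  refine ⟨τ, hτ, ((1+2*((n:ℝ)+2))*G + B + 2)^(2/θ), fun x => Vb_bd hθ ?_⟩
  have lu : Tendsto (fun m => u (τs (ψ m)) x) atTop (nhds (u τ x)) :=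
    ((h.sol.hut τ hτ0 x).continuousAt.tendsto).comp hlim
  have lV : Tendsto (fun m => Vb θ (u (τs (ψ m)) x)) atTop (nhds (Vb θ (u τ x))) :=
    ((hd_Vb θ (u τ x)).continuousAt.tendsto).comp lu
  have lR : Tendsto (fun m => ((ψ m+R0+1:ℕ):ℝ)) atTop atTop := by
    apply tendsto_natCast_atTop_atTop.comp
    exact tendsto_atTop_mono (fun m => by have := hψ.id_le m; simp only [id] at this ⊢; omega) tendsto_id
  have lc : Tendsto (fun m => chi n ((ψ m+R0+1:ℕ):ℝ) x) atTop (nhds 1) := by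
    unfold chi xi
    have : Tendsto (fun m => x^2/((ψ m+R0+1:ℕ):ℝ)^2) atTop (nhds 0) :=
      Tendsto.div_atTop tendsto_const_nhds ((tendsto_pow_atTop two_ne_zero).comp lR)
    simpa using (this.const_sub 1).pow (n+2)
  have lt := (lV.pow 2).mul lc
  rw [mul_one] at lt
  refine le_of_tendsto lt ?_
  filter_upwards [lR.eventually_ge_atTop |x|] with m hm
  exact hV2 (ψ m) x (abs_le.1 hm)

lemma bdd_later (h : SolN σ N j μ u g ut ux uxx) {s k : ℝ} (hs : 0 < s) (hk : ∀ x, |u s x| ≤ k) {t : ℝ} (hst : s ≤ t) (x : ℝ) :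
    |u t x| ≤ k := by
  set w : ℝ → ℝ := fun p => max (|p| - k) 0 * ((1+p^2)^2)⁻¹ with hw
  have k0 : 0 ≤ k := (abs_nonneg _).trans (hk 0)
  have cw : Continuous w := by
    have : Continuous fun p : ℝ => ((1+p^2)^2)⁻¹ := by
      apply Continuous.inv₀ (by fun_prop)
      intro p; positivity
    fun_prop
  have w0 : ∀ p, 0 ≤ w p := fun p => by positivity
  have iw : Integrable w := by
    refine integrable_inv_one_add_sq.mono' cw.aestronglyMeasurable (Eventually.of_forall fun p => ?_)
    rw [Real.norm_eq_abs, abs_of_nonneg (w0 p)]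
    have : max (|p| - k) 0 ≤ 1 + p^2 := by
      apply max_le _ (by positivity)
      nlinarith [sq_abs p, sq_nonneg (|p| - 1)]
    calc w p ≤ (1+p^2) * ((1+p^2)^2)⁻¹ := by simp only [hw]; gcongr
      _ = _ := by field_simp
  have van : ∀ p, |p| ≤ k → w p = 0 := fun p hp => by
    simp only [hw]; rw [max_eq_right (by linarith), zero_mul]
  have ht := hs.trans_le hst
  have I0 : 0 ≤ ∫ p, w p := integral_nonneg w0
  have ei := h.EI I0 (hd_E0 cw) (hd_E1 cw) cw w0 (fun p => E1_bd cw iw w0 p) E0_zero hs hst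
  have e : Ent Set.univ (∫ p, w p) (fun p _ => E0 w p) (fun p _ => E1 w p) (fun _ _ => 0) :=
    Ent.ofSingle I0 (Set.mem_univ _) (hd_E0 cw) (hd_E1 cw) w0 (fun p _ => E1_bd cw iw w0 p) E0_zero
  have i2 : Integrable (fun x => E0 w (u t x)) :=
    Psi_int (h.sol.ui t ht) (h.sol.cu ht) e (fun _ => Set.mem_univ _) 0
  have hz : ∫ x, E0 w (u s x) = 0 := by
    have : (fun x => E0 w (u s x)) = fun _ => 0 := by funext x; exact E0_van van (hk x)
    rw [this]; simp
  rw [hz] at ei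
  have nn : 0 ≤ fun x => E0 w (u t x) := fun x => E0_nonneg cw w0 _
  have hz2 : ∫ x, E0 w (u t x) = 0 := le_antisymm ei (integral_nonneg nn)
  have ae := (integral_eq_zero_iff_of_nonneg nn i2).1 hz2
  have cc : Continuous fun x => E0 w (u t x) := (dcont (hd_E0 cw)).comp (h.sol.cu ht)
  have all := (Continuous.ae_eq_iff_eq volume cc (continuous_const (y := (0:ℝ)))).1 ae
  have hx : E0 w (u t x) = 0 := congrFun all x
  by_contra! hcon
  have hp : 0 < w (u t x) := by
    simp only [hw]
    apply _root_.mul_pos (lt_max_of_lt_left (by linarith)) (by positivity)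
  exact E0_pos cw w0 hp (fun h0 => by rw [h0, abs_zero] at hcon; linarith) hx

lemma l1_decr (h : SolN σ N j μ u g ut ux uxx) {s t : ℝ} (hs : 0 < s) (hst : s ≤ t) :
    ∫ x, |u t x| ≤ ∫ x, |u s x| := by
  have key : ∀ δ : ℝ, 0 < δ → ∫ x, (√(δ^2 + u t x^2) - δ) ≤ ∫ x, |u s x| := by
    intro δ hδ
    have wp : ∀ p : ℝ, 0 < δ^2 + p^2 := fun p => by positivity
    have a1 : ∀ p, HasDerivAt (fun p => √(δ^2 + p^2) - δ) (p / √(δ^2+p^2)) p := by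
      intro p
      have b1 : HasDerivAt (fun p:ℝ => δ^2 + p^2) (2*p) p := by
        have := ((hasDerivAt_id p).pow 2).const_add (δ^2)
        refine this.congr_deriv (by simp)
      have := (b1.sqrt (wp p).ne').sub_const δ
      refine this.congr_deriv ?_
      rw [mul_div_mul_left _ _ two_ne_zero]
    have a2 : ∀ p, HasDerivAt (fun p => p / √(δ^2+p^2)) (δ^2 / (√(δ^2+p^2))^3) p := by
      intro p
      have sp : 0 < √(δ^2+p^2) := Real.sqrt_pos.2 (wp p)
      have b1 : HasDerivAt (fun p => √(δ^2 + p^2)) (p / √(δ^2+p^2)) p := by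
        have := (a1 p).add_const δ
        simpa using this
      have := (hasDerivAt_id p).div b1 sp.ne'
      refine this.congr_deriv ?_
      have sq := Real.sq_sqrt (wp p).le
      simp only [id]
      field_simp
      rw [sq]; ring
    have c2 : Continuous fun p : ℝ => δ^2 / (√(δ^2+p^2))^3 := by
      apply Continuous.div continuous_const (by fun_prop)
      intro p
      have := Real.sqrt_pos.2 (wp p)
      positivity
    have hle : ∀ p : ℝ, √(δ^2+p^2) - δ ≤ |p| := by
      intro p
      have : √(δ^2+p^2) ≤ δ + |p| := by
        rw [Real.sqrt_le_left (by positivity)]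
        nlinarith [sq_abs p, mul_nonneg hδ.le (abs_nonneg p)]
      linarith
    have hb : ∀ p, |p / √(δ^2+p^2)| ≤ 1 := by
      intro p
      have sp : 0 < √(δ^2+p^2) := Real.sqrt_pos.2 (wp p)
      rw [abs_div, abs_of_pos sp, div_le_one sp]
      apply Real.le_sqrt_of_sq_le
      rw [sq_abs]; nlinarith
    have ei := h.EI zero_le_one a1 a2 c2 (fun p => by positivity) hb (by simp [hδ.le]) hs hst
    refine ei.trans ?_
    have e : Ent Set.univ 1 (fun p _ => √(δ^2 + p^2) - δ) (fun p _ => p / √(δ^2+p^2)) (fun _ _ => 0) :=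
      Ent.ofSingle zero_le_one (Set.mem_univ _) a1 a2 (fun p => by positivity) (fun p _ => hb p) (by simp [hδ.le])
    exact integral_mono (Psi_int (h.sol.ui s hs) (h.sol.cu hs) e (fun _ => Set.mem_univ _) 0) (h.sol.ui s hs).abs (fun x => hle _)
  have ht := hs.trans_le hst
  have cu := h.sol.cu ht
  have lim : Tendsto (fun m : ℕ => ∫ x, (√((1/((m:ℝ)+1))^2 + u t x^2) - 1/((m:ℝ)+1))) atTop (nhds (∫ x, |u t x|)) := by
    have ld := tendsto_one_div_add_atTop_nhds_zero_nat (𝕜 := ℝ)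
    apply tendsto_integral_of_dominated_convergence (fun x => |u t x|)
    · intro m; exact Continuous.aestronglyMeasurable (by fun_prop)
    · exact (h.sol.ui t ht).abs
    · intro m
      refine Eventually.of_forall fun x => ?_
      have hδ : 0 < 1/((m:ℝ)+1) := by positivity
      rw [Real.norm_eq_abs, abs_le]
      constructor
      · have : 1/((m:ℝ)+1) ≤ √((1/((m:ℝ)+1))^2 + u t x^2) := Real.le_sqrt_of_sq_le (by nlinarith [sq_nonneg (u t x)])
        linarith [abs_nonneg (u t x)]
      · have : √((1/((m:ℝ)+1))^2 + u t x^2) ≤ 1/((m:ℝ)+1) + |u t x| := by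
          rw [Real.sqrt_le_left (by positivity)]
          nlinarith [sq_abs (u t x), mul_nonneg hδ.le (abs_nonneg (u t x))]
        linarith
    · refine Eventually.of_forall fun x => ?_
      have : Continuous fun δ : ℝ => √(δ^2 + u t x^2) - δ := by fun_prop
      have := (this.tendsto 0).comp ld
      simpa only [Function.comp_def, ne_eq, OfNat.ofNat_ne_zero, not_false_eq_true, zero_pow, zero_add, Real.sqrt_sq_eq_abs, sub_zero] using this
  exact le_of_tendsto lim (Eventually.of_forall fun m => key _ (by positivity))

end SolN

namespace SolN
variable {σ N : ℝ} {j : ℝ → ℝ} {μ : ℝ} {u g ut ux uxx : ℝ → ℝ → ℝ} {S : Set ℝ} {C : ℝ}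
  {η η1 η2 Q : ℝ → ℝ}

lemma g_bd (h : SolN σ N j μ u g ut ux uxx) {τ k : ℝ} (hτ : 0 < τ) (hk : ∀ x, |u τ x| ≤ k) (x : ℝ) : |g τ x| ≤ N * (2*k) := by
  rw [h.hg τ hτ]
  unfold NLop
  rw [abs_mul, abs_of_nonneg h.hN]
  have b : |∫ y, j y * u τ (x - y)| ≤ ∫ y, j y * k := by
    rw [← Real.norm_eq_abs]
    refine norm_integral_le_of_norm_le (h.hj.mul_const k) (Eventually.of_forall fun y => ?_)
    rw [Real.norm_eq_abs, abs_mul, abs_of_nonneg (h.hj0 y)]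
    exact mul_le_mul_of_nonneg_left (hk _) (h.hj0 y)
  rw [integral_mul_const, h.hj1, one_mul] at b
  have := abs_sub (∫ y, j y * u τ (x - y)) (u τ x)
  have := hk x
  have hN := h.hN
  gcongr
  linarith

lemma ug_int (h : SolN σ N j μ u g ut ux uxx) {τ k : ℝ} (hτ : 0 < τ) (hk : ∀ x, |u τ x| ≤ k) :
    Integrable (fun x => 2 * u τ x * g τ x) := by
  have cu := h.sol.cu hτ
  refine (h.sol.gi τ hτ).bdd_mul (c := 2*k) (Continuous.aestronglyMeasurable (by fun_prop)) (Eventually.of_forall fun x => ?_)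
  rw [Real.norm_eq_abs, abs_mul, abs_two]
  have := hk x
  linarith

lemma ug_cont (h : SolN σ N j μ u g ut ux uxx) {s t k : ℝ} (hs : 0 < s) (hk : ∀ τ, s ≤ τ → ∀ x, |u τ x| ≤ k) :
    ContinuousOn (fun τ => ∫ x, 2 * u τ x * g τ x) (Set.Icc s t) := by
  intro τ0 hτ0
  have h00 := hs.trans_le hτ0.1
  rw [ContinuousWithinAt, tendsto_iff_norm_sub_tendsto_zero]
  have l : Tendsto (fun τ => 2*k*(∫ x, |g τ x - g τ0 x|) + 2*(N*(2*k)) * ∫ x, |u τ x - u τ0 x|) (nhdsWithin τ0 (Set.Icc s t)) (nhds 0) := by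
    have := ((h.sol.gc τ0 h00).const_mul (2*k)).add ((h.sol.uc τ0 h00).const_mul (2*(N*(2*k))))
    simp only [mul_zero, add_zero] at this
    exact this.mono_left nhdsWithin_le_nhds
  refine squeeze_zero' (Eventually.of_forall fun _ => norm_nonneg _) ?_ l
  filter_upwards [self_mem_nhdsWithin] with τ hτ
  have hτ0' := hs.trans_le hτ.1
  have i1 : Integrable fun x => |g τ x - g τ0 x| := ((h.sol.gi τ hτ0').sub (h.sol.gi τ0 h00)).abs
  have i2 : Integrable fun x => |u τ x - u τ0 x| := ((h.sol.ui τ hτ0').sub (h.sol.ui τ0 h00)).abs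
  rw [← integral_sub (h.ug_int hτ0' (hk τ hτ.1)) (h.ug_int h00 (hk τ0 hτ0.1)), Real.norm_eq_abs]
  refine (abs_integral_le_integral_abs).trans ?_
  calc _ ≤ ∫ x, (2*k*|g τ x - g τ0 x| + 2*(N*(2*k)) * |u τ x - u τ0 x|) := by
        apply integral_mono ((h.ug_int hτ0' (hk τ hτ.1)).sub (h.ug_int h00 (hk τ0 hτ0.1))).abs
          ((i1.const_mul (2*k)).add (i2.const_mul _))
        intro x
        simp only [Pi.sub_apply]
        have e : 2 * u τ x * g τ x - 2 * u τ0 x * g τ0 x = 2 * u τ x * (g τ x - g τ0 x) + 2 * g τ0 x * (u τ x - u τ0 x) := by ring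
        rw [e]
        refine (abs_add_le _ _).trans ?_
        rw [abs_mul, abs_mul, abs_mul, abs_mul, abs_two]
        have q1 := mul_le_mul_of_nonneg_right (hk τ hτ.1 x) (abs_nonneg (g τ x - g τ0 x))
        have q2 := mul_le_mul_of_nonneg_right (h.g_bd h00 (hk τ0 hτ0.1) x) (abs_nonneg (u τ x - u τ0 x))
        simp only [Pi.add_apply]
        linarith
    _ = _ := by
        rw [integral_add (i1.const_mul (2*k)) (i2.const_mul _), integral_const_mul, integral_const_mul]

lemma energy (h : SolN σ N j μ u g ut ux uxx) {s t k : ℝ} (hs : 0 < s) (hst : s ≤ t) (hk : ∀ τ, s ≤ τ → ∀ x, |u τ x| ≤ k) :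
    - ∫ τ in s..t, ∫ x, 2 * u τ x * g τ x ≤ ∫ x, u s x^2 := by
  have k0 : 0 ≤ k := (abs_nonneg _).trans (hk s le_rfl 0)
  have a1 : ∀ p : ℝ, HasDerivAt (fun p => p^2) (2*p) p := fun p => by
    exact ((hasDerivAt_id p).pow 2).congr_deriv (by simp)
  have a2 : ∀ p : ℝ, HasDerivAt (fun p => 2*p) 2 p := fun p => by
    simpa using (hasDerivAt_id p).const_mul (2:ℝ)
  have e : Ent (Set.Icc (-k) k) (2*k) (fun p _ => p^2) (fun p _ => 2*p) (fun _ _ => 0) :=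
    Ent.ofSingle (by positivity) ⟨by linarith, k0⟩ a1 a2 (fun p => zero_le_two) (fun p hp => by
      rw [abs_mul, abs_two]; have := abs_le.2 hp; linarith) (by simp)
  have hS : ∀ τ, s ≤ τ → ∀ x, u τ x ∈ Set.Icc (-k) k := fun τ hτ x => abs_le.1 (hk τ hτ x)
  obtain ⟨G, hG0, hG⟩ := bdd_abs h.sol.ui h.sol.uc hs t
  have hμ := h.sol.hμ
  have ht := hs.trans_le hst
  set c1 := 2*((0:ℕ)+2:ℝ) * (2*k*k^σ*G) + μ * (((0:ℕ)+2:ℝ)*(4*((0:ℕ)+1)+2) * (2*k*G)) with hc1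
  have l1 := (h.E_lim (n := 0) e ht (hS t hst)).sub (h.E_lim (n := 0) e hs (hS s le_rfl))
  have l2 : Tendsto (fun R : ℕ => (∫ τ in s..t, ∫ x, 2 * u τ x * g τ x) + (2*k * (2 * ∫ τ in s..t, ∫ x, TT 0 R x * |g τ x|) + (t-s) * (c1 / (R:ℝ)))) atTop
      (nhds (∫ τ in s..t, ∫ x, 2 * u τ x * g τ x)) := by
    have a := ((TT_tend_time (n := 0) h.sol.gi h.sol.gc hs hst).const_mul 2).const_mul (2*k)
    have b := (tendsto_const_div_atTop_nhds_zero_nat c1).const_mul (t-s)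
    simpa using (a.add b).const_add (∫ τ in s..t, ∫ x, 2 * u τ x * g τ x)
  have := le_of_tendsto_of_tendsto l1 l2 ?_
  · have : 0 ≤ ∫ x, u t x^2 := integral_nonneg fun _ => sq_nonneg _
    linarith
  filter_upwards [eventually_ge_atTop 1] with R hR1
  have hR1' : (1:ℝ) ≤ R := by exact_mod_cast hR1
  have hR0 : (0:ℝ) < R := by linarith
  have hRR : -(R:ℝ) ≤ R := by linarith
  have cT := h.cTT 0 R hs t
  have cU := h.ug_cont (t := t) hs hk
  have iT : IntervalIntegrable (fun τ => ∫ x, TT 0 R x * |g τ x|) volume s t := by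
    apply ContinuousOn.intervalIntegrable
    rwa [Set.uIcc_of_le hst]
  have iU : IntervalIntegrable (fun τ => ∫ x, 2 * u τ x * g τ x) volume s t := by
    apply ContinuousOn.intervalIntegrable
    rwa [Set.uIcc_of_le hst]
  have := h.E_ftc (n := 0) (R := R) hR0 e hs hst hS
    (φ := fun τ => (∫ x, 2 * u τ x * g τ x) + (2*k * (2 * ∫ x, TT 0 R x * |g τ x|) + c1 / R)) (by fun_prop)
    (fun τ hτ => by
      have hτ0 := hs.trans_le hτ.1
      have hQ := hd_Q (σ := σ) h.hσ0 (η1 := fun p => 2*p) (by fun_prop)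
      have a := h.single_A 0 hR0 e a1 a2 continuous_const hQ hτ0 (hS τ hτ.1)
      have hI : 0 ≤ ∫ y, |u τ y| := integral_nonneg fun _ => abs_nonneg _
      have hg := hG τ hτ
      have fl : ∫ x in (-(R:ℝ))..R, chi1 0 R x * (∫ s in (0:ℝ)..(u τ x), 2*s * |s|^σ) ≤ 2*((0:ℕ)+2:ℝ)/R * (2*k*k^σ*G) := by
        have cu := h.sol.cu hτ0
        have cQ := (dcont hQ).comp cu
        have cQ' : Continuous fun x => (∫ s in (0:ℝ)..(u τ x), 2*s * |s|^σ) := cQ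
        have k1 := c_chi1 0 (R:ℝ)
        calc _ ≤ ∫ x in (-(R:ℝ))..R, 2*((0:ℕ)+2:ℝ)/R * (2*k*k^σ) * |u τ x| := by
              apply intervalIntegral.integral_mono_on hRR (Continuous.intervalIntegrable (by fun_prop) _ _)
                (Continuous.intervalIntegrable (by fun_prop) _ _)
              intro x hx
              refine (le_abs_self _).trans ?_
              rw [abs_mul]
              have q1 := chi1_abs' (n := 0) hR0 hx
              have q2 := Q_bd (σ := σ) (C := 2*k) (η1 := fun p => 2*p) h.hσ0.le k (fun p hp => by
                rw [abs_mul, abs_two]; linarith) (hk τ hτ.1 x)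
              have q3 : |u τ x|^σ ≤ k^σ := Real.rpow_le_rpow (abs_nonneg _) (hk τ hτ.1 x) h.hσ0.le
              calc _ ≤ (2*((0:ℕ)+2:ℝ)/R) * (2*k*(|u τ x| * |u τ x|^σ)) :=
                    mul_le_mul q1 q2 (abs_nonneg _) (by positivity)
                _ ≤ (2*((0:ℕ)+2:ℝ)/R) * (2*k*(|u τ x| * k^σ)) := by gcongr
                _ = _ := by ring
          _ ≤ _ := by
              rw [intervalIntegral.integral_const_mul]
              have := (ii_le_full (h.sol.ui τ hτ0) hRR).trans hg
              calc _ ≤ 2*((0:ℕ)+2:ℝ)/R * (2*k*k^σ) * G := by gcongr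
                _ = _ := by ring
      have d : μ * (((0:ℕ)+2:ℝ)*(4*((0:ℕ)+1)+2)/R^2 * (2*k * ∫ x, |u τ x|)) ≤ μ * (((0:ℕ)+2:ℝ)*(4*((0:ℕ)+1)+2)*(2*k*G))/R := by
        have : (R:ℝ) ≤ R^2 := by nlinarith
        calc _ ≤ μ * (((0:ℕ)+2:ℝ)*(4*((0:ℕ)+1)+2)/R * (2*k * G)) := by gcongr
          _ = _ := by ring
      have f : 0 ≤ ∫ x in (-(R:ℝ))..R, chi 0 R x * (2 * ux τ x^2) := by
        apply intervalIntegral.integral_nonneg hRR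
        intro x hx
        have := (chi_mem (n := 0) hR0 hx).1
        positivity
      have f' := mul_nonneg hμ.le f
      have ec : c1 / R = 2*((0:ℕ)+2:ℝ)/R * (2*k*k^σ*G) + μ * (((0:ℕ)+2:ℝ)*(4*((0:ℕ)+1)+2) * (2*k*G))/R := by
        rw [hc1]; ring
      rw [ec]
      linarith)
  refine this.trans (le_of_eq ?_)
  rw [intervalIntegral.integral_add iU (((iT.const_mul 2).const_mul (2*k)).add intervalIntegrable_const), intervalIntegral.integral_add ((iT.const_mul 2).const_mul (2*k)) intervalIntegrable_const,
    intervalIntegral.integral_const_mul, intervalIntegral.integral_const_mul, intervalIntegral.integral_const, smul_eq_mul]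

/-- the dissipation integral is bounded by the L² norm -/
lemma dissip (h : SolN σ N j μ u g ut ux uxx) {s t k : ℝ} (hs : 0 < s) (hst : s ≤ t) (hk : ∀ τ, s ≤ τ → ∀ x, |u τ x| ≤ k) :
    N * ∫ τ in Set.Ioc s t, ∫ x, ∫ y, j y * (u τ x - u τ (x-y))^2 ≤ ∫ x, u s x^2 := by
  refine le_trans (le_of_eq ?_) (h.energy hs hst hk)
  rw [← intervalIntegral.integral_of_le hst, ← intervalIntegral.integral_const_mul, ← intervalIntegral.integral_neg]
  apply intervalIntegral.integral_congr
  intro τ hτ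
  rw [Set.uIcc_of_le hst] at hτ
  have hτ0 := hs.trans_le hτ.1
  have := NL_sq (N := N) h.hj h.hj1 (h.sol.ui τ hτ0) (h.sol.cu hτ0) (hk τ hτ.1)
  simp only
  rw [this, h.hg τ hτ0]

end SolN

noncomputable def psi (p r : ℝ) : ℝ := 2*(p^2+r^2)^2 - p*r^3
noncomputable def psp (p r : ℝ) : ℝ := 8*p*(p^2+r^2) - r^3
noncomputable def psr (p r : ℝ) : ℝ := 8*r*(p^2+r^2) - 3*p*r^2

/-- second order form of `psi` -/
noncomputable def psh (p r a b : ℝ) : ℝ := 8*(p^2+r^2)*(a^2+b^2) + 16*(p*a+r*b)^2 - 6*r^2*a*b - 6*p*r*b^2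

lemma psh_nonneg (p r a b : ℝ) : 0 ≤ psh p r a b := by
  unfold psh
  have h1 : 6*r^2*a*b ≤ 3*r^2*(a^2+b^2) := by nlinarith [mul_nonneg (sq_nonneg r) (sq_nonneg (a-b))]
  have h2 : 6*p*r*b^2 ≤ 3*(p^2+r^2)*b^2 := by nlinarith [mul_nonneg (sq_nonneg b) (sq_nonneg (p-r))]
  nlinarith [sq_nonneg (p*a+r*b), mul_nonneg (sq_nonneg p) (sq_nonneg a), mul_nonneg (sq_nonneg p) (sq_nonneg b),
    mul_nonneg (sq_nonneg r) (sq_nonneg a), mul_nonneg (sq_nonneg r) (sq_nonneg b)]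

lemma psi_chain {y1 y2 : ℝ → ℝ} {t d1 d2 : ℝ} (h1 : HasDerivAt y1 d1 t) (h2 : HasDerivAt y2 d2 t) :
    HasDerivAt (fun s => psi (y1 s) (y2 s)) (psp (y1 t) (y2 t) * d1 + psr (y1 t) (y2 t) * d2) t := by
  have := ((((h1.pow 2).add (h2.pow 2)).pow 2).const_mul 2).sub (h1.mul (h2.pow 3))
  refine this.congr_deriv ?_
  simp [psp, psr]; ring

lemma psi1_chain {y1 y2 e1 e2 : ℝ → ℝ} {t d1 d2 : ℝ} (h1 : HasDerivAt y1 (e1 t) t) (h2 : HasDerivAt y2 (e2 t) t)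
    (k1 : HasDerivAt e1 d1 t) (k2 : HasDerivAt e2 d2 t) :
    HasDerivAt (fun s => psp (y1 s) (y2 s) * e1 s + psr (y1 s) (y2 s) * e2 s)
      (psp (y1 t) (y2 t) * d1 + psr (y1 t) (y2 t) * d2 + psh (y1 t) (y2 t) (e1 t) (e2 t)) t := by
  have q := (h1.pow 2).add (h2.pow 2)
  have a := ((((h1.const_mul 8).mul q).sub (h2.pow 3)).mul k1).add
    ((((h2.const_mul 8).mul q).sub ((h1.const_mul 3).mul (h2.pow 2))).mul k2)
  refine a.congr_deriv ?_
  simp [psp, psr, psh]; ring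

lemma psi_conv (p r p' r' : ℝ) : psp p r * (p' - p) + psr p r * (r' - r) ≤ psi p' r' - psi p r := by
  have l : ∀ (p p' t : ℝ), HasDerivAt (fun t => p + t*(p'-p)) (p'-p) t := fun p p' t => by
    have := ((hasDerivAt_id t).mul_const (p'-p)).const_add p
    simpa using this
  have := tangent_of_deriv2 (η := fun t => psi (p + t*(p'-p)) (r + t*(r'-r)))
    (η1 := fun t => psp (p + t*(p'-p)) (r + t*(r'-r)) * (p'-p) + psr (p + t*(p'-p)) (r + t*(r'-r)) * (r'-r))
    (η2 := fun t => psp (p + t*(p'-p)) (r + t*(r'-r)) * 0 + psr (p + t*(p'-p)) (r + t*(r'-r)) * 0 + psh (p + t*(p'-p)) (r + t*(r'-r)) (p'-p) (r'-r))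
    (fun t => psi_chain (l p p' t) (l r r' t))
    (fun t => psi1_chain (e1 := fun _ => p'-p) (e2 := fun _ => r'-r) (l p p' t) (l r r' t) (hasDerivAt_const _ _) (hasDerivAt_const _ _))
    (fun t => by have := psh_nonneg (p + t*(p'-p)) (r + t*(r'-r)) (p'-p) (r'-r); linarith) 0 1
  simpa using this

lemma psi_ent {k : ℝ} (hk : 0 ≤ k) : Ent (Set.Icc (-k) k) (20*k^3) psi psp psr := by
  have bp : ∀ p ∈ Set.Icc (-k) k, ∀ r ∈ Set.Icc (-k) k, |psp p r| ≤ 20*k^3 := by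
    intro p hp r hr
    have hp := abs_le.2 hp
    have hr := abs_le.2 hr
    unfold psp
    refine (abs_sub _ _).trans ?_
    rw [abs_mul, abs_mul, abs_pow, abs_of_nonneg (show 0 ≤ p^2+r^2 by positivity), ← sq_abs p, ← sq_abs r]
    calc _ ≤ |8| * k * (k^2+k^2) + k^3 := by gcongr
      _ ≤ _ := by rw [abs_of_pos (by norm_num)]; have : 0 ≤ k^3 := by positivity
                  nlinarith
  have br : ∀ p ∈ Set.Icc (-k) k, ∀ r ∈ Set.Icc (-k) k, |psr p r| ≤ 20*k^3 := by
    intro p hp r hr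
    have hp := abs_le.2 hp
    have hr := abs_le.2 hr
    unfold psr
    refine (abs_sub _ _).trans ?_
    rw [abs_mul, abs_mul, abs_mul, abs_mul, abs_pow, abs_of_nonneg (show 0 ≤ p^2+r^2 by positivity), ← sq_abs p, ← sq_abs r]
    calc _ ≤ |8| * k * (k^2+k^2) + |3| * k * k^2 := by
            gcongr
      _ ≤ _ := by rw [abs_of_pos (by norm_num), abs_of_pos (by norm_num)]; have : 0 ≤ k^3 := by positivity
                  nlinarith
  refine ⟨by positivity, ⟨by linarith, hk⟩, fun y1 y2 t d1 d2 h1 h2 => psi_chain h1 h2, ?_, ?_, ?_, ?_, bp, br, by simp [psi],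
    fun p _ r _ p' _ r' _ => psi_conv p r p' r'⟩
  · unfold psi; fun_prop
  · unfold psp; fun_prop
  · unfold psr; fun_prop
  · intro p hp r hr p' hp' r' hr'
    have a1 := psi_conv p r p' r'
    have a2 := psi_conv p' r' p r
    have b : ∀ (x y c : ℝ), |c| ≤ 20*k^3 → |c * (x-y)| ≤ 20*k^3 * |x-y| := fun x y c hc => by
      rw [abs_mul]; exact mul_le_mul_of_nonneg_right hc (abs_nonneg _)
    have b1 := abs_le.1 (b p' p _ (bp p hp r hr))
    have b2 := abs_le.1 (b r' r _ (br p hp r hr))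
    have b3 := abs_le.1 (b p p' _ (bp p' hp' r' hr'))
    have b4 := abs_le.1 (b r r' _ (br p' hp' r' hr'))
    rw [abs_sub_comm p p'] at b3
    rw [abs_sub_comm r r'] at b4
    rw [abs_le, mul_add]
    constructor <;> linarith [b1.1, b1.2, b2.1, b2.2, b3.1, b3.2, b4.1, b4.2]

lemma pr3_le (p r : ℝ) : |p*r^3| ≤ (p^2+r^2)^2 := by
  rw [abs_le]
  constructor <;> nlinarith [sq_nonneg (p-r), sq_nonneg (p+r), mul_nonneg (sq_nonneg r) (sq_nonneg (p-r)),
    mul_nonneg (sq_nonneg r) (sq_nonneg (p+r)), sq_nonneg (p^2), sq_nonneg (p*r), sq_nonneg (r^2)]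

lemma psi_low (p r : ℝ) : p^4 ≤ psi p r := by
  have := (abs_le.1 (pr3_le p r)).2
  unfold psi
  nlinarith [sq_nonneg (p^2), sq_nonneg (p*r), sq_nonneg (r^2)]

lemma psi_up (p r : ℝ) : psi p r ≤ 6*(p^4+r^4) := by
  have := (abs_le.1 (pr3_le p r)).1
  unfold psi
  nlinarith [sq_nonneg (p^2-r^2)]

/-! primitives -/
noncomputable def Sg (σ p : ℝ) : ℝ := |p|^σ * p

lemma hd_Sg {σ : ℝ} (hσ : 0 < σ) (p : ℝ) : HasDerivAt (Sg σ) ((σ+1) * |p|^σ) p := by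
  by_cases hp : p = 0
  · subst hp
    rw [abs_zero, Real.zero_rpow hσ.ne', mul_zero, hasDerivAt_iff_tendsto_slope]
    have c : Continuous fun p : ℝ => |p|^σ := Continuous.rpow_const continuous_abs (fun _ => Or.inr hσ.le)
    have := (c.tendsto 0).mono_left (nhdsWithin_le_nhds (s := {0}ᶜ))
    rw [abs_zero, Real.zero_rpow hσ.ne'] at this
    refine this.congr' ?_
    filter_upwards [self_mem_nhdsWithin] with x hx
    have hx : x ≠ 0 := hx
    simp [slope, Sg]
    field_simp
  · have h1 := (hasDerivAt_abs hp).rpow_const (p := σ) (Or.inl (abs_ne_zero.2 hp))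
    have := h1.mul (hasDerivAt_id p)
    refine this.congr_deriv ?_
    have ap : 0 < |p| := abs_pos.2 hp
    have e : |p|^(σ-1) * |p| = |p|^σ := by
      rw [Real.rpow_sub_one ap.ne']; field_simp
    have e2 : ((SignType.sign p : SignType) : ℝ) * p = |p| := sign_mul_self p
    simp only [id, mul_one]
    calc _ = σ * (|p|^(σ-1) * ((((SignType.sign p : SignType) : ℝ)) * p)) + |p|^σ := by ring
      _ = _ := by rw [e2, e]; ring

noncomputable def aa (σ p r : ℝ) : ℝ := 8*(Sg σ p * p^3/(σ+4) + r^2*(Sg σ p*p/(σ+2))) - r^3*(Sg σ p/(σ+1))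
noncomputable def P3 (σ p : ℝ) : ℝ := Sg σ p * p^3/(σ+4)
noncomputable def Mx (σ p r : ℝ) : ℝ := 8*(r^2*(Sg σ p*p/(σ+2)) - p^2*(Sg σ r*r/(σ+2))) - r^3*(Sg σ p/(σ+1)) + 3*p*(Sg σ r*r^2/(σ+3))
noncomputable def WW (σ p r : ℝ) : ℝ := 8*(P3 σ p - P3 σ r) + Mx σ p r
noncomputable def WWr (σ p r : ℝ) : ℝ := 16*r*(Sg σ p*p/(σ+2)) - 3*r^2*(Sg σ p/(σ+1)) - psr p r*|r|^σ

lemma aa_chain {σ : ℝ} (hσ : 0 < σ) {y1 y2 : ℝ → ℝ} {t d1 d2 : ℝ} (h1 : HasDerivAt y1 d1 t) (h2 : HasDerivAt y2 d2 t) :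
    HasDerivAt (fun s => aa σ (y1 s) (y2 s)) (psp (y1 t) (y2 t) * |y1 t|^σ * d1 +
      (WWr σ (y1 t) (y2 t) + psr (y1 t) (y2 t) * |y2 t|^σ) * d2) t := by
  have s : HasDerivAt (fun s => Sg σ (y1 s)) ((σ+1) * |y1 t|^σ * d1) t := (hd_Sg hσ (y1 t)).comp t h1
  have := ((((s.mul (h1.pow 3)).div_const (σ+4)).add ((h2.pow 2).mul ((s.mul h1).div_const (σ+2)))).const_mul 8).sub
    ((h2.pow 3).mul (s.div_const (σ+1)))
  refine this.congr_deriv ?_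
  simp [psp, psr, WWr, Sg]
  field_simp
  ring

lemma WW_chain {σ : ℝ} (hσ : 0 < σ) (p : ℝ) {y2 : ℝ → ℝ} {t d2 : ℝ} (h2 : HasDerivAt y2 d2 t) :
    HasDerivAt (fun s => WW σ p (y2 s)) (WWr σ p (y2 t) * d2) t := by
  have s : HasDerivAt (fun s => Sg σ (y2 s)) ((σ+1) * |y2 t|^σ * d2) t := (hd_Sg hσ (y2 t)).comp t h2
  have c := hasDerivAt_const t p
  have := ((((s.mul (h2.pow 3)).div_const (σ+4)).const_sub (P3 σ p)).const_mul 8).add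
    ((((((h2.pow 2).mul_const (Sg σ p*p/(σ+2))).sub (((s.mul h2).div_const (σ+2)).const_mul (p^2))).const_mul 8).sub
      ((h2.pow 3).mul_const (Sg σ p/(σ+1)))).add (((s.mul (h2.pow 2)).div_const (σ+3)).const_mul (3*p)))
  refine this.congr_deriv ?_
  simp [psr, WWr, Sg]
  field_simp
  ring

lemma WW_diag {σ : ℝ} (hσ : 0 < σ) (p : ℝ) : WW σ p p = 2*σ/((σ+1)*(σ+3)) * (|p|^σ * p^4) := by
  unfold WW Mx Sg
  field_simp
  ring

lemma abs_Sg {σ p : ℝ} : |Sg σ p| = |p|^σ * |p| := by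
  unfold Sg
  rw [abs_mul, abs_of_nonneg (Real.rpow_nonneg (abs_nonneg p) σ)]

lemma Mx_bd {σ : ℝ} (hσ : 0 < σ) (p r : ℝ) : |Mx σ p r| ≤ 20 * (|p| * (|r|^σ * |r|^3) + |r| * (|p|^σ * |p|^3)) := by
  have hd : ∀ (x c : ℝ), 1 ≤ c → |x/c| ≤ |x| := fun x c hc => by
    rw [abs_div]
    exact div_le_self (abs_nonneg _) (hc.trans (le_abs_self c))
  have t1 : |r^2*(Sg σ p*p/(σ+2))| ≤ |r|^2 * (|p|^σ * |p| * |p|) := by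
    rw [abs_mul, abs_pow]
    gcongr
    refine (hd _ _ (by linarith)).trans ?_
    rw [abs_mul, abs_Sg]
  have t2 : |p^2*(Sg σ r*r/(σ+2))| ≤ |p|^2 * (|r|^σ * |r| * |r|) := by
    rw [abs_mul, abs_pow]
    gcongr
    refine (hd _ _ (by linarith)).trans ?_
    rw [abs_mul, abs_Sg]
  have t3 : |r^3*(Sg σ p/(σ+1))| ≤ |r|^3 * (|p|^σ * |p|) := by
    rw [abs_mul, abs_pow]
    gcongr
    refine (hd _ _ (by linarith)).trans ?_
    rw [abs_Sg]
  have t4 : |p*(Sg σ r*r^2/(σ+3))| ≤ |p| * (|r|^σ * |r| * |r|^2) := by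
    rw [abs_mul]
    gcongr
    refine (hd _ _ (by linarith)).trans ?_
    rw [abs_mul, abs_Sg, abs_pow]
  set A := |p|^σ
  set B := |r|^σ
  have hA : 0 ≤ A := by positivity
  have hB : 0 ≤ B := by positivity
  set P := |p| with hP
  set Q := |r| with hQ
  have hP0 : 0 ≤ P := abs_nonneg _
  have hQ0 : 0 ≤ Q := abs_nonneg _
  set Z := P * (B * Q^3) + Q * (A * P^3) with hZ
  have g1 : Q^2*(A*P*P) ≤ Z ∧ P^2*(B*Q*Q) ≤ Z ∧ Q^3*(A*P) ≤ Z := by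
    have n1 : 0 ≤ P * (B * Q^3) := by positivity
    have n2 : 0 ≤ Q * (A * P^3) := by positivity
    rcases le_total P Q with hPQ | hPQ
    · have hAB : A ≤ B := Real.rpow_le_rpow hP0 hPQ hσ.le
      refine ⟨?_, ?_, ?_⟩
      · calc Q^2*(A*P*P) ≤ Q^2*(B*Q*P) := by gcongr
          _ = P * (B * Q^3) := by ring
          _ ≤ Z := by linarith
      · calc P^2*(B*Q*Q) = P*(P*(B*Q^2)) := by ring
          _ ≤ P*(Q*(B*Q^2)) := by gcongr
          _ = P * (B * Q^3) := by ring
          _ ≤ Z := by linarith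
      · calc Q^3*(A*P) ≤ Q^3*(B*P) := by gcongr
          _ = P * (B * Q^3) := by ring
          _ ≤ Z := by linarith
    · have hAB : B ≤ A := Real.rpow_le_rpow hQ0 hPQ hσ.le
      refine ⟨?_, ?_, ?_⟩
      · calc Q^2*(A*P*P) = Q*(Q*(A*P*P)) := by ring
          _ ≤ Q*(P*(A*P*P)) := by gcongr
          _ = Q * (A * P^3) := by ring
          _ ≤ Z := by linarith
      · calc P^2*(B*Q*Q) ≤ P^2*(A*P*Q) := by gcongr
          _ = Q * (A * P^3) := by ring
          _ ≤ Z := by linarith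
      · calc Q^3*(A*P) = Q*(Q^2*(A*P)) := by ring
          _ ≤ Q*(P^2*(A*P)) := by gcongr
          _ = Q * (A * P^3) := by ring
          _ ≤ Z := by linarith
  obtain ⟨g1, g2, g3⟩ := g1
  have g4 : P * (B*Q*Q^2) ≤ Z := by
    have n2 : 0 ≤ Q * (A * P^3) := by positivity
    calc P * (B*Q*Q^2) = P * (B * Q^3) := by ring
      _ ≤ Z := by linarith
  have e : Mx σ p r = 8*(r^2*(Sg σ p*p/(σ+2))) - 8*(p^2*(Sg σ r*r/(σ+2))) - r^3*(Sg σ p/(σ+1)) + 3*(p*(Sg σ r*r^2/(σ+3))) := by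
    unfold Mx; ring
  rw [e, abs_le]
  have s1 := abs_le.1 (t1.trans g1)
  have s2 := abs_le.1 (t2.trans g2)
  have s3 := abs_le.1 (t3.trans g3)
  have s4 := abs_le.1 (t4.trans g4)
  constructor <;> linarith [s1.1, s1.2, s2.1, s2.2, s3.1, s3.2, s4.1, s4.2]

lemma pow_bd {σ k p : ℝ} (hσ : 0 < σ) (hp : |p| ≤ k) (n : ℕ) : |p|^σ * |p|^n ≤ k^σ * k^n := by
  have h1 : |p|^σ ≤ k^σ := Real.rpow_le_rpow (abs_nonneg _) hp hσ.le
  have hk := (abs_nonneg p).trans hp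
  gcongr

lemma P3_bd {σ k p : ℝ} (hσ : 0 < σ) (hp : |p| ≤ k) : |P3 σ p| ≤ k^σ*k^3 * |p| := by
  unfold P3
  rw [abs_div]
  refine (div_le_self (abs_nonneg _) (by rw [abs_of_pos (by linarith)]; linarith)).trans ?_
  rw [abs_mul, abs_Sg, abs_pow]
  calc _ = |p|^σ * |p|^3 * |p| := by ring
    _ ≤ _ := mul_le_mul_of_nonneg_right (pow_bd hσ hp 3) (abs_nonneg _)

lemma aa_bd {σ k p r : ℝ} (hσ : 0 < σ) (hp : |p| ≤ k) (hr : |r| ≤ k) : |aa σ p r| ≤ 17*(k^σ*k^3) * |p| := by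
  have hd : ∀ (x c : ℝ), 1 ≤ c → |x/c| ≤ |x| := fun x c hc => by
    rw [abs_div]
    exact div_le_self (abs_nonneg _) (hc.trans (le_abs_self c))
  have hk := (abs_nonneg p).trans hp
  have t0 : |Sg σ p * p^3/(σ+4)| ≤ k^σ*k^3 * |p| := P3_bd hσ hp
  have t1 : |r^2*(Sg σ p*p/(σ+2))| ≤ k^σ*k^3 * |p| := by
    rw [abs_mul, abs_pow]
    calc _ ≤ k^2 * (|p|^σ * |p|^1 * |p|) := by
            gcongr
            refine (hd _ _ (by linarith)).trans ?_
            rw [abs_mul, abs_Sg, pow_one]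
      _ ≤ k^2 * (k^σ * k^1 * |p|) := by gcongr k^2 * (?_ * |p|); exact pow_bd hσ hp 1
      _ = _ := by ring
  have t3 : |r^3*(Sg σ p/(σ+1))| ≤ k^σ*k^3 * |p| := by
    rw [abs_mul, abs_pow]
    calc _ ≤ k^3 * (|p|^σ * |p|^0 * |p|) := by
            gcongr
            refine (hd _ _ (by linarith)).trans ?_
            rw [abs_Sg, pow_zero, mul_one]
      _ ≤ k^3 * (k^σ * k^0 * |p|) := by gcongr k^3 * (?_ * |p|); exact pow_bd hσ hp 0
      _ = _ := by ring
  unfold aa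
  have s1 := abs_le.1 t0
  have s2 := abs_le.1 t1
  have s3 := abs_le.1 t3
  rw [abs_le]
  constructor <;> linarith [s1.1, s1.2, s2.1, s2.2, s3.1, s3.2]

lemma young1 {σ δ p : ℝ} (hσ : 0 < σ) (hδ : 0 < δ) : |p|^σ * |p|^3 ≤ δ * (|p|^σ * p^4) + (1/δ)^σ * (1/δ)^2 * |p| := by
  have e : p^4 = |p|^4 := by rw [← abs_pow, abs_of_nonneg (by positivity)]
  rw [e]
  rcases le_total |p| (1/δ) with h | h
  · have := pow_bd hσ h 2
    have : |p|^σ * |p|^3 ≤ (1/δ)^σ * (1/δ)^2 * |p| := by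
      calc _ = |p|^σ * |p|^2 * |p| := by ring
        _ ≤ _ := by gcongr
    have : 0 ≤ δ * (|p|^σ * |p|^4) := by positivity
    linarith
  · have h1 : 1 ≤ δ * |p| := by rw [div_le_iff₀ hδ] at h; linarith
    have h2 : |p|^σ * |p|^3 * 1 ≤ |p|^σ * |p|^3 * (δ * |p|) := by gcongr
    have : 0 ≤ (1/δ)^σ * (1/δ)^2 * |p| := by positivity
    nlinarith

lemma young2 {σ c y T β p : ℝ} {m : ℕ} (hσ : 0 < σ) (hc : 0 < c) (hβ : 0 < β) (hm : 3 ≤ σ*m) (hy : 0 ≤ y) (hyT : y ≤ T) :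
    β * y^m * p^4 ≤ c * y^(m+1) * (|p|^σ * p^4) + β * ((β/c)^m + T^m) * |p| := by
  have e : p^4 = |p|^4 := by rw [← abs_pow, abs_of_nonneg (by positivity)]
  rw [e]
  set P := |p| with hP
  have hP0 : 0 ≤ P := abs_nonneg _
  have hT : 0 ≤ T := hy.trans hyT
  rcases le_total (y * P^σ) (β/c) with h | h
  · have hn : 0 ≤ c * y^(m+1) * (P^σ * P^4) := by positivity
    have : y^m * P^3 ≤ (β/c)^m + T^m := by
      rcases le_total P 1 with h1 | h1
      · have : y^m * P^3 ≤ T^m * 1 := by gcongr; exact pow_le_one₀ hP0 h1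
        have : 0 ≤ (β/c)^m := by positivity
        linarith
      · have a : P^3 ≤ (P^σ)^m := by
          rw [← Real.rpow_natCast, ← Real.rpow_natCast, ← Real.rpow_mul hP0]
          exact Real.rpow_le_rpow_of_exponent_le h1 (by push_cast; exact hm)
        have : y^m * P^3 ≤ (β/c)^m := by
          calc y^m * P^3 ≤ y^m * (P^σ)^m := by gcongr
            _ = (y*P^σ)^m := by rw [mul_pow]
            _ ≤ _ := by gcongr
        have : 0 ≤ T^m := by positivity
        linarith
    have := mul_le_mul_of_nonneg_left this (mul_nonneg hβ.le hP0)
    nlinarith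
  · rw [div_le_iff₀ hc] at h
    have : 0 ≤ β * ((β/c)^m + T^m) * P := by positivity
    have h3 : y^m * P^4 * β ≤ y^m * P^4 * (y*P^σ*c) := by gcongr
    have : c * y^(m+1) * (P^σ * P^4) = y^m * P^4 * (y*P^σ*c) := by ring
    linarith

lemma c_psp : Continuous fun q : ℝ × ℝ => psp q.1 q.2 := by unfold psp; fun_prop
lemma c_psr : Continuous fun q : ℝ × ℝ => psr q.1 q.2 := by unfold psr; fun_prop
lemma c_psi : Continuous fun q : ℝ × ℝ => psi q.1 q.2 := by unfold psi; fun_prop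
lemma c_Sg {σ : ℝ} (hσ : 0 < σ) : Continuous (Sg σ) := dcont (hd_Sg hσ)
lemma c_pw {σ : ℝ} (hσ : 0 < σ) : Continuous fun p : ℝ => |p|^σ :=
  Continuous.rpow_const continuous_abs (fun _ => Or.inr hσ.le)
lemma c_aa {σ : ℝ} (hσ : 0 < σ) : Continuous fun q : ℝ × ℝ => aa σ q.1 q.2 := by
  have := c_Sg hσ
  unfold aa; fun_prop
lemma c_P3 {σ : ℝ} (hσ : 0 < σ) : Continuous (P3 σ) := by
  have := c_Sg hσ
  unfold P3; fun_prop
lemma c_Mx {σ : ℝ} (hσ : 0 < σ) : Continuous fun q : ℝ × ℝ => Mx σ q.1 q.2 := by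
  have := c_Sg hσ
  unfold Mx; fun_prop
lemma c_WW {σ : ℝ} (hσ : 0 < σ) : Continuous fun q : ℝ × ℝ => WW σ q.1 q.2 := by
  have := c_Mx hσ
  have := c_P3 hσ
  unfold WW; fun_prop
lemma c_WWr {σ : ℝ} (hσ : 0 < σ) : Continuous fun q : ℝ × ℝ => WWr σ q.1 q.2 := by
  have := c_Sg hσ
  have := c_psr
  have h : Continuous fun q : ℝ × ℝ => |q.2|^σ := (c_pw hσ).comp continuous_snd
  unfold WWr; fun_prop

set_option maxHeartbeats 2000000 in
lemma pair_space {σ μ R z : ℝ} {v v1 v2 : ℝ → ℝ} (n : ℕ) (hR : 0 < R) (hσ : 0 < σ)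
    (hv : ∀ x, HasDerivAt v (v1 x) x) (hv1 : ∀ x, HasDerivAt v1 (v2 x) x) (cv2 : Continuous v2) :
    ∫ x in (-R)..R, chi n R x * (psp (v x) (v (x+z)) * (-(|v x|^σ * v1 x) + μ * v2 x)
        + psr (v x) (v (x+z)) * (-(|v (x+z)|^σ * v1 (x+z)) + μ * v2 (x+z)))
     = (∫ x in (-R)..R, chi1 n R x * aa σ (v x) (v (x+z)))
       + (∫ x in (-R)..R, chi n R x * (WWr σ (v x) (v (x+z)) * v1 (x+z)))
       + μ * (∫ x in (-R)..R, chi2 n R x * psi (v x) (v (x+z)))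
       - μ * ∫ x in (-R)..R, chi n R x * psh (v x) (v (x+z)) (v1 x) (v1 (x+z)) := by
  have cv := dcont hv
  have cv1 := dcont hv1
  have k0 := c_chi n R
  have k1 := c_chi1 n R
  have k2 := c_chi2 n R
  have cz : Continuous fun x => (v x, v (x+z)) := by fun_prop
  have m1 : Continuous fun x => psp (v x) (v (x+z)) := c_psp.comp cz
  have m2 : Continuous fun x => psr (v x) (v (x+z)) := c_psr.comp cz
  have m3 : Continuous fun x => psi (v x) (v (x+z)) := c_psi.comp cz
  have m4 : Continuous fun x => aa σ (v x) (v (x+z)) := (c_aa hσ).comp cz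
  have m5 : Continuous fun x => WWr σ (v x) (v (x+z)) := (c_WWr hσ).comp cz
  have m6 : Continuous fun x => psh (v x) (v (x+z)) (v1 x) (v1 (x+z)) := by unfold psh; fun_prop
  have m7 : Continuous fun x => |v x|^σ := (c_pw hσ).comp cv
  have m8 : Continuous fun x => |v (x+z)|^σ := (c_pw hσ).comp (by fun_prop : Continuous fun x => v (x+z))
  have hd : ∀ x ∈ Set.uIcc (-R) R, HasDerivAt (fun x => - (chi n R x * aa σ (v x) (v (x+z)))
        + μ * (chi n R x * (psp (v x) (v (x+z)) * v1 x + psr (v x) (v (x+z)) * v1 (x+z)) - chi1 n R x * psi (v x) (v (x+z))))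
      (chi n R x * (psp (v x) (v (x+z)) * (-(|v x|^σ * v1 x) + μ * v2 x)
        + psr (v x) (v (x+z)) * (-(|v (x+z)|^σ * v1 (x+z)) + μ * v2 (x+z)))
       - (chi1 n R x * aa σ (v x) (v (x+z)) + chi n R x * (WWr σ (v x) (v (x+z)) * v1 (x+z))
         + μ * (chi2 n R x * psi (v x) (v (x+z)))
         - μ * (chi n R x * psh (v x) (v (x+z)) (v1 x) (v1 (x+z))))) x := by
    intro x _
    have y2 : HasDerivAt (fun x => v (x+z)) (v1 (x+z)) x := (hv (x+z)).comp_add_const x z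
    have y3 : HasDerivAt (fun x => v1 (x+z)) (v2 (x+z)) x := (hv1 (x+z)).comp_add_const x z
    have a1 := (hd_chi n R x).mul (aa_chain hσ (hv x) y2)
    have a2 := (hd_chi n R x).mul (psi1_chain (e2 := fun x => v1 (x+z)) (hv x) y2 (hv1 x) y3)
    have a3 := (hd_chi1 n R x).mul (psi_chain (hv x) y2)
    have := a1.neg.add ((a2.sub a3).const_mul μ)
    refine this.congr_deriv ?_
    ring
  have i1 : Continuous fun x => chi n R x * (psp (v x) (v (x+z)) * (-(|v x|^σ * v1 x) + μ * v2 x)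
        + psr (v x) (v (x+z)) * (-(|v (x+z)|^σ * v1 (x+z)) + μ * v2 (x+z))) := by fun_prop
  have i2 : Continuous fun x => chi1 n R x * aa σ (v x) (v (x+z)) := by fun_prop
  have i3 : Continuous fun x => chi n R x * (WWr σ (v x) (v (x+z)) * v1 (x+z)) := by fun_prop
  have i4 : Continuous fun x => μ * (chi2 n R x * psi (v x) (v (x+z))) := by fun_prop
  have i5 : Continuous fun x => μ * (chi n R x * psh (v x) (v (x+z)) (v1 x) (v1 (x+z))) := by fun_prop
  have i6 : Continuous fun x => chi1 n R x * aa σ (v x) (v (x+z)) + chi n R x * (WWr σ (v x) (v (x+z)) * v1 (x+z)) := i2.add i3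
  have i7 : Continuous fun x => chi1 n R x * aa σ (v x) (v (x+z)) + chi n R x * (WWr σ (v x) (v (x+z)) * v1 (x+z))
      + μ * (chi2 n R x * psi (v x) (v (x+z))) := i6.add i4
  have i8 : Continuous fun x => chi1 n R x * aa σ (v x) (v (x+z)) + chi n R x * (WWr σ (v x) (v (x+z)) * v1 (x+z))
      + μ * (chi2 n R x * psi (v x) (v (x+z))) - μ * (chi n R x * psh (v x) (v (x+z)) (v1 x) (v1 (x+z))) := i7.sub i5
  have := intervalIntegral.integral_eq_sub_of_hasDerivAt hd ((i1.sub i8).intervalIntegrable _ _)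
  rw [intervalIntegral.integral_sub (i1.intervalIntegrable _ _) (i8.intervalIntegrable _ _),
    intervalIntegral.integral_sub (i7.intervalIntegrable _ _) (i5.intervalIntegrable _ _),
    intervalIntegral.integral_add (i6.intervalIntegrable _ _) (i4.intervalIntegrable _ _),
    intervalIntegral.integral_add (i2.intervalIntegrable _ _) (i3.intervalIntegrable _ _),
    intervalIntegral.integral_const_mul, intervalIntegral.integral_const_mul,
    chi_R hR, chi_nR hR, chi1_R hR, chi1_nR hR] at this
  linarith

namespace SolN
variable {σ N : ℝ} {j : ℝ → ℝ} {μ : ℝ} {u g ut ux uxx : ℝ → ℝ → ℝ}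

set_option maxHeartbeats 2000000 in
lemma pair_A (h : SolN σ N j μ u g ut ux uxx) (n : ℕ) {R k z : ℝ} (hR : 0 < R) (hz : z ∈ Set.Icc (0:ℝ) 1)
    {τ : ℝ} (hτ : 0 < τ) (hk : ∀ x, |u τ x| ≤ k) :
    ∫ x in (-R)..R, chi n R x * (psp (u τ x) (u τ (x+z)) * ut τ x + psr (u τ x) (u τ (x+z)) * ut τ (x+z)) ≤
      (∫ x in (-R)..R, chi n R x * (WWr σ (u τ x) (u τ (x+z)) * ux τ (x+z)))
      + 20*k^3 * (2 * ∫ x, TT n R x * |g τ x|)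
      + 2*((n:ℝ)+2)/R * (17*(k^σ*k^3) * ∫ x, |u τ x|)
      + μ * (((n:ℝ)+2)*(4*(n+1)+2)/R^2 * (20*k^3 * (2 * ∫ x, |u τ x|))) := by
  have hRR : -R ≤ R := by linarith
  have hk0 : 0 ≤ k := (abs_nonneg _).trans (hk 0)
  have e := psi_ent hk0
  have hS : ∀ x, u τ x ∈ Set.Icc (-k) k := fun x => abs_le.1 (hk x)
  have hσ := h.hσ0
  have s := h.sol
  have cu := s.cu hτ
  have cux := s.cux hτ
  have k0 := c_chi n R
  have k1 := c_chi1 n R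
  have k2 := c_chi2 n R
  have cuxx := s.uxxc τ hτ
  have cz : Continuous fun x => (u τ x, u τ (x+z)) := by fun_prop
  have m1 : Continuous fun x => psp (u τ x) (u τ (x+z)) := c_psp.comp cz
  have m2 : Continuous fun x => psr (u τ x) (u τ (x+z)) := c_psr.comp cz
  have m3 : Continuous fun x => psi (u τ x) (u τ (x+z)) := c_psi.comp cz
  have m4 : Continuous fun x => aa σ (u τ x) (u τ (x+z)) := (c_aa hσ).comp cz
  have m6 : Continuous fun x => psh (u τ x) (u τ (x+z)) (ux τ x) (ux τ (x+z)) := by unfold psh; fun_prop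
  have m7 : Continuous fun x => |u τ x|^σ := (c_pw hσ).comp cu
  have m8 : Continuous fun x => |u τ (x+z)|^σ := (c_pw hσ).comp (by fun_prop : Continuous fun x => u τ (x+z))
  have cmain : Continuous fun x => chi n R x * (psp (u τ x) (u τ (x+z)) * (-(|u τ x|^σ * ux τ x) + μ * uxx τ x)
        + psr (u τ x) (u τ (x+z)) * (-(|u τ (x+z)|^σ * ux τ (x+z)) + μ * uxx τ (x+z))) := by
    fun_prop
  have gz : Integrable (fun x => g τ (x+z)) := (s.gi τ hτ).comp_add_right z
  have ik1 : Integrable (fun x => psp (u τ x) (u τ (x+z)) * g τ x) :=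
    (s.gi τ hτ).bdd_mul (c := 20*k^3) m1.aestronglyMeasurable
      (Eventually.of_forall fun x => e.bp _ (hS x) _ (hS _))
  have ik2 : Integrable (fun x => psr (u τ x) (u τ (x+z)) * g τ (x+z)) :=
    gz.bdd_mul (c := 20*k^3) m2.aestronglyMeasurable
      (Eventually.of_forall fun x => e.br _ (hS x) _ (hS _))
  have ik : Integrable (fun x => psp (u τ x) (u τ (x+z)) * g τ x + psr (u τ x) (u τ (x+z)) * g τ (x+z)) := ik1.add ik2
  have ig : IntervalIntegrable (fun x => chi n R x * (psp (u τ x) (u τ (x+z)) * g τ x + psr (u τ x) (u τ (x+z)) * g τ (x+z))) volume (-R) R :=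
    ik.intervalIntegrable.continuousOn_mul k0.continuousOn
  have e1 : ∫ x in (-R)..R, chi n R x * (psp (u τ x) (u τ (x+z)) * ut τ x + psr (u τ x) (u τ (x+z)) * ut τ (x+z))
      = (∫ x in (-R)..R, chi n R x * (psp (u τ x) (u τ (x+z)) * g τ x + psr (u τ x) (u τ (x+z)) * g τ (x+z)))
        + ∫ x in (-R)..R, chi n R x * (psp (u τ x) (u τ (x+z)) * (-(|u τ x|^σ * ux τ x) + μ * uxx τ x)
        + psr (u τ x) (u τ (x+z)) * (-(|u τ (x+z)|^σ * ux τ (x+z)) + μ * uxx τ (x+z))) := by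
    rw [← intervalIntegral.integral_add ig (cmain.intervalIntegrable _ _)]
    congr 1; funext x
    rw [s.pde τ hτ x, s.pde τ hτ (x+z)]; ring
  have e2 := pair_space (μ := μ) (z := z) n hR hσ (s.hux τ hτ) (s.huxx τ hτ) cuxx
  have e3 := loc2 (n := n) hR ik (s.gi τ hτ) e.C0 hz (fun x => by
    refine (abs_add_le _ _).trans ?_
    rw [abs_mul, abs_mul, mul_add]
    have := mul_le_mul_of_nonneg_right (e.bp _ (hS x) _ (hS (x+z))) (abs_nonneg (g τ x))
    have := mul_le_mul_of_nonneg_right (e.br _ (hS x) _ (hS (x+z))) (abs_nonneg (g τ (x+z)))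
    linarith)
  have e3' := (abs_le.1 e3).2
  have e3'' : ∫ x, (psp (u τ x) (u τ (x+z)) * g τ x + psr (u τ x) (u τ (x+z)) * g τ (x+z)) ≤ 0 := by
    rw [h.hg τ hτ]
    exact NL_le h.hj0 h.hj h.hj1 h.hN (s.ui τ hτ) cu e hS z
  have e4 : ∫ x in (-R)..R, chi2 n R x * psi (u τ x) (u τ (x+z)) ≤ ((n:ℝ)+2)*(4*(n+1)+2)/R^2 * (20*k^3 * (2* ∫ x, |u τ x|)) := by
    calc ∫ x in (-R)..R, chi2 n R x * psi (u τ x) (u τ (x+z)) ≤ ∫ x in (-R)..R, ((n:ℝ)+2)*(4*(n+1)+2)/R^2 * (20*k^3 * (|u τ x| + |u τ (x+z)|)) := by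
          apply intervalIntegral.integral_mono_on hRR (Continuous.intervalIntegrable (by fun_prop) _ _)
            (Continuous.intervalIntegrable (by fun_prop) _ _)
          intro x hx
          refine (le_abs_self _).trans ?_
          rw [abs_mul]
          have l := e.lip 0 e.mem0 0 e.mem0 _ (hS x) _ (hS (x+z))
          have z := e.zero
          rw [z] at l
          simp only [sub_zero] at l
          exact mul_le_mul (chi2_abs hR hx) l (abs_nonneg _) (by positivity)
      _ ≤ _ := by
          rw [intervalIntegral.integral_const_mul, intervalIntegral.integral_const_mul,
            intervalIntegral.integral_add (Continuous.intervalIntegrable (by fun_prop) _ _) (Continuous.intervalIntegrable (by fun_prop) _ _)]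
          have a1 := ii_le_full (s.ui τ hτ) hRR
          have a2 := ii_le_full ((s.ui τ hτ).comp_add_right z) hRR
          rw [integral_add_right_eq_self (fun x => |u τ x|) z] at a2
          have := e.C0
          gcongr
          linarith
  have e6 : ∫ x in (-R)..R, chi1 n R x * aa σ (u τ x) (u τ (x+z)) ≤ 2*((n:ℝ)+2)/R * (17*(k^σ*k^3) * ∫ x, |u τ x|) := by
    calc ∫ x in (-R)..R, chi1 n R x * aa σ (u τ x) (u τ (x+z)) ≤ ∫ x in (-R)..R, 2*((n:ℝ)+2)/R * (17*(k^σ*k^3) * |u τ x|) := by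
          apply intervalIntegral.integral_mono_on hRR (Continuous.intervalIntegrable (by fun_prop) _ _)
            (Continuous.intervalIntegrable (by fun_prop) _ _)
          intro x hx
          refine (le_abs_self _).trans ?_
          rw [abs_mul]
          exact mul_le_mul (chi1_abs' hR hx) (aa_bd hσ (hk x) (hk _)) (abs_nonneg _) (by positivity)
      _ ≤ _ := by
          rw [intervalIntegral.integral_const_mul, intervalIntegral.integral_const_mul]
          have a1 := ii_le_full (s.ui τ hτ) hRR
          gcongr
  have e7 : 0 ≤ ∫ x in (-R)..R, chi n R x * psh (u τ x) (u τ (x+z)) (ux τ x) (ux τ (x+z)) := by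
    apply intervalIntegral.integral_nonneg hRR
    intro x hx
    exact mul_nonneg (chi_mem hR hx).1 (psh_nonneg _ _ _ _)
  have e5 := mul_le_mul_of_nonneg_left e4 s.hμ.le
  have e8 := mul_nonneg s.hμ.le e7
  rw [e1, e2]
  linarith

end SolN

noncomputable def Iz (α β : ℝ) (χ : ℝ → ℝ) (ψ : ℝ → ℝ → ℝ) (u : ℝ → ℝ → ℝ) (t : ℝ) : ℝ :=
  ∫ z in (0:ℝ)..1, (1-z) * Fz α β χ ψ u t z

noncomputable def Az (α β : ℝ) (χ : ℝ → ℝ) (ψp ψr : ℝ → ℝ → ℝ) (u ut : ℝ → ℝ → ℝ) (s z : ℝ) : ℝ :=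
  ∫ x in α..β, χ x * (ψp (u s x) (u s (x+z)) * ut s x + ψr (u s x) (u s (x+z)) * ut s (x+z))

namespace Sol
variable {f : ℝ → ℝ} {μ : ℝ} {u g ut ux uxx : ℝ → ℝ → ℝ} {α β C : ℝ} {S : Set ℝ} {χ : ℝ → ℝ}
  {ψ ψp ψr : ℝ → ℝ → ℝ}

lemma Fz_quot_bd (h : Sol f μ u g ut ux uxx) (e : Ent S C ψ ψp ψr) (cχ : Continuous χ)
    (hχ1 : ∀ x ∈ Set.Icc α β, |χ x| ≤ 1) (hαβ : α ≤ β)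
    {s : ℝ} (hs : 0 < s) (hS : ∀ t, s ≤ t → ∀ x, u t x ∈ S) :
    ∃ B, 0 ≤ B ∧ ∀ᶠ k in nhdsWithin (0:ℝ) (Set.Ioi 0), ∀ z ∈ Set.Icc (0:ℝ) 1,
      |(Fz α β χ ψ u (s+k) z - Fz α β χ ψ u s z)/k| ≤ B := by
  have hab' : α ≤ β + 1 := by linarith
  have hn : 0 ≤ ∫ x in α..(β+1), |ut s x| := intervalIntegral.integral_nonneg hab' fun x _ => abs_nonneg _
  refine ⟨C * (2 * ((∫ x in α..(β+1), |ut s x|) + 1)), mul_nonneg e.C0 (by linarith), ?_⟩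
  have hk0 : ∀ᶠ k in nhdsWithin (0:ℝ) (Set.Ioi 0), 0 < k := self_mem_nhdsWithin
  have hab'' : α < β + 1 := by linarith
  have hdq := h.diffquot hab' hs
  filter_upwards [hk0, hdq.eventually (gt_mem_nhds (show (0:ℝ) < 1 by norm_num))] with k hk hq z hz
  have h1 := h.Fz_incr e cχ hχ1 hαβ hs (show 0 < s + k by linarith) (hS s le_rfl) (hS (s+k) (by linarith)) hz
  rw [abs_div, abs_of_pos hk, div_le_iff₀ hk]
  refine h1.trans ?_
  rw [mul_assoc, mul_assoc]
  apply mul_le_mul_of_nonneg_left _ e.C0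
  have cu := h.cu hs
  have cu' := h.cu (show 0 < s + k by linarith)
  have c1 : Continuous fun x => (u (s+k) x - u s x)/k := (cu'.sub cu).div_const _
  have i1 := (h.uti hs α (β+1)).abs
  have i2 := ((c1.intervalIntegrable α (β+1)).sub (h.uti hs α (β+1))).abs
  have h2 : ∫ x in α..(β+1), |u (s+k) x - u s x| ≤ ∫ x in α..(β+1), (|ut s x| + |(u (s+k) x - u s x)/k - ut s x|) * k := by
    apply intervalIntegral.integral_mono_on hab'
    · apply Continuous.intervalIntegrable; fun_prop
    · exact (i1.add i2).mul_const k
    · intro x hx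
      have := abs_add_le (ut s x) ((u (s+k) x - u s x)/k - ut s x)
      rw [add_sub_cancel, abs_div, abs_of_pos hk, div_le_iff₀ hk] at this
      exact this
  rw [intervalIntegral.integral_mul_const, intervalIntegral.integral_add i1 i2] at h2
  have h3 : ((∫ x in α..(β+1), |ut s x|) + ∫ x in α..(β+1), |(u (s+k) x - u s x)/k - ut s x|) * k
      ≤ ((∫ x in α..(β+1), |ut s x|) + 1) * k := by gcongr
  linarith

lemma Az_ii (h : Sol f μ u g ut ux uxx) (e : Ent S C ψ ψp ψr) (cχ : Continuous χ)
    (hχ1 : ∀ x ∈ Set.Icc α β, |χ x| ≤ 1) (hαβ : α ≤ β)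
    {s : ℝ} (hs : 0 < s) (hS : ∀ t, s ≤ t → ∀ x, u t x ∈ S) :
    IntervalIntegrable (fun z => (1-z) * Az α β χ ψp ψr u ut s z) volume 0 1 := by
  obtain ⟨B, hB0, hB⟩ := h.Fz_quot_bd e cχ hχ1 hαβ hs hS
  have hlim : ∀ z, Tendsto (fun k => (Fz α β χ ψ u (s+k) z - Fz α β χ ψ u s z)/k) (nhdsWithin (0:ℝ) (Set.Ioi 0))
      (nhds (Az α β χ ψp ψr u ut s z)) := fun z => h.Fz_rderiv e cχ hχ1 hαβ hs hS
  have hseq : Tendsto (fun m : ℕ => 1/((m:ℝ)+1)) atTop (nhdsWithin (0:ℝ) (Set.Ioi 0)) :=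
    tendsto_nhdsWithin_iff.2 ⟨tendsto_one_div_add_atTop_nhds_zero_nat, Eventually.of_forall fun m => by
      rw [Set.mem_Ioi]; positivity⟩
  have hm : AEStronglyMeasurable (fun z => Az α β χ ψp ψr u ut s z) (volume.restrict (Set.Ioc (0:ℝ) 1)) := by
    apply aestronglyMeasurable_of_tendsto_ae (u := (atTop : Filter ℕ))
      (f := fun (m:ℕ) z => (Fz α β χ ψ u (s+1/((m:ℝ)+1)) z - Fz α β χ ψ u s z)/(1/((m:ℝ)+1)))
    · intro m
      exact (((h.Fz_cont e cχ (by positivity)).sub (h.Fz_cont e cχ hs)).div_const _).aestronglyMeasurable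
    · exact Eventually.of_forall fun z => (hlim z).comp hseq
  have hb : ∀ z ∈ Set.Icc (0:ℝ) 1, |Az α β χ ψp ψr u ut s z| ≤ B := fun z hz =>
    le_of_tendsto (hlim z).abs (hB.mono fun k hk => hk z hz)
  rw [intervalIntegrable_iff_integrableOn_Ioc_of_le zero_le_one]
  refine Integrable.mono' (integrable_const B) ((by fun_prop : Continuous fun z : ℝ => 1 - z).aestronglyMeasurable.mul hm) ?_
  filter_upwards [ae_restrict_mem measurableSet_Ioc] with z hz
  rw [norm_mul, Real.norm_eq_abs, Real.norm_eq_abs, abs_of_nonneg (by linarith [hz.2])]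
  exact (mul_le_of_le_one_left (abs_nonneg _) (by linarith [hz.1])).trans (hb z ⟨hz.1.le, hz.2⟩)

lemma Iz_rderiv (h : Sol f μ u g ut ux uxx) (e : Ent S C ψ ψp ψr) (cχ : Continuous χ)
    (hχ1 : ∀ x ∈ Set.Icc α β, |χ x| ≤ 1) (hαβ : α ≤ β)
    {s : ℝ} (hs : 0 < s) (hS : ∀ t, s ≤ t → ∀ x, u t x ∈ S) :
    Tendsto (fun k => (Iz α β χ ψ u (s+k) - Iz α β χ ψ u s)/k) (nhdsWithin (0:ℝ) (Set.Ioi 0))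
      (nhds (∫ z in (0:ℝ)..1, (1-z) * Az α β χ ψp ψr u ut s z)) := by
  obtain ⟨B, hB0, hB⟩ := h.Fz_quot_bd e cχ hχ1 hαβ hs hS
  have hk0 : ∀ᶠ k in nhdsWithin (0:ℝ) (Set.Ioi 0), 0 < k := self_mem_nhdsWithin
  have hlim : ∀ z, Tendsto (fun k => (Fz α β χ ψ u (s+k) z - Fz α β χ ψ u s z)/k) (nhdsWithin (0:ℝ) (Set.Ioi 0))
      (nhds (Az α β χ ψp ψr u ut s z)) := fun z => h.Fz_rderiv e cχ hχ1 hαβ hs hS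
  have := intervalIntegral.tendsto_integral_filter_of_dominated_convergence (μ := volume) (a := 0) (b := 1)
    (l := nhdsWithin (0:ℝ) (Set.Ioi 0))
    (F := fun k z => (1-z) * ((Fz α β χ ψ u (s+k) z - Fz α β χ ψ u s z)/k))
    (f := fun z => (1-z) * Az α β χ ψp ψr u ut s z) (fun _ => B) ?_ ?_ ?_ ?_
  · refine this.congr' ?_
    filter_upwards [hk0] with k hk
    have c1 := h.Fz_cont (α := α) (β := β) e cχ (show 0 < s + k by linarith)
    have c2 := h.Fz_cont (α := α) (β := β) e cχ hs
    unfold Iz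
    rw [← intervalIntegral.integral_sub (Continuous.intervalIntegrable (by fun_prop) _ _)
      (Continuous.intervalIntegrable (by fun_prop) _ _), ← intervalIntegral.integral_div]
    congr 1; funext z; ring
  · filter_upwards [hk0] with k hk
    have c1 := h.Fz_cont (α := α) (β := β) e cχ (show 0 < s + k by linarith)
    have c2 := h.Fz_cont (α := α) (β := β) e cχ hs
    exact Continuous.aestronglyMeasurable (by fun_prop)
  · filter_upwards [hB] with k hk
    refine Eventually.of_forall fun z hz => ?_
    rw [Set.uIoc_of_le zero_le_one] at hz
    rw [norm_mul, Real.norm_eq_abs, Real.norm_eq_abs, abs_of_nonneg (by linarith [hz.2])]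
    exact (mul_le_of_le_one_left (abs_nonneg _) (by linarith [hz.1])).trans (hk z ⟨hz.1.le, hz.2⟩)
  · exact intervalIntegrable_const
  · exact Eventually.of_forall fun z _ => (hlim z).const_mul _

lemma Iz_tcont (h : Sol f μ u g ut ux uxx) (e : Ent S C ψ ψp ψr) (cχ : Continuous χ)
    (hχ1 : ∀ x ∈ Set.Icc α β, |χ x| ≤ 1) (hαβ : α ≤ β)
    {s t : ℝ} (hs : 0 < s) (hS : ∀ t, s ≤ t → ∀ x, u t x ∈ S) :
    ContinuousOn (fun t => Iz α β χ ψ u t) (Set.Icc s t) := by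
  intro t0 ht0
  have ht00 : 0 < t0 := hs.trans_le ht0.1
  rw [ContinuousWithinAt, tendsto_iff_norm_sub_tendsto_zero]
  have h1 := ((h.uc t0 ht00).const_mul (C*2)).mono_left (nhdsWithin_le_nhds (s := Set.Icc s t))
  rw [mul_zero] at h1
  refine squeeze_zero' (Eventually.of_forall fun _ => norm_nonneg _) ?_ h1
  filter_upwards [self_mem_nhdsWithin] with t' ht'
  have ht'0 : 0 < t' := hs.trans_le ht'.1
  have c1 := h.Fz_cont (α := α) (β := β) e cχ ht'0
  have c2 := h.Fz_cont (α := α) (β := β) e cχ ht00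
  unfold Iz
  rw [← intervalIntegral.integral_sub (Continuous.intervalIntegrable (by fun_prop) _ _)
      (Continuous.intervalIntegrable (by fun_prop) _ _)]
  have := intervalIntegral.norm_integral_le_of_norm_le_const (a := 0) (b := 1)
    (f := fun z => (1-z) * Fz α β χ ψ u t' z - (1-z) * Fz α β χ ψ u t0 z) (C := C*2*∫ x, |u t' x - u t0 x|) ?_
  · simpa using this
  · intro z hz
    rw [Set.uIoc_of_le zero_le_one] at hz
    rw [← mul_sub, norm_mul, Real.norm_eq_abs, Real.norm_eq_abs, abs_of_nonneg (by linarith [hz.2])]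
    refine (mul_le_of_le_one_left (abs_nonneg _) (by linarith [hz.1])).trans ?_
    refine (h.Fz_incr e cχ hχ1 hαβ ht00 ht'0 (hS t0 ht0.1) (hS t' ht'.1) ⟨hz.1.le, hz.2⟩).trans ?_
    rw [mul_assoc]
    have := ii_le_full ((h.ui t' ht'0).sub (h.ui t0 ht00)) (show α ≤ β + 1 by linarith)
    simp only [Pi.sub_apply] at this
    have := e.C0
    gcongr

end Sol

lemma swap_cont {F : ℝ → ℝ → ℝ} (hF : Continuous fun q : ℝ × ℝ => F q.1 q.2) (a b c d : ℝ) :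
    ∫ x in a..b, ∫ y in c..d, F x y = ∫ y in c..d, ∫ x in a..b, F x y := by
  apply intervalIntegral_intervalIntegral_swap
  have : IntegrableOn F.uncurry (Set.uIcc a b ×ˢ Set.uIcc c d) :=
    (hF.continuousOn).integrableOn_compact (isCompact_uIcc.prod isCompact_uIcc)
  exact this.mono_set (Set.prod_mono Set.uIoc_subset_uIcc Set.uIoc_subset_uIcc)

lemma cont_param {F : ℝ → ℝ → ℝ} (hF : Continuous fun q : ℝ × ℝ => F q.1 q.2) (a b : ℝ) :
    Continuous fun x => ∫ z in a..b, F x z :=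
  intervalIntegral.continuous_parametric_intervalIntegral_of_continuous' hF a b

lemma shift_le {w : ℝ → ℝ} (hw : Integrable w) (h0 : ∀ x, 0 ≤ w x) (x : ℝ) :
    ∫ z in (0:ℝ)..1, w (x+z) ≤ ∫ y, w y := by
  have h1 := ii_le_full (hw.comp_add_left x) (zero_le_one (α := ℝ))
  rw [integral_add_left_eq_self (fun y => |w y|) x] at h1
  simpa only [abs_of_nonneg (h0 _)] using h1

section
variable {σ R k : ℝ} {v v1 : ℝ → ℝ} {n : ℕ}

lemma pw_int (hσ : 0 < σ) (cv : Continuous v) (hi : Integrable v) (hk : ∀ x, |v x| ≤ k) :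
    Integrable (fun x => |v x|^σ * |v x|^3) := by
  have c7 : Continuous fun x => |v x|^σ := (c_pw hσ).comp cv
  refine Integrable.mono' (hi.abs.const_mul (k^σ*k^2)) (by fun_prop : Continuous fun x => |v x|^σ * |v x|^3).aestronglyMeasurable
    (Eventually.of_forall fun x => ?_)
  rw [Real.norm_eq_abs, abs_of_nonneg (by positivity)]
  calc |v x|^σ * |v x|^3 = |v x|^σ * |v x|^2 * |v x| := by ring
    _ ≤ _ := mul_le_mul_of_nonneg_right (pow_bd hσ (hk x) 2) (abs_nonneg _)

lemma pw4_bd (hσ : 0 < σ) {p : ℝ} (hk : |p| ≤ k) : |(|p|^σ) * p^4| ≤ k^σ*k^3 * |p| := by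
  rw [abs_mul, abs_of_nonneg (by positivity : 0 ≤ |p|^σ), abs_pow]
  calc |p|^σ * |p|^4 = |p|^σ * |p|^3 * |p| := by ring
    _ ≤ _ := mul_le_mul_of_nonneg_right (pow_bd hσ hk 3) (abs_nonneg _)

lemma pw4_int (hσ : 0 < σ) (cv : Continuous v) (hi : Integrable v) (hk : ∀ x, |v x| ≤ k) :
    Integrable (fun x => |v x|^σ * (v x)^4) := by
  have c7 : Continuous fun x => |v x|^σ := (c_pw hσ).comp cv
  exact Integrable.mono' (hi.abs.const_mul (k^σ*k^3)) (by fun_prop : Continuous fun x => |v x|^σ * (v x)^4).aestronglyMeasurable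
    (Eventually.of_forall fun x => pw4_bd hσ (hk x))

set_option maxHeartbeats 1000000 in
lemma D_swap (hσ : 0 < σ) (hv : ∀ x, HasDerivAt v (v1 x) x) (cv1 : Continuous v1) :
    ∫ z in (0:ℝ)..1, (1-z) * (∫ x in (-R)..R, chi n R x * (WWr σ (v x) (v (x+z)) * v1 (x+z)))
    = - (∫ x in (-R)..R, chi n R x * WW σ (v x) (v x))
      + 8 * (∫ z in (0:ℝ)..1, ∫ x in (-R)..R, chi n R x * (P3 σ (v x) - P3 σ (v (x+z))))
      + ∫ x in (-R)..R, chi n R x * ∫ z in (0:ℝ)..1, Mx σ (v x) (v (x+z)) := by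
  have cv := dcont hv
  have k0 := c_chi n R
  have cq : Continuous fun q : ℝ × ℝ => (v q.1, v (q.1+q.2)) := by fun_prop
  have cq' : Continuous fun q : ℝ × ℝ => (v q.2, v (q.2+q.1)) := by fun_prop
  have m1 : Continuous fun q : ℝ × ℝ => WWr σ (v q.2) (v (q.2+q.1)) := (c_WWr hσ).comp cq'
  have m2 : Continuous fun q : ℝ × ℝ => Mx σ (v q.1) (v (q.1+q.2)) := (c_Mx hσ).comp cq
  have c3 := c_P3 hσ
  have m3 : Continuous fun q : ℝ × ℝ => chi n R q.2 * (P3 σ (v q.2) - P3 σ (v (q.2+q.1))) := by fun_prop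
  have step1 : ∫ z in (0:ℝ)..1, (1-z) * (∫ x in (-R)..R, chi n R x * (WWr σ (v x) (v (x+z)) * v1 (x+z)))
      = ∫ x in (-R)..R, ∫ z in (0:ℝ)..1, (1-z) * (chi n R x * (WWr σ (v x) (v (x+z)) * v1 (x+z))) := by
    rw [← swap_cont (F := fun z x => (1-z) * (chi n R x * (WWr σ (v x) (v (x+z)) * v1 (x+z)))) (by fun_prop)]
    congr 1; funext z
    rw [intervalIntegral.integral_const_mul]
  have step2 : ∀ x, ∫ z in (0:ℝ)..1, (1-z) * (chi n R x * (WWr σ (v x) (v (x+z)) * v1 (x+z)))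
      = - (chi n R x * WW σ (v x) (v x)) + 8 * (∫ z in (0:ℝ)..1, chi n R x * (P3 σ (v x) - P3 σ (v (x+z))))
        + chi n R x * ∫ z in (0:ℝ)..1, Mx σ (v x) (v (x+z)) := by
    intro x
    have cz : Continuous fun z => (v x, v (x+z)) := by fun_prop
    have n1 : Continuous fun z => WWr σ (v x) (v (x+z)) := (c_WWr hσ).comp cz
    have n2 : Continuous fun z => WW σ (v x) (v (x+z)) := (c_WW hσ).comp cz
    have n3 : Continuous fun z => Mx σ (v x) (v (x+z)) := (c_Mx hσ).comp cz
    have hd : ∀ z ∈ Set.uIcc (0:ℝ) 1, HasDerivAt (fun z => (1-z) * WW σ (v x) (v (x+z)))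
        ((1-z) * (WWr σ (v x) (v (x+z)) * v1 (x+z)) - WW σ (v x) (v (x+z))) z := by
      intro z _
      have y2 : HasDerivAt (fun z => v (x+z)) (v1 (x+z)) z := (hv (x+z)).comp_const_add x z
      have := ((hasDerivAt_id z).const_sub 1).mul (WW_chain hσ (v x) y2)
      refine this.congr_deriv ?_
      simp only [id]; ring
    have i1 : IntervalIntegrable (fun z => (1-z) * (WWr σ (v x) (v (x+z)) * v1 (x+z))) volume 0 1 :=
      Continuous.intervalIntegrable (by fun_prop) _ _
    have := intervalIntegral.integral_eq_sub_of_hasDerivAt hd (i1.sub (n2.intervalIntegrable _ _))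
    rw [intervalIntegral.integral_sub i1 (n2.intervalIntegrable _ _)] at this
    have e2 : ∫ z in (0:ℝ)..1, WW σ (v x) (v (x+z)) = 8 * (∫ z in (0:ℝ)..1, (P3 σ (v x) - P3 σ (v (x+z))))
        + ∫ z in (0:ℝ)..1, Mx σ (v x) (v (x+z)) := by
      unfold WW
      rw [intervalIntegral.integral_add (Continuous.intervalIntegrable (by fun_prop) _ _) (n3.intervalIntegrable _ _),
        intervalIntegral.integral_const_mul]
    have e1 : ∫ z in (0:ℝ)..1, (1-z) * (chi n R x * (WWr σ (v x) (v (x+z)) * v1 (x+z)))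
       = chi n R x * ∫ z in (0:ℝ)..1, (1-z) * (WWr σ (v x) (v (x+z)) * v1 (x+z)) := by
      rw [← intervalIntegral.integral_const_mul]
      congr 1; funext z; ring
    rw [e1, intervalIntegral.integral_const_mul]
    rw [e2, add_zero] at this
    have e3 : ∫ z in (0:ℝ)..1, (1-z) * (WWr σ (v x) (v (x+z)) * v1 (x+z)) =
      - WW σ (v x) (v x) + (8 * (∫ z in (0:ℝ)..1, (P3 σ (v x) - P3 σ (v (x+z))))
        + ∫ z in (0:ℝ)..1, Mx σ (v x) (v (x+z))) := by
      simp only [sub_self, zero_mul, sub_zero, one_mul, zero_sub] at this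
      linarith
    rw [e3]; ring
  rw [step1]
  simp only [step2]
  have p1 : Continuous fun x => chi n R x * WW σ (v x) (v x) := k0.mul ((c_WW hσ).comp (cv.prodMk cv))
  have p2 : Continuous fun x => ∫ z in (0:ℝ)..1, chi n R x * (P3 σ (v x) - P3 σ (v (x+z))) := cont_param (by fun_prop) 0 1
  have p3 : Continuous fun x => ∫ z in (0:ℝ)..1, Mx σ (v x) (v (x+z)) := cont_param m2 0 1
  rw [intervalIntegral.integral_add (Continuous.intervalIntegrable (by fun_prop) _ _) (Continuous.intervalIntegrable (by fun_prop) _ _),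
    intervalIntegral.integral_add (Continuous.intervalIntegrable (by fun_prop) _ _) (Continuous.intervalIntegrable (by fun_prop) _ _),
    intervalIntegral.integral_neg, intervalIntegral.integral_const_mul,
    swap_cont (F := fun x z => chi n R x * (P3 σ (v x) - P3 σ (v (x+z)))) (by fun_prop)]

set_option maxHeartbeats 1000000 in
lemma D_avg (hσ : 0 < σ) (hR : 0 < R) (hv : ∀ x, HasDerivAt v (v1 x) x) (cv1 : Continuous v1)
    (hi : Integrable v) (hk : ∀ x, |v x| ≤ k) :
    ∫ z in (0:ℝ)..1, (1-z) * (∫ x in (-R)..R, chi n R x * (WWr σ (v x) (v (x+z)) * v1 (x+z)))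
    ≤ - (2*σ/((σ+1)*(σ+3))) * (∫ x, |v x|^σ * (v x)^4) + 40 * ((∫ x, |v x|) * ∫ x, |v x|^σ * |v x|^3)
      + (2*σ/((σ+1)*(σ+3)) + 8) * (k^σ*k^3 * (2 * ∫ x, TT n R x * |v x|)) := by
  have hRR : -R ≤ R := by linarith
  have hk0 : 0 ≤ k := (abs_nonneg _).trans (hk 0)
  have cv := dcont hv
  have k0 := c_chi n R
  rw [D_swap hσ hv cv1]
  have hC : 0 ≤ k^σ*k^3 := by positivity
  set c := 2*σ/((σ+1)*(σ+3)) with hc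
  have hc0 : 0 ≤ c := by positivity
  -- diagonal part
  have d1 : ∫ x in (-R)..R, chi n R x * WW σ (v x) (v x) = c * ∫ x in (-R)..R, chi n R x * (|v x|^σ * (v x)^4) := by
    rw [← intervalIntegral.integral_const_mul]
    congr 1; funext x
    rw [WW_diag hσ]; ring
  have d2 := (abs_le.1 (loc2 (n := n) hR (pw4_int hσ cv hi hk) hi hC (z := 0) (by simp) (fun x => by
    refine (pw4_bd hσ (hk x)).trans ?_
    have : 0 ≤ k^σ*k^3 * |v (x+0)| := by positivity
    linarith))).1
  have d3 := mul_le_mul_of_nonneg_left d2 hc0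
  -- P3 part
  have iP : Integrable (fun x => P3 σ (v x)) :=
    Integrable.mono' (hi.abs.const_mul (k^σ*k^3)) ((c_P3 hσ).comp cv).aestronglyMeasurable
      (Eventually.of_forall fun x => P3_bd hσ (hk x))
  have c3 := c_P3 hσ
  have p1 : ∀ z ∈ Set.Icc (0:ℝ) 1, ∫ x in (-R)..R, chi n R x * (P3 σ (v x) - P3 σ (v (x+z)))
      ≤ k^σ*k^3 * (2 * ∫ x, TT n R x * |v x|) := by
    intro z hz
    have iPz : Integrable (fun x => P3 σ (v (x+z))) := iP.comp_add_right z
    have := (abs_le.1 (loc2 (n := n) (k := fun x => P3 σ (v x) - P3 σ (v (x+z))) hR (iP.sub iPz) hi hC hz (fun x => by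
      refine (abs_sub _ _).trans ?_
      rw [mul_add]
      exact add_le_add (P3_bd hσ (hk x)) (P3_bd hσ (hk _))))).2
    rw [integral_sub iP iPz, integral_add_right_eq_self (fun x => P3 σ (v x)) z] at this
    linarith
  have p2 : ∫ z in (0:ℝ)..1, ∫ x in (-R)..R, chi n R x * (P3 σ (v x) - P3 σ (v (x+z)))
      ≤ k^σ*k^3 * (2 * ∫ x, TT n R x * |v x|) := by
    have cc : Continuous fun z => ∫ x in (-R)..R, chi n R x * (P3 σ (v x) - P3 σ (v (x+z))) :=
      cont_param (F := fun z x => chi n R x * (P3 σ (v x) - P3 σ (v (x+z)))) (by fun_prop) _ _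
    have := intervalIntegral.integral_mono_on zero_le_one (cc.intervalIntegrable 0 1)
      (intervalIntegrable_const (μ := volume) (c := k^σ*k^3 * (2 * ∫ x, TT n R x * |v x|))) p1
    simpa using this
  -- Mx part
  have cq : Continuous fun q : ℝ × ℝ => (v q.1, v (q.1+q.2)) := by fun_prop
  have m2 : Continuous fun q : ℝ × ℝ => Mx σ (v q.1) (v (q.1+q.2)) := (c_Mx hσ).comp cq
  have m3 : Continuous fun x => ∫ z in (0:ℝ)..1, Mx σ (v x) (v (x+z)) := cont_param m2 0 1
  have c7 : Continuous fun x => |v x|^σ := (c_pw hσ).comp cv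
  have iY := pw_int hσ cv hi hk
  set Y := ∫ x, |v x|^σ * |v x|^3 with hY
  have x1 : ∀ x, |∫ z in (0:ℝ)..1, Mx σ (v x) (v (x+z))| ≤ 20 * (|v x| * Y + (∫ x, |v x|) * (|v x|^σ * |v x|^3)) := by
    intro x
    have cz : Continuous fun z => (v x, v (x+z)) := by fun_prop
    have n3 : Continuous fun z => Mx σ (v x) (v (x+z)) := (c_Mx hσ).comp cz
    have c8 : Continuous fun z => |v (x+z)|^σ := c7.comp (by fun_prop : Continuous fun z => x + z)
    calc |∫ z in (0:ℝ)..1, Mx σ (v x) (v (x+z))| ≤ ∫ z in (0:ℝ)..1, |Mx σ (v x) (v (x+z))| :=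
          intervalIntegral.abs_integral_le_integral_abs zero_le_one
      _ ≤ ∫ z in (0:ℝ)..1, 20 * (|v x| * (|v (x+z)|^σ * |v (x+z)|^3) + |v (x+z)| * (|v x|^σ * |v x|^3)) := by
          apply intervalIntegral.integral_mono_on zero_le_one (n3.abs.intervalIntegrable _ _)
            (Continuous.intervalIntegrable (by fun_prop) _ _)
          intro z _
          exact Mx_bd hσ _ _
      _ = 20 * (|v x| * (∫ z in (0:ℝ)..1, |v (x+z)|^σ * |v (x+z)|^3) + (∫ z in (0:ℝ)..1, |v (x+z)|) * (|v x|^σ * |v x|^3)) := by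
          rw [intervalIntegral.integral_const_mul,
            intervalIntegral.integral_add (Continuous.intervalIntegrable (by fun_prop) _ _) (Continuous.intervalIntegrable (by fun_prop) _ _),
            intervalIntegral.integral_const_mul, intervalIntegral.integral_mul_const]
      _ ≤ _ := by
          have a1 := shift_le iY (fun x => by positivity) x
          have a2 := shift_le hi.abs (fun x => by positivity) x
          gcongr
  have x2 : ∫ x in (-R)..R, chi n R x * ∫ z in (0:ℝ)..1, Mx σ (v x) (v (x+z)) ≤ 40 * ((∫ x, |v x|) * Y) := by
    calc _ ≤ ∫ x in (-R)..R, 20 * (|v x| * Y + (∫ x, |v x|) * (|v x|^σ * |v x|^3)) := by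
          apply intervalIntegral.integral_mono_on hRR (Continuous.intervalIntegrable (by fun_prop) _ _)
            (Continuous.intervalIntegrable (by fun_prop) _ _)
          intro x hx
          refine (le_abs_self _).trans ?_
          rw [abs_mul]
          exact (mul_le_of_le_one_left (abs_nonneg _) (chi_abs hR hx)).trans (x1 x)
      _ = 20 * ((∫ x in (-R)..R, |v x|) * Y + (∫ x, |v x|) * ∫ x in (-R)..R, |v x|^σ * |v x|^3) := by
          rw [intervalIntegral.integral_const_mul,
            intervalIntegral.integral_add (Continuous.intervalIntegrable (by fun_prop) _ _) (Continuous.intervalIntegrable (by fun_prop) _ _),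
            intervalIntegral.integral_const_mul, intervalIntegral.integral_mul_const]
      _ ≤ 20 * ((∫ x, |v x|) * Y + (∫ x, |v x|) * Y) := by
          have a1 := ii_le_full hi hRR
          have a2 := ii_le_full iY hRR
          have a3 : ∀ x, 0 ≤ |v x|^σ * |v x|^3 := fun x => by positivity
          simp only [abs_of_nonneg (a3 _)] at a2
          have a4 : 0 ≤ Y := integral_nonneg a3
          have a5 : 0 ≤ ∫ x, |v x| := integral_nonneg fun x => abs_nonneg _
          gcongr
      _ = _ := by ring
  rw [d1]
  linarith

end

noncomputable def cs (σ : ℝ) : ℝ := 2*σ/((σ+1)*(σ+3))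
noncomputable def dl (σ K : ℝ) : ℝ := cs σ / (80 * (K+1))
noncomputable def CK (σ K : ℝ) : ℝ := 40 * (K * ((1/dl σ K)^σ * (1/dl σ K)^2 * K))

lemma cs_pos {σ : ℝ} (hσ : 0 < σ) : 0 < cs σ := by unfold cs; positivity
lemma dl_pos {σ K : ℝ} (hσ : 0 < σ) (hK : 0 ≤ K) : 0 < dl σ K := by
  have := cs_pos hσ
  unfold dl; positivity

noncomputable def Er (σ K k μ : ℝ) (n : ℕ) (R : ℝ) (u g : ℝ → ℝ → ℝ) (τ : ℝ) : ℝ :=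
  20*k^3 * (2 * ∫ x, TT n R x * |g τ x|) + (cs σ + 8) * (k^σ*k^3 * (2 * ∫ x, TT n R x * |u τ x|))
  + (2*((n:ℝ)+2)/R * (17*(k^σ*k^3) * K) + μ * (((n:ℝ)+2)*(4*(n+1)+2)/R^2 * (20*k^3 * (2 * K))))

namespace SolN
variable {σ N : ℝ} {j : ℝ → ℝ} {μ : ℝ} {u g ut ux uxx : ℝ → ℝ → ℝ}

set_option maxHeartbeats 1000000 in
lemma A_bd (h : SolN σ N j μ u g ut ux uxx) (n : ℕ) {R k K : ℝ} (hR : 0 < R)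
    {τ : ℝ} (hτ : 0 < τ) (hk : ∀ t, τ ≤ t → ∀ x, |u t x| ≤ k) (hK : ∫ x, |u τ x| ≤ K) :
    ∫ z in (0:ℝ)..1, (1-z) * Az (-R) R (chi n R) psp psr u ut τ z ≤
      -(cs σ/2) * (∫ x, |u τ x|^σ * (u τ x)^4) + CK σ K + Er σ K k μ n R u g τ := by
  have hRR : -R ≤ R := by linarith
  have hσ := h.hσ0
  have s := h.sol
  have cu := s.cu hτ
  have cux := s.cux hτ
  have ui := s.ui τ hτ
  have hkτ := hk τ le_rfl
  have hk0 : 0 ≤ k := (abs_nonneg _).trans (hkτ 0)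
  have hμ := s.hμ
  have hcs := cs_pos hσ
  have hK0 : 0 ≤ ∫ x, |u τ x| := integral_nonneg fun x => abs_nonneg _
  have hKK : 0 ≤ K := hK0.trans hK
  have hg0 : 0 ≤ ∫ x, TT n R x * |g τ x| := integral_nonneg fun x => mul_nonneg (TT_nonneg x) (abs_nonneg _)
  have hu0 : 0 ≤ ∫ x, TT n R x * |u τ x| := integral_nonneg fun x => mul_nonneg (TT_nonneg x) (abs_nonneg _)
  have hS : ∀ t, τ ≤ t → ∀ x, u t x ∈ Set.Icc (-k) k := fun t ht x => abs_le.1 (hk t ht x)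
  have hA := s.Az_ii (psi_ent hk0) (c_chi n R) (fun x hx => chi_abs hR hx) hRR hτ hS
  set e0 := 20*k^3 * (2 * ∫ x, TT n R x * |g τ x|)
      + (2*((n:ℝ)+2)/R * (17*(k^σ*k^3) * K) + μ * (((n:ℝ)+2)*(4*(n+1)+2)/R^2 * (20*k^3 * (2 * K)))) with he0
  have he00 : 0 ≤ e0 := by positivity
  have cD : Continuous fun z => ∫ x in (-R)..R, chi n R x * (WWr σ (u τ x) (u τ (x+z)) * ux τ (x+z)) := by
    apply cont_param (F := fun z x => chi n R x * (WWr σ (u τ x) (u τ (x+z)) * ux τ (x+z)))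
    have cq' : Continuous fun q : ℝ × ℝ => (u τ q.2, u τ (q.2+q.1)) := by fun_prop
    have m1 : Continuous fun q : ℝ × ℝ => WWr σ (u τ q.2) (u τ (q.2+q.1)) := (c_WWr hσ).comp cq'
    have := c_chi n R
    fun_prop
  have iD : IntervalIntegrable (fun z => (1-z) * ∫ x in (-R)..R, chi n R x * (WWr σ (u τ x) (u τ (x+z)) * ux τ (x+z))) volume 0 1 :=
    Continuous.intervalIntegrable (by fun_prop) _ _
  have h1 : ∫ z in (0:ℝ)..1, (1-z) * Az (-R) R (chi n R) psp psr u ut τ z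
      ≤ ∫ z in (0:ℝ)..1, ((1-z) * (∫ x in (-R)..R, chi n R x * (WWr σ (u τ x) (u τ (x+z)) * ux τ (x+z))) + e0) := by
    apply intervalIntegral.integral_mono_on zero_le_one hA (iD.add intervalIntegrable_const)
    intro z hz
    have p := h.pair_A n hR hz hτ hkτ
    have q : Az (-R) R (chi n R) psp psr u ut τ z ≤
       (∫ x in (-R)..R, chi n R x * (WWr σ (u τ x) (u τ (x+z)) * ux τ (x+z))) + e0 := by
      refine p.trans ?_
      have r1 : 2*((n:ℝ)+2)/R * (17*(k^σ*k^3) * ∫ x, |u τ x|) ≤ 2*((n:ℝ)+2)/R * (17*(k^σ*k^3) * K) := by gcongr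
      have r2 : μ * (((n:ℝ)+2)*(4*(n+1)+2)/R^2 * (20*k^3 * (2 * ∫ x, |u τ x|))) ≤
        μ * (((n:ℝ)+2)*(4*(n+1)+2)/R^2 * (20*k^3 * (2 * K))) := by gcongr
      rw [he0]
      linarith
    have := mul_le_mul_of_nonneg_left q (show 0 ≤ 1 - z by linarith [hz.2])
    have := mul_nonneg hz.1 he00
    linarith
  rw [intervalIntegral.integral_add iD intervalIntegrable_const] at h1
  simp only [intervalIntegral.integral_const, sub_zero, one_smul] at h1
  have h2 := D_avg (n := n) hσ hR (s.hux τ hτ) cux ui hkτ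
  have iX := pw4_int hσ cu ui hkτ
  have iY := pw_int hσ cu ui hkτ
  have hδ := dl_pos hσ hKK
  have h3 : ∫ x, |u τ x|^σ * |u τ x|^3 ≤ dl σ K * (∫ x, |u τ x|^σ * (u τ x)^4)
      + (1/dl σ K)^σ * (1/dl σ K)^2 * K := by
    have := integral_mono iY ((iX.const_mul (dl σ K)).add (ui.abs.const_mul ((1/dl σ K)^σ * (1/dl σ K)^2)))
      (fun x => young1 hσ hδ)
    simp only [Pi.add_apply] at this
    rw [integral_add (iX.const_mul (dl σ K)) (ui.abs.const_mul ((1/dl σ K)^σ * (1/dl σ K)^2)),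
      integral_const_mul, integral_const_mul] at this
    refine this.trans ?_
    gcongr
  have hX0 : 0 ≤ ∫ x, |u τ x|^σ * (u τ x)^4 := integral_nonneg fun x => by positivity
  have hY0 : 0 ≤ ∫ x, |u τ x|^σ * |u τ x|^3 := integral_nonneg fun x => by positivity
  have h4 : 40 * ((∫ x, |u τ x|) * ∫ x, |u τ x|^σ * |u τ x|^3) ≤ cs σ/2 * (∫ x, |u τ x|^σ * (u τ x)^4) + CK σ K := by
    calc _ ≤ 40 * (K * (dl σ K * (∫ x, |u τ x|^σ * (u τ x)^4) + (1/dl σ K)^σ * (1/dl σ K)^2 * K)) := by gcongr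
      _ = (40 * K * dl σ K) * (∫ x, |u τ x|^σ * (u τ x)^4) + CK σ K := by unfold CK; ring
      _ ≤ _ := by
        have : 40 * K * dl σ K ≤ cs σ/2 := by
          unfold dl
          rw [mul_div_assoc', div_le_div_iff₀ (by positivity) (by norm_num)]
          nlinarith
        gcongr
  unfold Er
  have : cs σ = 2*σ/((σ+1)*(σ+3)) := rfl
  rw [← this] at h2
  linarith

lemma cEr (h : SolN σ N j μ u g ut ux uxx) (n : ℕ) (R K k : ℝ) {s : ℝ} (hs : 0 < s) (t : ℝ) :
    ContinuousOn (Er σ K k μ n R u g) (Set.Icc s t) := by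
  have a := h.cTT n R hs t
  have b := h.cTTu n R hs t
  unfold Er
  exact ((continuousOn_const.mul (continuousOn_const.mul a)).add (continuousOn_const.mul (continuousOn_const.mul (continuousOn_const.mul b)))).add continuousOn_const

lemma Er_tend (h : SolN σ N j μ u g ut ux uxx) (n : ℕ) (K k : ℝ) {s t : ℝ} (hs : 0 < s) (hst : s ≤ t) :
    Tendsto (fun R : ℕ => ∫ τ in s..t, Er σ K k μ n R u g τ) atTop (nhds 0) := by
  have a := TT_tend_time (n := n) h.sol.gi h.sol.gc hs hst
  have b := TT_tend_time (n := n) h.sol.ui h.sol.uc hs hst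
  have c1 : Tendsto (fun R : ℕ => 2*((n:ℝ)+2)/(R:ℝ)) atTop (nhds 0) := tendsto_const_div_atTop_nhds_zero_nat _
  have c2 : Tendsto (fun R : ℕ => ((n:ℝ)+2)*(4*(n+1)+2)/(R:ℝ)^2) atTop (nhds 0) :=
    Tendsto.div_atTop tendsto_const_nhds ((tendsto_pow_atTop two_ne_zero).comp tendsto_natCast_atTop_atTop)
  have := (((a.const_mul 2).const_mul (20*k^3)).add (((b.const_mul 2).const_mul (k^σ*k^3)).const_mul (cs σ + 8))).add
    (((c1.mul_const (17*(k^σ*k^3) * K)).add ((c2.mul_const (20*k^3 * (2 * K))).const_mul μ)).const_mul (t-s))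
  simp only [mul_zero, zero_mul, add_zero] at this
  refine this.congr fun R => ?_
  have ia := (h.cTT n R hs t)
  have ib := (h.cTTu n R hs t)
  rw [← Set.uIcc_of_le hst] at ia ib
  have ia' : IntervalIntegrable (fun τ => 20*k^3 * (2 * ∫ x, TT n R x * |g τ x|)) volume s t :=
    (ia.intervalIntegrable.const_mul 2).const_mul _
  have ib' : IntervalIntegrable (fun τ => (cs σ + 8) * (k^σ*k^3 * (2 * ∫ x, TT n R x * |u τ x|))) volume s t :=
    ((ib.intervalIntegrable.const_mul 2).const_mul _).const_mul _
  unfold Er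
  rw [intervalIntegral.integral_add (ia'.add ib') intervalIntegrable_const, intervalIntegral.integral_add ia' ib']
  simp only [intervalIntegral.integral_const_mul, intervalIntegral.integral_const, smul_eq_mul]

end SolN

noncomputable def BB (σ K T : ℝ) (m : ℕ) : ℝ :=
  T^(m+1) * CK σ K + 12*((m:ℝ)+1) * ((12*((m:ℝ)+1)/(cs σ/2))^m + T^m) * K

namespace SolN
variable {σ N : ℝ} {j : ℝ → ℝ} {μ : ℝ} {u g ut ux uxx : ℝ → ℝ → ℝ}

lemma u4_int (h : SolN σ N j μ u g ut ux uxx) {k τ : ℝ} (hτ : 0 < τ) (hk : ∀ x, |u τ x| ≤ k) :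
    Integrable (fun x => (u τ x)^4) := by
  have cu := h.sol.cu hτ
  refine Integrable.mono' ((h.sol.ui τ hτ).abs.const_mul (k^3)) (by fun_prop : Continuous fun x => (u τ x)^4).aestronglyMeasurable
    (Eventually.of_forall fun x => ?_)
  rw [Real.norm_eq_abs, abs_pow]
  have h1 : |u τ x|^3 ≤ k^3 := by have := hk x; gcongr
  calc |u τ x|^4 = |u τ x|^3 * |u τ x| := by ring
    _ ≤ _ := by gcongr

lemma Iz_up (h : SolN σ N j μ u g ut ux uxx) (n : ℕ) {R k : ℝ} (hR : 0 < R)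
    {τ : ℝ} (hτ : 0 < τ) (hk : ∀ x, |u τ x| ≤ k) :
    Iz (-R) R (chi n R) psi u τ ≤ 12 * ∫ x, (u τ x)^4 := by
  have hRR : -R ≤ R := by linarith
  have hk0 : 0 ≤ k := (abs_nonneg _).trans (hk 0)
  have cu := h.sol.cu hτ
  have i4 := h.u4_int hτ hk
  have k0 := c_chi n R
  have h40 : 0 ≤ ∫ x, (u τ x)^4 := integral_nonneg fun x => by positivity
  have cF := h.sol.Fz_cont (α := -R) (β := R) (psi_ent hk0) k0 hτ
  have hF : ∀ z, Fz (-R) R (chi n R) psi u τ z ≤ 12 * ∫ x, (u τ x)^4 := by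
    intro z
    have cP := h.sol.cPsi (psi_ent hk0) hτ z
    have a1 := ii_le_full i4 hRR
    have a2 := ii_le_full (i4.comp_add_right z) hRR
    rw [integral_add_right_eq_self (fun x => |(u τ x)^4|) z] at a2
    have e4 : ∀ x, |(u τ x)^4| = (u τ x)^4 := fun x => abs_of_nonneg (by positivity)
    simp only [e4] at a1 a2
    unfold Fz
    calc _ ≤ ∫ x in (-R)..R, 6 * ((u τ x)^4 + (u τ (x+z))^4) := by
          apply intervalIntegral.integral_mono_on hRR (Continuous.intervalIntegrable (by fun_prop) _ _)
            (Continuous.intervalIntegrable (by fun_prop) _ _)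
          intro x hx
          obtain ⟨c1, c2⟩ := chi_mem (n := n) hR hx
          have p0 : 0 ≤ psi (u τ x) (u τ (x+z)) := (by positivity : 0 ≤ (u τ x)^4).trans (psi_low _ _)
          exact (mul_le_of_le_one_left p0 c2).trans (psi_up _ _)
      _ ≤ _ := by
          rw [intervalIntegral.integral_const_mul,
            intervalIntegral.integral_add (Continuous.intervalIntegrable (by fun_prop) _ _) (Continuous.intervalIntegrable (by fun_prop) _ _)]
          linarith
  unfold Iz
  have := intervalIntegral.integral_mono_on zero_le_one (Continuous.intervalIntegrable (by fun_prop : Continuous fun z => (1-z) * Fz (-R) R (chi n R) psi u τ z) 0 1)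
      (intervalIntegrable_const (μ := volume) (c := 12 * ∫ x, (u τ x)^4)) (fun z hz => by
    have b1 := mul_le_mul_of_nonneg_left (hF z) (show 0 ≤ 1 - z by linarith [hz.2])
    have := mul_nonneg hz.1 h40
    linarith)
  simpa using this

lemma Iz_low (h : SolN σ N j μ u g ut ux uxx) (n : ℕ) {R k : ℝ} (hR : 0 < R)
    {τ : ℝ} (hτ : 0 < τ) (hk : ∀ x, |u τ x| ≤ k) :
    1/2 * (∫ x, (u τ x)^4) - 1/2 * (k^3 * (2 * ∫ x, TT n R x * |u τ x|)) ≤ Iz (-R) R (chi n R) psi u τ := by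
  have hRR : -R ≤ R := by linarith
  have hk0 : 0 ≤ k := (abs_nonneg _).trans (hk 0)
  have cu := h.sol.cu hτ
  have i4 := h.u4_int hτ hk
  have k0 := c_chi n R
  have cF := h.sol.Fz_cont (α := -R) (β := R) (psi_ent hk0) k0 hτ
  have hl := (abs_le.1 (loc2 (n := n) hR i4 (h.sol.ui τ hτ) (show 0 ≤ k^3 by positivity) (z := 0) (by simp) (fun x => by
    rw [abs_pow, mul_add]
    have h1 : |u τ x|^3 ≤ k^3 := by have := hk x; gcongr
    have h2 : 0 ≤ k^3 * |u τ (x+0)| := by positivity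
    have h3 := mul_le_mul_of_nonneg_right h1 (abs_nonneg (u τ x))
    calc |u τ x|^4 = |u τ x|^3 * |u τ x| := by ring
      _ ≤ _ := by linarith))).1
  set q := ∫ x in (-R)..R, chi n R x * (u τ x)^4 with hq
  have hF : ∀ z, q ≤ Fz (-R) R (chi n R) psi u τ z := by
    intro z
    have cP := h.sol.cPsi (psi_ent hk0) hτ z
    unfold Fz
    apply intervalIntegral.integral_mono_on hRR (Continuous.intervalIntegrable (by fun_prop) _ _)
            (Continuous.intervalIntegrable (by fun_prop) _ _)
    intro x hx
    exact mul_le_mul_of_nonneg_left (psi_low _ _) (chi_mem hR hx).1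
  have e1 : ∫ z in (0:ℝ)..1, (1-z) * q = 1/2 * q := by
    have e0 : ∫ z in (0:ℝ)..1, (1-z) = 1/2 := by
      rw [intervalIntegral.integral_sub (intervalIntegrable_const (μ := volume)) (Continuous.intervalIntegrable (u := fun z : ℝ => z) (by fun_prop) _ _)]
      rw [integral_id, intervalIntegral.integral_const]
      norm_num
    rw [intervalIntegral.integral_mul_const, e0]
  have : ∫ z in (0:ℝ)..1, (1-z) * q ≤ Iz (-R) R (chi n R) psi u τ := by
    unfold Iz
    apply intervalIntegral.integral_mono_on zero_le_one (Continuous.intervalIntegrable (by fun_prop) _ _)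
            (Continuous.intervalIntegrable (by fun_prop) _ _)
    intro z hz
    exact mul_le_mul_of_nonneg_left (hF z) (by linarith [hz.2])
  linarith

set_option maxHeartbeats 1000000 in
lemma wI_bd (h : SolN σ N j μ u g ut ux uxx) (n : ℕ) {R k K s t : ℝ} {m : ℕ} (hm : 3 ≤ σ*m) (hR : 0 < R)
    (hs : 0 < s) (hst : s ≤ t) (hk : ∀ τ, s ≤ τ → ∀ x, |u τ x| ≤ k) (hK : ∀ τ, s ≤ τ → ∫ x, |u τ x| ≤ K) :
    (t-s)^(m+1) * Iz (-R) R (chi n R) psi u t ≤ (t-s) * BB σ K (t-s) m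
      + (t-s)^(m+1) * ∫ τ in s..t, Er σ K k μ n R u g τ := by
  have hRR : -R ≤ R := by linarith
  have hσ := h.hσ0
  have hk0 : 0 ≤ k := (abs_nonneg _).trans (hk s le_rfl 0)
  have hS : ∀ t, s ≤ t → ∀ x, u t x ∈ Set.Icc (-k) k := fun t ht x => abs_le.1 (hk t ht x)
  have hcs := cs_pos hσ
  have hK0 : 0 ≤ K := (integral_nonneg fun x => abs_nonneg _).trans (hK s le_rfl)
  have hμ := h.sol.hμ
  have hCK : 0 ≤ CK σ K := by have := dl_pos hσ hK0; unfold CK; positivity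
  have hEr : ContinuousOn (Er σ K k μ n R u g) (Set.Icc s t) := h.cEr n R K k hs t
  have hI := h.sol.Iz_tcont (t := t) (psi_ent hk0) (c_chi n R) (fun x hx => chi_abs hR hx) hRR hs hS
  have hEr0 : ∀ τ, 0 ≤ Er σ K k μ n R u g τ := by
    intro τ
    have hg0 : 0 ≤ ∫ x, TT n R x * |g τ x| := integral_nonneg fun x => mul_nonneg (TT_nonneg x) (abs_nonneg _)
    have hu0 : 0 ≤ ∫ x, TT n R x * |u τ x| := integral_nonneg fun x => mul_nonneg (TT_nonneg x) (abs_nonneg _)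
    unfold Er; positivity
  have key := energy_ftc (E := fun τ => (τ-s)^(m+1) * Iz (-R) R (chi n R) psi u τ)
    (A := fun τ => (τ-s)^(m+1) * (∫ z in (0:ℝ)..1, (1-z) * Az (-R) R (chi n R) psp psr u ut τ z)
       + (((m:ℝ)+1)*(τ-s)^m) * Iz (-R) R (chi n R) psi u τ)
    (φ := fun τ => BB σ K (t-s) m + (t-s)^(m+1) * Er σ K k μ n R u g τ) hst
    ((by fun_prop : Continuous fun τ => (τ-s)^(m+1)).continuousOn.mul hI) ?_
    (continuousOn_const.add (continuousOn_const.mul hEr)) ?_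
  · have hEi : IntervalIntegrable (Er σ K k μ n R u g) volume s t := by
      rw [← Set.uIcc_of_le hst] at hEr
      exact hEr.intervalIntegrable
    rw [intervalIntegral.integral_add intervalIntegrable_const (hEi.const_mul _), intervalIntegral.integral_const_mul,
      intervalIntegral.integral_const, smul_eq_mul] at key
    simp only [sub_self, ne_eq, Nat.add_eq_zero_iff, one_ne_zero, and_false, not_false_eq_true, zero_pow, zero_mul, sub_zero] at key
    exact key
  · intro τ hτ
    have hτ0 : 0 < τ := hs.trans_le hτ.1
    have d := h.sol.Iz_rderiv (psi_ent hk0) (c_chi n R) (fun x hx => chi_abs hR hx) hRR hτ0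
      (fun t ht => hS t (hτ.1.trans ht))
    have w0 : Tendsto (fun k => (τ + k - s)^(m+1)) (nhdsWithin (0:ℝ) (Set.Ioi 0)) (nhds ((τ-s)^(m+1))) := by
      have : Continuous fun k => (τ + k - s)^(m+1) := by fun_prop
      have := (this.tendsto 0).mono_left (nhdsWithin_le_nhds (s := Set.Ioi 0))
      simpa using this
    have w1 : Tendsto (fun k => ((τ + k - s)^(m+1) - (τ-s)^(m+1))/k) (nhdsWithin (0:ℝ) (Set.Ioi 0)) (nhds (((m:ℝ)+1)*(τ-s)^m)) := by
      have hd : HasDerivAt (fun τ => (τ-s)^(m+1)) (((m:ℝ)+1)*(τ-s)^m) τ := by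
        have := ((hasDerivAt_id τ).sub_const s).pow (m+1)
        refine this.congr_deriv ?_
        simp
      have := hd.tendsto_slope_zero.mono_left
        (nhdsWithin_mono 0 (fun z (hz : z ∈ Set.Ioi (0:ℝ)) => ne_of_gt hz : Set.Ioi (0:ℝ) ⊆ {0}ᶜ))
      refine this.congr fun k => ?_
      rw [smul_eq_mul, inv_mul_eq_div]
    refine ((w0.mul d).add (w1.mul_const (Iz (-R) R (chi n R) psi u τ))).congr fun k => ?_
    ring
  · intro τ hτ
    have hτ0 : 0 < τ := hs.trans hτ.1
    have hkτ := hk τ hτ.1.le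
    have hy : 0 ≤ τ - s := by linarith [hτ.1]
    have hyT : τ - s ≤ t - s := by linarith [hτ.2]
    have a1 := h.A_bd n hR hτ0 (fun t ht => hk t (hτ.1.le.trans ht)) (hK τ hτ.1.le)
    have a2 := h.Iz_up n hR hτ0 hkτ
    have ui := h.sol.ui τ hτ0
    have i4 := h.u4_int hτ0 hkτ
    have iX := pw4_int hσ (h.sol.cu hτ0) ui hkτ
    have hβ : (0:ℝ) < 12*((m:ℝ)+1) := by positivity
    have y2 := integral_mono (i4.const_mul (12*((m:ℝ)+1) * (τ-s)^m))
      ((iX.const_mul (cs σ/2 * (τ-s)^(m+1))).add (ui.abs.const_mul (12*((m:ℝ)+1) * ((12*((m:ℝ)+1)/(cs σ/2))^m + (t-s)^m))))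
      (fun x => young2 (p := u τ x) hσ (half_pos hcs) hβ hm hy hyT)
    simp only [Pi.add_apply] at y2
    rw [integral_add (iX.const_mul _) (ui.abs.const_mul _), integral_const_mul, integral_const_mul, integral_const_mul] at y2
    have b1 := mul_le_mul_of_nonneg_left a1 (show 0 ≤ (τ-s)^(m+1) by positivity)
    have b2 := mul_le_mul_of_nonneg_left a2 (show 0 ≤ ((m:ℝ)+1)*(τ-s)^m by positivity)
    have hT : 0 ≤ t - s := hy.trans hyT
    have b3 : 12*((m:ℝ)+1) * ((12*((m:ℝ)+1)/(cs σ/2))^m + (t-s)^m) * ∫ x, |u τ x| ≤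
        12*((m:ℝ)+1) * ((12*((m:ℝ)+1)/(cs σ/2))^m + (t-s)^m) * K := by
      have := hK τ hτ.1.le
      gcongr
    have b4 : (τ-s)^(m+1) * (CK σ K + Er σ K k μ n R u g τ) ≤ (t-s)^(m+1) * (CK σ K + Er σ K k μ n R u g τ) := by
      have := hEr0 τ
      gcongr
    unfold BB
    linarith

lemma L4 (h : SolN σ N j μ u g ut ux uxx) {k K s t : ℝ} {m : ℕ} (hm : 3 ≤ σ*m)
    (hs : 0 < s) (hst : s < t) (hk : ∀ τ, s ≤ τ → ∀ x, |u τ x| ≤ k) (hK : ∀ τ, s ≤ τ → ∫ x, |u τ x| ≤ K) :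
    ∫ x, (u t x)^4 ≤ 2 * ((t-s) * BB σ K (t-s) m / (t-s)^(m+1)) := by
  have ht : 0 < t := hs.trans hst
  have hT : 0 < (t-s)^(m+1) := pow_pos (by linarith) _
  have e1 := h.Er_tend 0 K k hs hst.le
  have e2 := TT_tend_int (n := 0) (h.sol.ui t ht)
  have lim := (e1.const_mul 2).add ((e2.const_mul 2).const_mul (k^3))
  simp only [mul_zero, add_zero] at lim
  have lim2 := lim.const_add (2 * ((t-s) * BB σ K (t-s) m / (t-s)^(m+1)))
  rw [add_zero] at lim2
  refine ge_of_tendsto lim2 ?_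
  filter_upwards [eventually_gt_atTop 0] with R hR
  have hR : (0:ℝ) < R := by exact_mod_cast hR
  have a := h.wI_bd 0 hm hR hs hst.le hk hK
  have b := h.Iz_low 0 hR ht (hk t hst.le)
  have c : Iz (-R) R (chi 0 R) psi u t ≤ (t-s) * BB σ K (t-s) m / (t-s)^(m+1) + ∫ τ in s..t, Er σ K k μ 0 R u g τ := by
    rw [div_add' _ _ _ hT.ne', le_div_iff₀ hT]
    linarith
  linarith

lemma L2 (h : SolN σ N j μ u g ut ux uxx) {K t : ℝ} {m : ℕ} (hm : 3 ≤ σ*m)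
    (ht : 0 < t) (hK : ∀ τ, 0 < τ → ∫ x, |u τ x| ≤ K) :
    ∃ s ∈ Set.Icc (t/4) (t/2), (∃ k, ∀ τ, s ≤ τ → ∀ x, |u τ x| ≤ k) ∧
      ∫ x, (u t x)^2 ≤ K + 2 * ((t-s) * BB σ K (t-s) m / (t-s)^(m+1)) := by
  obtain ⟨s, hs, k, hk⟩ := h.exists_bdd (s := t/4) (t := t/2) (by linarith) (by linarith)
  have hs0 : 0 < s := by linarith [hs.1]
  have hst : s < t := by linarith [hs.2]
  have hk' : ∀ τ, s ≤ τ → ∀ x, |u τ x| ≤ k := fun τ hτ x => h.bdd_later hs0 hk hτ x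
  refine ⟨s, hs, ⟨k, hk'⟩, ?_⟩
  have a := h.L4 hm hs0 hst hk' (fun τ hτ => hK τ (hs0.trans_le hτ))
  have i4 := h.u4_int ht (hk' t hst.le)
  have ui := h.sol.ui t ht
  have b : ∫ x, (u t x)^2 ≤ ∫ x, (|u t x| + (u t x)^4) := by
    apply integral_mono_of_nonneg (Eventually.of_forall fun x => by positivity) (ui.abs.add i4)
    refine Eventually.of_forall fun x => ?_
    show u t x^2 ≤ |u t x| + u t x^4
    rw [← sq_abs, show (u t x)^4 = |u t x|^4 by rw [← abs_pow, abs_of_nonneg (by positivity)]]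
    have := abs_nonneg (u t x)
    rcases le_total (|u t x|) 1 with h | h
    · nlinarith [pow_nonneg this 4]
    · nlinarith [one_le_pow₀ (n := 2) h, sq_nonneg (|u t x|)]
  rw [integral_add ui.abs i4] at b
  have := hK t ht
  linarith

end SolN

lemma seq_deriv {f : ℝ → ℝ} {d x : ℝ} (h : HasDerivAt f d x) :
    Tendsto (fun n : ℕ => ((n:ℝ)+1) * (f (x + 1/((n:ℝ)+1)) - f x)) atTop (nhds d) := by
  have a := h.tendsto_slope_zero_right
  have b : Tendsto (fun n : ℕ => 1/((n:ℝ)+1)) atTop (nhdsWithin 0 (Set.Ioi 0)) := by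
    refine tendsto_nhdsWithin_iff.2 ⟨tendsto_one_div_add_atTop_nhds_zero_nat, Eventually.of_forall fun n => ?_⟩
    show (0:ℝ) < _
    positivity
  refine (a.comp b).congr fun n => ?_
  simp

set_option maxHeartbeats 1000000 in
lemma mkSolN {J φ : ℝ → ℝ} {q lam μ : ℝ} {u : ℝ → ℝ → ℝ} (hq1 : 1 < q) (hq2 : q < 2)
    (hJ0 : ∀ x, 0 ≤ J x) (hJ : Integrable J) (hJ1 : ∫ x, J x = 1)
    (hl : 0 < lam) (hμ : 0 < μ) (h : IsRescaledSol J q lam μ φ u) :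
    ∃ u' g ut ux uxx : ℝ → ℝ → ℝ, (∀ t, 0 < t → u' t = u t) ∧
      SolN (q-1) (lam^q) (fun y => lam * J (lam * y)) μ u' g ut ux uxx := by
  obtain ⟨hi, hc, hx2, ht1, hpde, -⟩ := h
  set j : ℝ → ℝ := fun y => lam * J (lam * y) with hjd
  set e : ℝ → ℝ := fun t => Real.exp (Real.log t) with hed
  have he : ∀ t, 0 < t → e t = t := fun t ht => Real.exp_log ht
  have he0 : ∀ t, 0 < e t := fun t => Real.exp_pos _
  have hji : Integrable j := (hJ.comp_mul_left' hl.ne').const_mul lam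
  have hj1 : ∫ y, j y = 1 := by
    rw [hjd, integral_const_mul, Measure.integral_comp_mul_left (fun y => J y), hJ1]
    rw [abs_of_pos (by positivity), smul_eq_mul]
    field_simp
  have hj0 : ∀ x, 0 ≤ j x := fun x => mul_nonneg hl.le (hJ0 _)
  have hut : ∀ t, 0 < t → ∀ x, HasDerivAt (fun s => u s x) (deriv (fun s => u s x) t) t := by
    intro t ht x
    exact (((ht1 x).differentiableOn (by norm_num)).differentiableAt (Ioi_mem_nhds ht)).hasDerivAt
  have hutc : ∀ x, ContinuousOn (fun s => deriv (fun s => u s x) s) (Set.Ioi 0) := fun x =>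
    (ht1 x).continuousOn_deriv_of_isOpen isOpen_Ioi (by norm_num)
  have hucont : ∀ t, 0 < t → Continuous (u t) := fun t ht => (hx2 t ht).continuous
  have hux : ∀ t, 0 < t → ∀ x, HasDerivAt (u t) (deriv (u t) x) x := fun t ht x =>
    ((hx2 t ht).differentiable (by norm_num) x).hasDerivAt
  have hd1 : ∀ t, 0 < t → ContDiff ℝ 1 (deriv (u t)) := fun t ht =>
    ((contDiff_succ_iff_deriv (n := 1)).1 (by simpa [one_add_one_eq_two] using hx2 t ht)).2.2
  have huxx : ∀ t, 0 < t → ∀ x, HasDerivAt (deriv (u t)) (deriv (deriv (u t)) x) x := fun t ht x =>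
    ((hd1 t ht).differentiable (by norm_num) x).hasDerivAt
  have huxxc : ∀ t, 0 < t → Continuous (deriv (deriv (u t))) := fun t ht =>
    (hd1 t ht).continuous_deriv (by norm_num)
  have hN : 0 ≤ lam^q := by positivity
  have logm : Measurable (fun p : ℝ × ℝ => (Real.log p.1, p.2)) :=
    (Real.measurable_log.comp measurable_fst).prodMk measurable_snd
  have hum : Measurable (Function.uncurry fun t => u (e t)) := by
    have : Measurable (Function.uncurry fun τ x => u (Real.exp τ) x) := by
      apply measurable_uncurry_of_continuous_of_measurable
      · intro x
        refine continuous_iff_continuousAt.2 fun τ => ?_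
        exact ContinuousAt.comp (f := Real.exp) (g := fun s => u s x)
          (hut _ (Real.exp_pos τ) x).continuousAt Real.continuous_exp.continuousAt
      · intro τ
        exact (hucont _ (Real.exp_pos τ)).measurable
    exact this.comp logm
  have hutm : Measurable (Function.uncurry fun t x => deriv (fun s => u s x) (e t)) := by
    have : Measurable (Function.uncurry fun τ x => deriv (fun s => u s x) (Real.exp τ)) := by
      apply measurable_uncurry_of_continuous_of_measurable
      · intro x
        exact (hutc x).comp_continuous Real.continuous_exp (fun τ => Real.exp_pos τ)
      · intro τ
        refine measurable_of_tendsto_metrizable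
          (f := fun (n : ℕ) x => ((n:ℝ)+1) * (u (Real.exp τ + 1/((n:ℝ)+1)) x - u (Real.exp τ) x)) ?_ ?_
        · intro n
          have h1 := hucont (Real.exp τ + 1/((n:ℝ)+1)) (by positivity)
          have h2 := hucont (Real.exp τ) (by positivity)
          exact (continuous_const.mul (h1.sub h2)).measurable
        · exact tendsto_pi_nhds.2 fun x => seq_deriv (hut _ (Real.exp_pos τ) x)
    exact this.comp logm
  have huxm : Measurable (Function.uncurry fun t x => deriv (u (e t)) x) := by
    refine measurable_of_tendsto_metrizable
      (f := fun (n : ℕ) (p : ℝ × ℝ) => ((n:ℝ)+1) * (u (e p.1) (p.2 + 1/((n:ℝ)+1)) - u (e p.1) p.2)) ?_ ?_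
    · intro n
      have h1 : Measurable fun p : ℝ × ℝ => (p.1, p.2 + 1/((n:ℝ)+1)) := by fun_prop
      have h2 := hum.comp h1
      exact measurable_const.mul (h2.sub hum)
    · exact tendsto_pi_nhds.2 fun p => seq_deriv (hux _ (he0 p.1) p.2)
  have huc : ∀ t₀, 0 < t₀ → Tendsto (fun t => ∫ x, |u (e t) x - u (e t₀) x|) (nhds t₀) (nhds 0) := by
    intro t₀ h0
    have a := hc t₀ h0.le
    rw [nhdsWithin_eq_nhds.2 (Ici_mem_nhds h0)] at a
    refine a.congr' ?_
    filter_upwards [Ioi_mem_nhds h0] with t ht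
    rw [he t ht, he t₀ h0]
  have hI : ∀ t, Integrable (u (e t)) := fun t => hi _ (he0 t).le
  refine ⟨fun t => u (e t), fun t => NLop (lam^q) j (u (e t)), fun t x => deriv (fun s => u s x) (e t),
    fun t x => deriv (u (e t)) x, fun t x => deriv (deriv (u (e t))) x, fun t ht => by simp only [he t ht], ?_⟩
  refine ⟨?_, by linarith, by linarith, hN, hj0, hji, hj1, fun t _ => rfl⟩
  refine ⟨hμ, ?_, fun p => by simp only [abs_neg], hum, hutm, huxm, fun t _ => hI t,
    fun t _ => NL_int hji (hI t), huc, ?_, ?_, ?_, fun t _ => hux _ (he0 t), fun t _ => huxx _ (he0 t),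
    fun t _ => huxxc _ (he0 t), ?_⟩
  · exact continuous_abs.rpow_const fun p => Or.inr (by linarith)
  · intro t₀ h0
    have a := ((huc t₀ h0).const_mul 2).const_mul (lam^q)
    simp only [mul_zero] at a
    refine squeeze_zero (fun t => integral_nonneg fun x => abs_nonneg _) (fun t => ?_) a
    have b := NL_l1 hj0 hji hj1 hN ((hI t).sub (hI t₀))
    refine le_trans (le_of_eq ?_) b
    apply integral_congr_ae
    filter_upwards [NL_sub (N := lam^q) hji (hI t) (hI t₀)] with x hx
    rw [hx]
    rfl
  · intro t ht x
    show HasDerivAt (fun s => u (e s) x) (deriv (fun s => u s x) (e t)) t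
    have a := hut t ht x
    rw [he t ht]
    refine a.congr_of_eventuallyEq ?_
    filter_upwards [Ioi_mem_nhds ht] with s hs
    rw [he s hs]
  · intro x
    refine (hutc x).congr fun s hs => ?_
    show deriv (fun s => u s x) (e s) = _
    rw [he s hs]
  · intro t _ x
    have a := hpde (e t) (he0 t) x
    have b : ∫ y, lam * J (lam * (x - y)) * u (e t) y = ∫ y, j y * u (e t) (x - y) := by
      rw [← integral_sub_left_eq_self (fun y => lam * J (lam * (x - y)) * u (e t) y) volume x]
      simp only [_root_.sub_sub_cancel, hjd]
    rw [b] at a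
    show _ = NLop (lam^q) j (u (e t)) x - _ + _
    simp only [NLop]
    linarith

lemma BB_mono {σ K T T' : ℝ} {m : ℕ} (hσ : 0 < σ) (hK : 0 ≤ K) (hT : 0 ≤ T) (hTT : T ≤ T') :
    BB σ K T m ≤ BB σ K T' m := by
  have h1 := cs_pos hσ
  have h2 := dl_pos hσ hK
  have h3 : 0 ≤ CK σ K := by unfold CK; positivity
  unfold BB
  gcongr

lemma BB_nonneg {σ K T : ℝ} {m : ℕ} (hσ : 0 < σ) (hK : 0 ≤ K) (hT : 0 ≤ T) :
    0 ≤ BB σ K T m := by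
  have h1 := cs_pos hσ
  have h2 := dl_pos hσ hK
  have h3 : 0 ≤ CK σ K := by unfold CK; positivity
  unfold BB
  positivity

lemma l1_le {J φ : ℝ → ℝ} {q lam μ K : ℝ} {u u' : ℝ → ℝ → ℝ}
    (hl : 0 < lam) (hK : ∫ y, |φ y| = K) (h : IsRescaledSol J q lam μ φ u)
    (hu : ∀ t, 0 < t → u' t = u t)
    (hd : ∀ s t, 0 < s → s ≤ t → ∫ x, |u' t x| ≤ ∫ x, |u' s x|) (t : ℝ) (ht : 0 < t) :
    ∫ x, |u' t x| ≤ K := by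
  obtain ⟨hi, hc, -, -, -, h0⟩ := h
  have e0 : ∫ x, |u 0 x| = K := by
    rw [integral_congr_ae (g := fun x => lam * |φ (lam * x)|)]
    · rw [integral_const_mul, Measure.integral_comp_mul_left (fun y => |φ y|), hK]
      rw [abs_of_pos (by positivity), smul_eq_mul]
      field_simp
    · filter_upwards [h0] with x hx
      rw [hx, abs_mul, abs_of_pos hl]
  have a := (hc 0 le_rfl).mono_left (nhdsWithin_mono 0 Set.Ioi_subset_Ici_self)
  have b := a.add_const K
  rw [zero_add] at b
  refine ge_of_tendsto b ?_
  filter_upwards [Ioo_mem_nhdsGT ht] with s hs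
  refine (hd s t hs.1 hs.2.le).trans ?_
  have i1 : Integrable (fun x => |u s x - u 0 x|) := ((hi s hs.1.le).sub (hi 0 le_rfl)).abs
  rw [hu s hs.1, ← e0, ← integral_add i1 (hi 0 le_rfl).abs]
  apply integral_mono (hi s hs.1.le).abs (i1.add (hi 0 le_rfl).abs)
  intro x
  show |u s x| ≤ |u s x - u 0 x| + |u 0 x|
  have := abs_add_le (u s x - u 0 x) (u 0 x)
  rwa [sub_add_cancel] at this

theorem stmt13
    (q t₁ K : ℝ) (hq1 : 1 < q) (hq2 : q < 2) (ht₁ : 0 < t₁) (hK : 0 ≤ K) :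
    -- a constant C(t₁, ‖φ‖₁, q), independent of λ, μ and t₂
    ∃ C : ℝ, 0 < C ∧
      ∀ (J φ : ℝ → ℝ) (lam μ t₂ : ℝ) (u : ℝ → ℝ → ℝ),
        (∀ x, 0 ≤ J x) → (∀ x, J (-x) = J x) → Integrable J → (∫ x, J x) = 1 →
        0 < lam → 0 < μ → Integrable φ → (∫ y, |φ y|) = K →
        IsRescaledSol J q lam μ φ u → t₁ < t₂ →
        lam ^ q * ∫ t in Set.Ioc t₁ t₂, ∫ x, ∫ y,
            lam * J (lam * (x - y)) * (u t x - u t y) ^ 2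
          ≤ C := by
  have hσ : 0 < q - 1 := by linarith
  obtain ⟨m, hm0⟩ := exists_nat_ge (3/(q-1))
  have hm : 3 ≤ (q-1) * m := by
    rw [div_le_iff₀ hσ] at hm0
    linarith
  have hB := BB_nonneg (m := m) hσ hK ht₁.le
  refine ⟨K + 2 * (t₁ * BB (q-1) K t₁ m / (t₁/2)^(m+1)) + 1, by positivity, ?_⟩
  intro J φ lam μ t₂ u hJ0 _ hJ hJ1 hl hμ _ hφK hu ht
  obtain ⟨u', g, ut, ux, uxx, hu', h⟩ := mkSolN hq1 hq2 hJ0 hJ hJ1 hl hμ hu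
  have hL1 := l1_le hl hφK hu hu' (fun s t hs hst => h.l1_decr hs hst)
  obtain ⟨s, hs, ⟨k, hk⟩, h2⟩ := h.L2 hm ht₁ hL1
  have hd := h.dissip ht₁ ht.le (fun τ hτ x => hk τ (by linarith [hs.2]) x)
  have e : ∫ t in Set.Ioc t₁ t₂, ∫ x, ∫ y, lam * J (lam * (x - y)) * (u t x - u t y) ^ 2
      = ∫ τ in Set.Ioc t₁ t₂, ∫ x, ∫ y, lam * J (lam * y) * (u' τ x - u' τ (x-y))^2 := by
    apply setIntegral_congr_fun measurableSet_Ioc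
    intro τ hτ
    have : 0 < τ := ht₁.trans hτ.1
    simp only [hu' τ this]
    congr 1
    funext x
    rw [← integral_sub_left_eq_self (fun y => lam * J (lam * (x - y)) * (u τ x - u τ y) ^ 2) volume x]
    simp only [_root_.sub_sub_cancel]
  rw [e]
  have hT1 : t₁/2 ≤ t₁ - s := by linarith [hs.2]
  have hT2 : t₁ - s ≤ t₁ := by linarith [hs.1]
  have hb := BB_mono (m := m) hσ hK (by linarith) hT2
  have hb0 := BB_nonneg (m := m) (T := t₁ - s) hσ hK (by linarith)
  have : (t₁-s) * BB (q-1) K (t₁-s) m / (t₁-s)^(m+1) ≤ t₁ * BB (q-1) K t₁ m / (t₁/2)^(m+1) := by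
    gcongr
  linarith
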